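/- arXiv:0707.0532 — 2 statements merged into one kernel-verified Lean document; each statement's English description precedes it below -/
import Mathlib

section
/- Generalized MacMahon's formula (Hall-Littlewood's case, boxed version): For every pair of positive integers r, c, the identity ∑_{π ∈ P(r,c)} A_π(t) s^{|π|} = ∏_{i=1}^{r} ∏_{j=1}^{c} (1 - t s^{i+j-1}) / (1 - s^{i+j-1}) holds, as an identity of formal power series in s whose coefficients are polynomials in t (equivalently, for real parameters 0 ≤ t, s < 1). -/
open scoped BigOperators

/-- A plane partition: a filling of a Young diagram (its support) with positive
integers that are weakly decreasing along rows and columns.  Entries outside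
the support are recorded as `0`, and rows and columns are indexed from `0`
(so box `(i, j)` is box `(i+1, j+1)` in the 1-indexed convention). -/
structure PlanePartition where
  part : ℕ → ℕ → ℕ
  row_decr : ∀ i j, part i (j + 1) ≤ part i j
  col_decr : ∀ i j, part (i + 1) j ≤ part i j
  finite_supp : {p : ℕ × ℕ | part p.1 p.2 ≠ 0}.Finite

namespace PlanePartition

/-- The weight `|π|`: the sum of all entries of `π`. -/
noncomputable def weight (π : PlanePartition) : ℕ := ∑ᶠ p : ℕ × ℕ, π.part p.1 p.2

/-- The trace `tr(π)`: the sum of the diagonal entries of `π`. -/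
noncomputable def trace (π : PlanePartition) : ℕ := ∑ᶠ i : ℕ, π.part i i

/-- A strict plane partition: all of the diagonal partitions of `π` have
distinct parts, i.e. every diagonal of `π` is strictly decreasing where
nonzero. -/
def IsStrict (π : PlanePartition) : Prop :=
  ∀ i j, π.part i j ≠ 0 → π.part (i + 1) (j + 1) < π.part i j

end PlanePartition

/-- Two boxes of `ℕ × ℕ` are adjacent when they share an edge. -/
def Adjacent (p q : ℕ × ℕ) : Prop :=
  (p.1 = q.1 ∧ (p.2 + 1 = q.2 ∨ q.2 + 1 = p.2)) ∨
  (p.2 = q.2 ∧ (p.1 + 1 = q.1 ∨ q.1 + 1 = p.1))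

/-- One step of connectivity for a filling `g` of boxes by natural numbers:
adjacent boxes carrying the same nonzero entry. -/
def ConnStep (g : ℕ → ℕ → ℕ) (p q : ℕ × ℕ) : Prop :=
  Adjacent p q ∧ g p.1 p.2 = g q.1 q.2 ∧ g p.1 p.2 ≠ 0

/-- `p` and `q` belong to the same connected component of `g`: both are boxes
of the support and they are joined by a chain of adjacent boxes all filled
with the same number. -/
def SameComponent (g : ℕ → ℕ → ℕ) (p q : ℕ × ℕ) : Prop :=
  g p.1 p.2 ≠ 0 ∧ Relation.ReflTransGen (ConnStep g) p q

/-- The set of connected components of a filling `g`. -/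
def components (g : ℕ → ℕ → ℕ) : Set (Set (ℕ × ℕ)) :=
  {C | ∃ p : ℕ × ℕ, g p.1 p.2 ≠ 0 ∧ C = {q | SameComponent g p q}}

/-- `k(g)`: the number of connected components. -/
noncomputable def numComponents (g : ℕ → ℕ → ℕ) : ℕ := (components g).ncard

/-- The level `h(p)` of a box `p`: the smallest positive `h` such that the box
shifted diagonally by `h` does not belong to the same connected component. -/
noncomputable def level (g : ℕ → ℕ → ℕ) (p : ℕ × ℕ) : ℕ :=
  sInf {h : ℕ | 0 < h ∧ ¬ SameComponent g p (p.1 + h, p.2 + h)}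

/-- One step of border connectivity: adjacent boxes with the same nonzero
entry and the same level. -/
def BorderStep (g : ℕ → ℕ → ℕ) (p q : ℕ × ℕ) : Prop :=
  ConnStep g p q ∧ level g p = level g q

/-- `p` and `q` belong to the same border component. -/
def SameBorder (g : ℕ → ℕ → ℕ) (p q : ℕ × ℕ) : Prop :=
  g p.1 p.2 ≠ 0 ∧ Relation.ReflTransGen (BorderStep g) p q

/-- The set of border components of a filling `g` (each border component is a
maximal connected set of boxes with the same entry and the same level). -/
def borderComponents (g : ℕ → ℕ → ℕ) : Set (Set (ℕ × ℕ)) :=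
  {B | ∃ p : ℕ × ℕ, g p.1 p.2 ≠ 0 ∧ B = {q | SameBorder g p q}}

/-- The (common) level of the boxes of a border component `B`. -/
noncomputable def borderLevel (g : ℕ → ℕ → ℕ) (B : Set (ℕ × ℕ)) : ℕ :=
  sInf {h : ℕ | ∃ p ∈ B, level g p = h}

/-- The polynomial `A_π(t)`: the product over all border components `B` of
`π` of `(1 - t ^ level(B))`; equivalently the product over connected
components `C` of `P_C(t) = ∏_i (1 - t^i)^{n_i}` where `n_i` is the number of
`i`-level border components of `C`. -/
noncomputable def Apoly (t : ℝ) (π : PlanePartition) : ℝ :=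
  ∏ᶠ B ∈ borderComponents π.part, (1 - t ^ borderLevel π.part B)

/-- The function `f(n, m)` (for parameters `q`, `t`); the empty product gives
`f(0, m) = 1`. -/
noncomputable def fmac (q t : ℝ) (n m : ℕ) : ℝ :=
  ∏ i ∈ Finset.range n, (1 - q ^ i * t ^ (m + 1)) / (1 - q ^ (i + 1) * t ^ m)

/-- `F_π(i,j)(q,t)`, associated to the box `(i, j)` of `π`: with
`λ = (π(i,j), π(i+1,j+1), …)`, `μ = (π(i+1,j), π(i+2,j+1), …)` and
`ν = (π(i,j+1), π(i+1,j+2), …)`, this is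
`∏_{m ≥ 0} f(λ₁-μ_{m+1},m) f(λ₁-ν_{m+1},m) / (f(λ₁-λ_{m+1},m) f(λ₁-λ_{m+2},m))`
(only finitely many factors differ from `1`). -/
noncomputable def Fbox (q t : ℝ) (π : PlanePartition) (i j : ℕ) : ℝ :=
  ∏' m : ℕ,
    (fmac q t (π.part i j - π.part (i + 1 + m) (j + m)) m *
        fmac q t (π.part i j - π.part (i + m) (j + 1 + m)) m) /
      (fmac q t (π.part i j - π.part (i + m) (j + m)) m *
        fmac q t (π.part i j - π.part (i + m + 1) (j + m + 1)) m)

/-- `F_π(q,t)`: the product of `F_π(i,j)(q,t)` over all boxes `(i,j)` of the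
support of `π`. -/
noncomputable def Fmac (q t : ℝ) (π : PlanePartition) : ℝ :=
  ∏ᶠ p : ℕ × ℕ, if π.part p.1 p.2 ≠ 0 then Fbox q t π p.1 p.2 else 1

/-- The infinite `q`-Pochhammer symbol `(x; q)_∞ = ∏_{n ≥ 0} (1 - x qⁿ)`. -/
noncomputable def qPoch (x q : ℝ) : ℝ := ∏' n : ℕ, (1 - x * q ^ n)

namespace HallLittlewood

/-- Prepending an entry to a finitely supported sequence. -/
noncomputable def consEquiv : ℕ × (ℕ →₀ ℕ) ≃ (ℕ →₀ ℕ) where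
  toFun x := Finsupp.single 0 x.1 + x.2.embDomain ⟨Nat.succ, Nat.succ_injective⟩
  invFun f := (f 0, f.comapDomain Nat.succ Nat.succ_injective.injOn)
  left_inv x := by
    obtain ⟨n, f⟩ := x
    have h (k) : (f.embDomain ⟨Nat.succ, Nat.succ_injective⟩) (k + 1) = f k :=
      Finsupp.embDomain_apply_self ⟨Nat.succ, Nat.succ_injective⟩ f k
    ext k
    · simp [Finsupp.embDomain_of_notMem_range]
    · simp [h]
  right_inv f := by
    ext k
    cases k with
    | zero => simp [Finsupp.embDomain_of_notMem_range]
    | succ k =>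
      have := Finsupp.embDomain_apply_self ⟨Nat.succ, Nat.succ_injective⟩
        (f.comapDomain Nat.succ Nat.succ_injective.injOn) k
      simpa using this

/-- The sequence with its first entry removed. -/
noncomputable def tail (f : ℕ →₀ ℕ) : ℕ →₀ ℕ :=
  f.comapDomain Nat.succ Nat.succ_injective.injOn

@[simp] lemma tail_apply (f : ℕ →₀ ℕ) (k : ℕ) : tail f k = f (k + 1) := rfl

lemma consEquiv_zero (n : ℕ) (f : ℕ →₀ ℕ) : consEquiv (n, f) 0 = n :=
  congrArg Prod.fst (consEquiv.symm_apply_apply (n, f))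

lemma tail_consEquiv (n : ℕ) (f : ℕ →₀ ℕ) : tail (consEquiv (n, f)) = f :=
  congrArg Prod.snd (consEquiv.symm_apply_apply (n, f))

lemma exists_forall_ge_eq_zero (f : ℕ →₀ ℕ) : ∃ N, ∀ k, N ≤ k → f k = 0 := by
  refine ⟨f.support.sup id + 1, fun k hk => ?_⟩
  by_contra h
  have : k ≤ f.support.sup id := Finset.le_sup (f := id) (Finsupp.mem_support_iff.2 h)
  omega

lemma finprod_nat_succ (F : ℕ → ℝ) (hF : ∃ N, ∀ k, N ≤ k → F k = 1) :
    ∏ᶠ k, F k = F 0 * ∏ᶠ k, F (k + 1) := by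
  obtain ⟨N, hN⟩ := hF
  rw [finprod_eq_prod_of_mulSupport_subset (s := Finset.range (N + 1)),
    finprod_eq_prod_of_mulSupport_subset (s := Finset.range N), Finset.prod_range_succ', mul_comm]
  · intro k hk
    by_contra h
    exact hk (hN _ (by simp at h; omega))
  · intro k hk
    by_contra h
    exact hk (hN _ (by simp at h; omega))

/-- The product of local weights along three finitely supported sequences. -/
noncomputable def transfer (T : ℕ → ℕ → ℕ → ℕ → ℕ → ℕ → ℝ) (f h g : ℕ →₀ ℕ) : ℝ :=
  ∏ᶠ k, T (f k) (f (k + 1)) (h k) (h (k + 1)) (g k) (g (k + 1))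

lemma transfer_eq {T : ℕ → ℕ → ℕ → ℕ → ℕ → ℕ → ℝ} (hT : T 0 0 0 0 0 0 = 1) (f h g : ℕ →₀ ℕ) :
    transfer T f h g =
      T (f 0) (f 1) (h 0) (h 1) (g 0) (g 1) * transfer T (tail f) (tail h) (tail g) := by
  obtain ⟨N₁, h₁⟩ := exists_forall_ge_eq_zero f
  obtain ⟨N₂, h₂⟩ := exists_forall_ge_eq_zero h
  obtain ⟨N₃, h₃⟩ := exists_forall_ge_eq_zero g
  refine finprod_nat_succ _ ⟨N₁ + N₂ + N₃, fun k hk => ?_⟩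
  rw [h₁ k (by omega), h₁ (k + 1) (by omega), h₂ k (by omega), h₂ (k + 1) (by omega),
    h₃ k (by omega), h₃ (k + 1) (by omega), hT]

lemma hasSum_transfer {T : ℕ → ℕ → ℕ → ℕ → ℕ → ℕ → ℝ} (hT : T 0 0 0 0 0 0 = 1)
    (f g : ℕ →₀ ℕ) (n : ℕ) (A : Finset ℕ) (S : ℕ → ℝ)
    (hA : ∀ h, h 0 ∉ A → transfer T (tail f) h (tail g) = 0)
    (hS : ∀ k ∈ A, HasSum (fun h => if h 0 = k then transfer T (tail f) h (tail g) else 0) (S k)) :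
    HasSum (fun h => if h 0 = n then transfer T f h g else 0)
      (∑ k ∈ A, T (f 0) (f 1) n k (g 0) (g 1) * S k) := by
  have key : HasSum (fun h => T (f 0) (f 1) n (h 0) (g 0) (g 1) * transfer T (tail f) h (tail g))
      (∑ k ∈ A, T (f 0) (f 1) n k (g 0) (g 1) * S k) := by
    have := hasSum_sum fun k hk => (hS k hk).mul_left (T (f 0) (f 1) n k (g 0) (g 1))
    have e (h : ℕ →₀ ℕ) : T (f 0) (f 1) n (h 0) (g 0) (g 1) * transfer T (tail f) h (tail g) =
        ∑ k ∈ A, T (f 0) (f 1) n k (g 0) (g 1) *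
          if h 0 = k then transfer T (tail f) h (tail g) else 0 := by
      simp only [mul_ite, mul_zero, Finset.sum_ite_eq]
      split_ifs with hh
      · rfl
      · rw [hA h hh, mul_zero]
    simpa only [e] using this
  have inj : Function.Injective fun h : ℕ →₀ ℕ => consEquiv (n, h) := fun a b hab => by
    simpa using hab
  rw [← inj.hasSum_iff]
  · convert key using 2 with h
    have e1 : consEquiv (n, h) 1 = h 0 := by
      rw [← tail_apply (consEquiv (n, h)) 0, tail_consEquiv]
    simp only [Function.comp_apply, consEquiv_zero, if_true]
    rw [transfer_eq hT, consEquiv_zero, tail_consEquiv, e1]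
  · intro h hh
    rw [if_neg]
    rintro rfl
    exact hh ⟨tail h, consEquiv.apply_symm_apply h⟩

/-- The local weight attached to multiplicities `a - a'` and `b - b'`. -/
def stepWeight (t : ℝ) (a a' b b' : ℕ) : ℝ := if b + a' < a + b' then 1 - t ^ (a - a') else 1

/-- The local weight of adding a horizontal strip. -/
def growFactor (t : ℝ) (a a' b b' : ℕ) : ℝ :=
  if a ≤ b ∧ b ≤ a + 1 then stepWeight t a a' b b' else 0

/-- The local weight of removing a horizontal strip. -/
def shrinkFactor (t : ℝ) (a a' b b' : ℕ) : ℝ :=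
  if b ≤ a ∧ a ≤ b + 1 then stepWeight t a a' b b' else 0

/-- The local weight of growing and then shrinking. -/
def peakFactor (t z : ℝ) (a a' b b' c c' : ℕ) : ℝ :=
  growFactor t a a' b b' * shrinkFactor t b b' c c' * z ^ (b - c)

/-- The local weight of shrinking and then growing. -/
def valleyFactor (t z : ℝ) (a a' b b' c c' : ℕ) : ℝ :=
  shrinkFactor t a a' b b' * growFactor t b b' c c' * z ^ (a - b)

lemma peakFactor_zero (t z : ℝ) : peakFactor t z 0 0 0 0 0 0 = 1 := by
  simp [peakFactor, growFactor, shrinkFactor, stepWeight]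

lemma valleyFactor_zero (t z : ℝ) : valleyFactor t z 0 0 0 0 0 0 = 1 := by
  simp [valleyFactor, growFactor, shrinkFactor, stepWeight]

/-- The linear relations between the sums over peaks `V` and over valleys `U`, indexed by the first
entry of the middle sequence, when the first entries of the outer sequences are `a` and `c`. -/
structure Intertwined (t z : ℝ) (a c : ℕ) (V U : ℕ → ℝ) : Prop where
  peak_zero : ∀ n, ¬ (a ≤ n ∧ n ≤ a + 1 ∧ c ≤ n ∧ n ≤ c + 1) → V n = 0
  valley_zero : ∀ n, ¬ (n ≤ a ∧ a ≤ n + 1 ∧ n ≤ c ∧ c ≤ n + 1) → U n = 0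
  eq_zero : a = 0 → c = 0 → (1 - z) * V 0 = (1 - z) * U 0 ∧ (1 - z) * V 1 = z * (1 - t) * U 0
  eq_succ : ∀ p, a = p + 1 → c = p + 1 →
    (1 - z) * V (p + 1) = (1 - z) * U (p + 1) + (1 - t) * U p ∧
    (1 - z) * V (p + 2) = z * (1 - t) * U (p + 1) + t * (1 - z) * U p
  left_succ : ∀ p, a = p + 1 → c = p → (1 - z) * V (p + 1) = (1 - t * z) * U p
  right_succ : ∀ p, a = p → c = p + 1 → (1 - z) * V (p + 1) = (1 - t * z) * U p

lemma pow_of_eq_zero (x : ℝ) {n : ℕ} (h : n = 0) : x ^ n = 1 := by rw [h, pow_zero]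

lemma pow_of_eq_one (x : ℝ) {n : ℕ} (h : n = 1) : x ^ n = x := by rw [h, pow_one]

set_option linter.unusedSimpArgs false in
lemma Intertwined.step {t z : ℝ} {a a' c c' : ℕ} {V U : ℕ → ℝ} (h : Intertwined t z a' c' V U)
    (ha : a' ≤ a) (hc : c' ≤ c) :
    Intertwined t z a c
      (fun n => ∑ k ∈ Finset.Icc a' (a' + 1), peakFactor t z a a' n k c c' * V k)
      (fun n => ∑ k ∈ Finset.Icc (a' - 1) a', valleyFactor t z a a' n k c c' * U k) := by
  obtain ⟨m, rfl⟩ := Nat.exists_eq_add_of_le ha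
  obtain ⟨l, rfl⟩ := Nat.exists_eq_add_of_le hc
  have hV (F : ℕ → ℝ) : ∑ k ∈ Finset.Icc a' (a' + 1), F k = F a' + F (a' + 1) := by
    rw [Finset.sum_Icc_succ_top (by omega)]; simp
  have hU0 (e : a' = 0) (F : ℕ → ℝ) : ∑ k ∈ Finset.Icc (a' - 1) a', F k = F 0 := by
    subst e; simp
  have hU1 (q : ℕ) (e : a' = q + 1) (F : ℕ → ℝ) :
      ∑ k ∈ Finset.Icc (a' - 1) a', F k = F q + F (q + 1) := by
    subst e; rw [Nat.add_sub_cancel, Finset.sum_Icc_succ_top (by omega)]; simp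
  have hcases : ((∀ n, V n = 0) ∧ ∀ n, U n = 0) ∨ (a' = 0 ∧ c' = 0) ∨
      (∃ q, a' = q + 1 ∧ c' = q + 1) ∨ a' = c' + 1 ∨ c' = a' + 1 := by
    by_cases h₁ : a' ≤ c' + 1 ∧ c' ≤ a' + 1
    · rcases Nat.eq_zero_or_pos a' with h₂ | h₂
      · omega
      · by_cases h₃ : a' = c'
        · exact Or.inr (Or.inr (Or.inl ⟨a' - 1, by omega, by omega⟩))
        · omega
    · exact Or.inl ⟨fun n => h.peak_zero n (by omega), fun n => h.valley_zero n (by omega)⟩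
  constructor
  · intro n hn
    refine Finset.sum_eq_zero fun k _ => ?_
    have : peakFactor t z (a' + m) a' n k (c' + l) c' = 0 := by
      unfold peakFactor growFactor shrinkFactor
      split_ifs <;> first | omega | simp
    rw [this, zero_mul]
  · intro n hn
    refine Finset.sum_eq_zero fun k _ => ?_
    have : valleyFactor t z (a' + m) a' n k (c' + l) c' = 0 := by
      unfold valleyFactor growFactor shrinkFactor
      split_ifs <;> first | omega | simp
    rw [this, zero_mul]
  · rintro h1 h2
    obtain rfl : a' = 0 := by omega
    obtain rfl : c' = 0 := by omega
    obtain rfl : m = 0 := by omega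
    obtain rfl : l = 0 := by omega
    obtain ⟨e1, e2⟩ := h.eq_zero rfl rfl
    simp only [hV, hU0 rfl, peakFactor, valleyFactor, growFactor, shrinkFactor, stepWeight]
    simp (disch := omega) only [if_pos, if_neg, pow_of_eq_zero, pow_of_eq_one]
    constructor
    · linear_combination e1
    · linear_combination z * (1 - t) * e1 + z * e2
  · intro p h1 h2
    rcases hcases with ⟨hV0, hU0⟩ | ⟨rfl, rfl⟩ | ⟨q, rfl, rfl⟩ | rfl | rfl
    · simp [hV0, hU0]
    · obtain ⟨e1, e2⟩ := h.eq_zero rfl rfl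
      obtain rfl : l = m := by omega
      obtain rfl : l = p + 1 := by omega
      obtain ⟨u, hu⟩ : ∃ u, u = t ^ (p + 1) := ⟨_, rfl⟩
      have t0 : ∀ n, n = p + 1 → t ^ n = u := by rintro _ rfl; exact hu.symm
      have t1 : ∀ n, n = p + 1 + 1 → t ^ n = u * t := by rintro _ rfl; rw [hu, pow_succ]
      have t2 : ∀ n, n = p + 1 + 2 → t ^ n = u * t * t := by rintro _ rfl; rw [hu, pow_succ, pow_succ]
      simp only [hV, hU0 rfl, peakFactor, valleyFactor, growFactor, shrinkFactor, stepWeight]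
      simp (disch := omega) only [if_pos, if_neg, pow_of_eq_zero, pow_of_eq_one, t0, t1, t2]
      constructor
      · linear_combination e1 + (1 - u) * e2
      · linear_combination z * (1 - u * t) * e1 + z * e2
    · obtain ⟨e1, e2⟩ := h.eq_succ q rfl rfl
      obtain rfl : l = m := by omega
      obtain rfl : p = q + l := by omega
      obtain ⟨u, hu⟩ : ∃ u, u = t ^ (l) := ⟨_, rfl⟩
      have t0 : ∀ n, n = l → t ^ n = u := by rintro _ rfl; exact hu.symm
      have t1 : ∀ n, n = l + 1 → t ^ n = u * t := by rintro _ rfl; rw [hu, pow_succ]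
      have t2 : ∀ n, n = l + 2 → t ^ n = u * t * t := by rintro _ rfl; rw [hu, pow_succ, pow_succ]
      simp only [hV, hU1 q rfl, peakFactor, valleyFactor, growFactor, shrinkFactor, stepWeight]
      simp (disch := omega) only [if_pos, if_neg, pow_of_eq_zero, pow_of_eq_one, t0, t1, t2]
      constructor
      · linear_combination e1 + (1 - u) * e2
      · linear_combination z * (1 - u * t) * e1 + z * e2
    · have e := h.left_succ c' rfl rfl
      obtain rfl : l = m + 1 := by omega
      obtain rfl : p = c' + m := by omega
      obtain ⟨u, hu⟩ : ∃ u, u = t ^ (m) := ⟨_, rfl⟩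
      have t0 : ∀ n, n = m → t ^ n = u := by rintro _ rfl; exact hu.symm
      have t1 : ∀ n, n = m + 1 → t ^ n = u * t := by rintro _ rfl; rw [hu, pow_succ]
      have t2 : ∀ n, n = m + 2 → t ^ n = u * t * t := by rintro _ rfl; rw [hu, pow_succ, pow_succ]
      simp only [hV, hU1 c' rfl, h.peak_zero (c' + 2) (by omega), h.valley_zero (c' + 1) (by omega),
        peakFactor, valleyFactor, growFactor, shrinkFactor, stepWeight]
      simp (disch := omega) only [if_pos, if_neg, pow_of_eq_zero, pow_of_eq_one, t0, t1, t2]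
      constructor
      · linear_combination e
      · linear_combination z * e
    · have e := h.right_succ a' rfl rfl
      obtain rfl : m = l + 1 := by omega
      obtain rfl : p = a' + l := by omega
      have hUr (F : ℕ → ℝ) : ∑ k ∈ Finset.Icc (a' - 1) a', F k * U k = F a' * U a' := by
        refine Finset.sum_eq_single_of_mem a' (by simp) fun k _ hk => ?_
        rw [h.valley_zero k (by omega), mul_zero]
      obtain ⟨u, hu⟩ : ∃ u, u = t ^ (l) := ⟨_, rfl⟩
      have t0 : ∀ n, n = l → t ^ n = u := by rintro _ rfl; exact hu.symm
      have t1 : ∀ n, n = l + 1 → t ^ n = u * t := by rintro _ rfl; rw [hu, pow_succ]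
      have t2 : ∀ n, n = l + 2 → t ^ n = u * t * t := by rintro _ rfl; rw [hu, pow_succ, pow_succ]
      simp only [hV, hUr, h.peak_zero a' (by omega),
        peakFactor, valleyFactor, growFactor, shrinkFactor, stepWeight]
      simp (disch := omega) only [if_pos, if_neg, pow_of_eq_zero, pow_of_eq_one, t0, t1, t2]
      constructor
      · linear_combination (1 - u * t) * e
      · linear_combination z * (1 - u * t) * e
  · intro p h1 h2
    rcases hcases with ⟨hV0, hU0⟩ | ⟨rfl, rfl⟩ | ⟨q, rfl, rfl⟩ | rfl | rfl
    · simp [hV0, hU0]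
    · obtain ⟨e1, e2⟩ := h.eq_zero rfl rfl
      obtain rfl : m = l + 1 := by omega
      obtain rfl : p = 0 + l := by omega
      obtain ⟨u, hu⟩ : ∃ u, u = t ^ (l) := ⟨_, rfl⟩
      have t0 : ∀ n, n = l → t ^ n = u := by rintro _ rfl; exact hu.symm
      have t1 : ∀ n, n = l + 1 → t ^ n = u * t := by rintro _ rfl; rw [hu, pow_succ]
      have t2 : ∀ n, n = l + 2 → t ^ n = u * t * t := by rintro _ rfl; rw [hu, pow_succ, pow_succ]
      simp only [hV, hU0 rfl, peakFactor, valleyFactor, growFactor, shrinkFactor, stepWeight]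
      simp (disch := omega) only [if_pos, if_neg, pow_of_eq_zero, pow_of_eq_one, t0, t1, t2]
      linear_combination z * (1 - u * t) * e1 + z * (1 - u * t) * e2
    · obtain ⟨e1, e2⟩ := h.eq_succ q rfl rfl
      obtain rfl : m = l + 1 := by omega
      obtain rfl : p = q + 1 + l := by omega
      obtain ⟨u, hu⟩ : ∃ u, u = t ^ (l) := ⟨_, rfl⟩
      have t0 : ∀ n, n = l → t ^ n = u := by rintro _ rfl; exact hu.symm
      have t1 : ∀ n, n = l + 1 → t ^ n = u * t := by rintro _ rfl; rw [hu, pow_succ]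
      have t2 : ∀ n, n = l + 2 → t ^ n = u * t * t := by rintro _ rfl; rw [hu, pow_succ, pow_succ]
      simp only [hV, hU1 q rfl, peakFactor, valleyFactor, growFactor, shrinkFactor, stepWeight]
      simp (disch := omega) only [if_pos, if_neg, pow_of_eq_zero, pow_of_eq_one, t0, t1, t2]
      linear_combination z * (1 - u * t) * e1 + z * (1 - u * t) * e2
    · have e := h.left_succ c' rfl rfl
      obtain rfl : l = m := by omega
      obtain rfl : p = c' + l := by omega
      obtain ⟨u, hu⟩ : ∃ u, u = t ^ (l) := ⟨_, rfl⟩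
      have t0 : ∀ n, n = l → t ^ n = u := by rintro _ rfl; exact hu.symm
      have t1 : ∀ n, n = l + 1 → t ^ n = u * t := by rintro _ rfl; rw [hu, pow_succ]
      have t2 : ∀ n, n = l + 2 → t ^ n = u * t * t := by rintro _ rfl; rw [hu, pow_succ, pow_succ]
      simp only [hV, hU1 c' rfl, h.peak_zero (c' + 2) (by omega), h.valley_zero (c' + 1) (by omega),
        peakFactor, valleyFactor, growFactor, shrinkFactor, stepWeight]
      simp (disch := omega) only [if_pos, if_neg, pow_of_eq_zero, pow_of_eq_one, t0, t1, t2]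
      linear_combination z * e
    · have e := h.right_succ a' rfl rfl
      obtain rfl : m = l + 2 := by omega
      obtain rfl : p = (a' + 1) + l := by omega
      have hUr (F : ℕ → ℝ) : ∑ k ∈ Finset.Icc (a' - 1) a', F k * U k = F a' * U a' := by
        refine Finset.sum_eq_single_of_mem a' (by simp) fun k _ hk => ?_
        rw [h.valley_zero k (by omega), mul_zero]
      obtain ⟨u, hu⟩ : ∃ u, u = t ^ (l) := ⟨_, rfl⟩
      have t0 : ∀ n, n = l → t ^ n = u := by rintro _ rfl; exact hu.symm
      have t1 : ∀ n, n = l + 1 → t ^ n = u * t := by rintro _ rfl; rw [hu, pow_succ]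
      have t2 : ∀ n, n = l + 2 → t ^ n = u * t * t := by rintro _ rfl; rw [hu, pow_succ, pow_succ]
      simp only [hV, hUr, h.peak_zero a' (by omega),
        peakFactor, valleyFactor, growFactor, shrinkFactor, stepWeight]
      simp (disch := omega) only [if_pos, if_neg, pow_of_eq_zero, pow_of_eq_one, t0, t1, t2]
      linear_combination z * (1 - u * t) * (1 - u * t * t) * e
  · intro p h1 h2
    rcases hcases with ⟨hV0, hU0⟩ | ⟨rfl, rfl⟩ | ⟨q, rfl, rfl⟩ | rfl | rfl
    · simp [hV0, hU0]
    · obtain ⟨e1, e2⟩ := h.eq_zero rfl rfl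
      obtain rfl : l = m + 1 := by omega
      obtain rfl : p = 0 + m := by omega
      obtain ⟨u, hu⟩ : ∃ u, u = t ^ (m) := ⟨_, rfl⟩
      have t0 : ∀ n, n = m → t ^ n = u := by rintro _ rfl; exact hu.symm
      have t1 : ∀ n, n = m + 1 → t ^ n = u * t := by rintro _ rfl; rw [hu, pow_succ]
      have t2 : ∀ n, n = m + 2 → t ^ n = u * t * t := by rintro _ rfl; rw [hu, pow_succ, pow_succ]
      simp only [hV, hU0 rfl, peakFactor, valleyFactor, growFactor, shrinkFactor, stepWeight]
      simp (disch := omega) only [if_pos, if_neg, pow_of_eq_zero, pow_of_eq_one, t0, t1, t2]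
      linear_combination e1 + e2
    · obtain ⟨e1, e2⟩ := h.eq_succ q rfl rfl
      obtain rfl : l = m + 1 := by omega
      obtain rfl : p = q + 1 + m := by omega
      obtain ⟨u, hu⟩ : ∃ u, u = t ^ (m) := ⟨_, rfl⟩
      have t0 : ∀ n, n = m → t ^ n = u := by rintro _ rfl; exact hu.symm
      have t1 : ∀ n, n = m + 1 → t ^ n = u * t := by rintro _ rfl; rw [hu, pow_succ]
      have t2 : ∀ n, n = m + 2 → t ^ n = u * t * t := by rintro _ rfl; rw [hu, pow_succ, pow_succ]
      simp only [hV, hU1 q rfl, peakFactor, valleyFactor, growFactor, shrinkFactor, stepWeight]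
      simp (disch := omega) only [if_pos, if_neg, pow_of_eq_zero, pow_of_eq_one, t0, t1, t2]
      linear_combination e1 + e2
    · have e := h.left_succ c' rfl rfl
      obtain rfl : l = m + 2 := by omega
      obtain rfl : p = c' + 1 + m := by omega
      obtain ⟨u, hu⟩ : ∃ u, u = t ^ (m) := ⟨_, rfl⟩
      have t0 : ∀ n, n = m → t ^ n = u := by rintro _ rfl; exact hu.symm
      have t1 : ∀ n, n = m + 1 → t ^ n = u * t := by rintro _ rfl; rw [hu, pow_succ]
      have t2 : ∀ n, n = m + 2 → t ^ n = u * t * t := by rintro _ rfl; rw [hu, pow_succ, pow_succ]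
      simp only [hV, hU1 c' rfl, h.peak_zero (c' + 2) (by omega), h.valley_zero (c' + 1) (by omega),
        peakFactor, valleyFactor, growFactor, shrinkFactor, stepWeight]
      simp (disch := omega) only [if_pos, if_neg, pow_of_eq_zero, pow_of_eq_one, t0, t1, t2]
      linear_combination e
    · have e := h.right_succ a' rfl rfl
      obtain rfl : l = m := by omega
      obtain rfl : p = a' + l := by omega
      have hUr (F : ℕ → ℝ) : ∑ k ∈ Finset.Icc (a' - 1) a', F k * U k = F a' * U a' := by
        refine Finset.sum_eq_single_of_mem a' (by simp) fun k _ hk => ?_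
        rw [h.valley_zero k (by omega), mul_zero]
      obtain ⟨u, hu⟩ : ∃ u, u = t ^ (l) := ⟨_, rfl⟩
      have t0 : ∀ n, n = l → t ^ n = u := by rintro _ rfl; exact hu.symm
      have t1 : ∀ n, n = l + 1 → t ^ n = u * t := by rintro _ rfl; rw [hu, pow_succ]
      have t2 : ∀ n, n = l + 2 → t ^ n = u * t * t := by rintro _ rfl; rw [hu, pow_succ, pow_succ]
      simp only [hV, hUr, h.peak_zero a' (by omega),
        peakFactor, valleyFactor, growFactor, shrinkFactor, stepWeight]
      simp (disch := omega) only [if_pos, if_neg, pow_of_eq_zero, pow_of_eq_one, t0, t1, t2]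
      linear_combination e

lemma transfer_eq_zero {T : ℕ → ℕ → ℕ → ℕ → ℕ → ℕ → ℝ} (hT : T 0 0 0 0 0 0 = 1)
    {f h g : ℕ →₀ ℕ} (k : ℕ) (hk : T (f k) (f (k + 1)) (h k) (h (k + 1)) (g k) (g (k + 1)) = 0) :
    transfer T f h g = 0 := by
  induction k generalizing f h g with
  | zero => rw [transfer_eq hT]; simp [hk]
  | succ k ih => rw [transfer_eq hT, ih (f := tail f) (h := tail h) (g := tail g) hk, mul_zero]

lemma peakFactor_eq_zero {t z : ℝ} {a a' b b' c c' : ℕ}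
    (h : ¬ (a ≤ b ∧ b ≤ a + 1 ∧ c ≤ b ∧ b ≤ c + 1)) : peakFactor t z a a' b b' c c' = 0 := by
  unfold peakFactor growFactor shrinkFactor
  split_ifs <;> first | omega | simp

lemma valleyFactor_eq_zero {t z : ℝ} {a a' b b' c c' : ℕ}
    (h : ¬ (b ≤ a ∧ a ≤ b + 1 ∧ b ≤ c ∧ c ≤ b + 1)) : valleyFactor t z a a' b b' c c' = 0 := by
  unfold valleyFactor growFactor shrinkFactor
  split_ifs <;> first | omega | simp

/-- The sequence consisting of `j` ones. -/
noncomputable def ones : ℕ → (ℕ →₀ ℕ)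
  | 0 => 0
  | j + 1 => consEquiv (1, ones j)

lemma tail_zero : tail 0 = 0 := by ext; simp

lemma transfer_zero {T : ℕ → ℕ → ℕ → ℕ → ℕ → ℕ → ℝ} (hT : T 0 0 0 0 0 0 = 1) :
    transfer T 0 0 0 = 1 := by
  simp [transfer, hT]

lemma consEquiv_one (n : ℕ) (h : ℕ →₀ ℕ) : consEquiv (n, h) 1 = h 0 := by
  rw [← tail_apply (consEquiv (n, h)) 0, tail_consEquiv]

lemma ones_succ_zero (j : ℕ) : ones (j + 1) 0 = 1 := consEquiv_zero _ _

lemma ones_injective : Function.Injective ones := by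
  intro a b h
  induction a generalizing b with
  | zero =>
    cases b with
    | zero => rfl
    | succ b => have := ones_succ_zero b; rw [← h] at this; simp [ones] at this
  | succ a ih =>
    cases b with
    | zero => have := ones_succ_zero a; rw [h] at this; simp [ones] at this
    | succ b =>
      simp only [ones, EmbeddingLike.apply_eq_iff_eq, Prod.mk.injEq, true_and] at h
      rw [ih h]

lemma transfer_peak_ones (t z : ℝ) (j : ℕ) :
    transfer (peakFactor t z) 0 (ones (j + 1)) 0 = (1 - t) * z * z ^ j := by
  induction j with
  | zero =>
    rw [transfer_eq (peakFactor_zero t z), ones, tail_consEquiv, consEquiv_zero, consEquiv_one,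
      tail_zero, ones, transfer_zero (peakFactor_zero t z)]
    simp [peakFactor, growFactor, shrinkFactor, stepWeight]
  | succ j ih =>
    rw [transfer_eq (peakFactor_zero t z), ones, tail_consEquiv, consEquiv_zero, consEquiv_one,
      tail_zero, ih, ones_succ_zero]
    simp [peakFactor, growFactor, shrinkFactor, stepWeight]
    ring

lemma exists_eq_ones {t z : ℝ} {h : ℕ →₀ ℕ} (hh : transfer (peakFactor t z) 0 h 0 ≠ 0) :
    ∃ j, h = ones j := by
  obtain ⟨M, hM⟩ := exists_forall_ge_eq_zero h
  induction M generalizing h with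
  | zero => exact ⟨0, Finsupp.ext fun k => hM k (Nat.zero_le k)⟩
  | succ M ih =>
    have h1 := hh
    rw [transfer_eq (peakFactor_zero t z), tail_zero] at h1
    obtain ⟨j, hj⟩ := ih (right_ne_zero_of_mul h1) fun k hk => hM (k + 1) (by omega)
    have hc : h = consEquiv (h 0, tail h) := (consEquiv.apply_symm_apply h).symm
    have h2 : h 0 ≤ 1 := by
      by_contra h3
      exact left_ne_zero_of_mul h1 (peakFactor_eq_zero (by simp; omega))
    rcases Nat.le_one_iff_eq_zero_or_eq_one.1 h2 with h3 | h3
    · cases j with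
      | zero =>
        refine ⟨0, Finsupp.ext fun k => ?_⟩
        cases k with
        | zero => simpa [ones] using h3
        | succ k => rw [← tail_apply, hj]; rfl
      | succ j =>
        refine absurd ?_ (left_ne_zero_of_mul h1)
        have h4 : h 1 = 1 := by rw [← tail_apply h 0, hj, ones_succ_zero]
        simp [h3, h4, peakFactor, growFactor, stepWeight]
    · exact ⟨j + 1, by rw [hc, h3, hj, ones]⟩

lemma exists_intertwined {t z : ℝ} (hz0 : 0 ≤ z) (hz1 : z < 1) (N : ℕ) (f g : ℕ →₀ ℕ)
    (hf : Antitone f) (hg : Antitone g) (hN : ∀ k, N ≤ k → f k = 0 ∧ g k = 0) :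
    ∃ V U : ℕ → ℝ,
      (∀ n, HasSum (fun h => if h 0 = n then transfer (peakFactor t z) f h g else 0) (V n)) ∧
      (∀ n, HasSum (fun h => if h 0 = n then transfer (valleyFactor t z) f h g else 0) (U n)) ∧
      Intertwined t z (f 0) (g 0) V U := by
  induction N generalizing f g with
  | zero =>
    obtain rfl : f = 0 := Finsupp.ext fun k => (hN k (Nat.zero_le k)).1
    obtain rfl : g = 0 := Finsupp.ext fun k => (hN k (Nat.zero_le k)).2
    have hz : 1 - z ≠ 0 := by linarith
    refine ⟨fun n => if n = 0 then 1 else if n = 1 then (1 - t) * z * (1 - z)⁻¹ else 0,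
      fun n => if n = 0 then 1 else 0, fun n => ?_, fun n => ?_, ?_⟩
    · rcases n with _ | _ | n
      · convert hasSum_single (0 : ℕ →₀ ℕ) ?_ using 1
        · simp [transfer_zero (peakFactor_zero t z)]
        · intro h hh
          by_contra h1
          obtain ⟨h2, h3⟩ := ite_ne_right_iff.1 h1
          obtain ⟨j, rfl⟩ := exists_eq_ones h3
          cases j with
          | zero => exact hh rfl
          | succ j => rw [ones_succ_zero] at h2; omega
      · have inj : Function.Injective fun j => ones (j + 1) :=
          ones_injective.comp (add_left_injective 1)
        rw [← inj.hasSum_iff]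
        · have e (j : ℕ) : (if ones (j + 1) 0 = 0 + 1 then
              transfer (peakFactor t z) 0 (ones (j + 1)) 0 else 0) = (1 - t) * z * z ^ j := by
            rw [if_pos (ones_succ_zero j), transfer_peak_ones]
          simpa [Function.comp_def, e] using
            (hasSum_geometric_of_lt_one hz0 hz1).mul_left ((1 - t) * z)
        · intro h hh
          by_contra h1
          obtain ⟨h2, h3⟩ := ite_ne_right_iff.1 h1
          obtain ⟨j, rfl⟩ := exists_eq_ones h3
          cases j with
          | zero => simp [ones] at h2
          | succ j => exact hh ⟨j, rfl⟩
      · convert hasSum_zero (α := ℝ) (β := ℕ →₀ ℕ) using 2 with h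
        · rw [ite_eq_right_iff]
          exact fun h1 =>
            transfer_eq_zero (peakFactor_zero t z) 0 (peakFactor_eq_zero (by simp; omega))
        · simp
    · have h0 (h : ℕ →₀ ℕ) (hh : h ≠ 0) : transfer (valleyFactor t z) 0 h 0 = 0 := by
        obtain ⟨k, hk⟩ := Finsupp.ne_iff.1 hh
        exact transfer_eq_zero (valleyFactor_zero t z) k
          (valleyFactor_eq_zero (by simp at hk ⊢; omega))
      convert hasSum_single (0 : ℕ →₀ ℕ) ?_ using 1
      · simp [transfer_zero (valleyFactor_zero t z), eq_comm]
      · intro h hh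
        rw [h0 h hh, ite_self]
    · constructor
      · intro n hn
        simp only [Finsupp.coe_zero, Pi.zero_apply] at hn
        rw [if_neg (by omega), if_neg (by omega)]
      · intro n hn
        simp only [Finsupp.coe_zero, Pi.zero_apply] at hn
        exact if_neg (by omega)
      · intro _ _
        constructor
        · simp
        · simp; field_simp
      all_goals
        intro p h1 h2
        simp at h1 h2
  | succ N ih =>
    obtain ⟨V, U, hV, hU, hVU⟩ := ih (tail f) (tail g)
      (fun i j hij => hf (Nat.succ_le_succ hij)) (fun i j hij => hg (Nat.succ_le_succ hij))
      fun k hk => hN (k + 1) (by omega)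
    refine ⟨_, _, fun n => ?_, fun n => ?_, hVU.step (hf (Nat.zero_le 1)) (hg (Nat.zero_le 1))⟩
    · refine hasSum_transfer (peakFactor_zero t z) f g n _ V (fun h hh => ?_) fun k _ => hV k
      refine transfer_eq_zero (peakFactor_zero t z) 0 (peakFactor_eq_zero fun h1 => hh ?_)
      exact Finset.mem_Icc.2 ⟨h1.1, h1.2.1⟩
    · refine hasSum_transfer (valleyFactor_zero t z) f g n _ U (fun h hh => ?_) fun k _ => hU k
      refine transfer_eq_zero (valleyFactor_zero t z) 0 (valleyFactor_eq_zero fun h1 => hh ?_)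
      exact Finset.mem_Icc.2 ⟨Nat.sub_le_of_le_add h1.2.1, h1.1⟩

lemma hasSum_of_head {F : (ℕ →₀ ℕ) → ℝ} (A : Finset ℕ) {S : ℕ → ℝ} (hA : ∀ h, h 0 ∉ A → F h = 0)
    (hS : ∀ n, HasSum (fun h => if h 0 = n then F h else 0) (S n)) :
    HasSum F (∑ n ∈ A, S n) := by
  have := hasSum_sum fun n (_ : n ∈ A) => hS n
  have e (h : ℕ →₀ ℕ) : F h = ∑ n ∈ A, if h 0 = n then F h else 0 := by
    rw [Finset.sum_ite_eq]
    split_ifs with hh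
    · rfl
    · exact hA h hh
  simpa only [← e] using this

lemma exists_hasSum_peak_valley {t z : ℝ} (hz0 : 0 ≤ z) (hz1 : z < 1) (f g : ℕ →₀ ℕ)
    (hf : Antitone f) (hg : Antitone g) :
    ∃ v u : ℝ, HasSum (fun h => transfer (peakFactor t z) f h g) v ∧
      HasSum (fun h => transfer (valleyFactor t z) f h g) u ∧ v = (1 - t * z) / (1 - z) * u := by
  obtain ⟨N₁, h₁⟩ := exists_forall_ge_eq_zero f
  obtain ⟨N₂, h₂⟩ := exists_forall_ge_eq_zero g
  obtain ⟨V, U, hV, hU, h⟩ := exists_intertwined (t := t) hz0 hz1 (N₁ + N₂) f g hf hg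
    fun k hk => ⟨h₁ k (by omega), h₂ k (by omega)⟩
  refine ⟨_, _, hasSum_of_head (Finset.Icc (f 0) (f 0 + 1)) (fun h hh => ?_) hV,
    hasSum_of_head (Finset.Icc (f 0 - 1) (f 0)) (fun h hh => ?_) hU, ?_⟩
  · refine transfer_eq_zero (peakFactor_zero t z) 0 (peakFactor_eq_zero fun h1 => hh ?_)
    exact Finset.mem_Icc.2 ⟨h1.1, h1.2.1⟩
  · refine transfer_eq_zero (valleyFactor_zero t z) 0 (valleyFactor_eq_zero fun h1 => hh ?_)
    exact Finset.mem_Icc.2 ⟨Nat.sub_le_of_le_add h1.2.1, h1.1⟩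
  · have hz : 1 - z ≠ 0 := by linarith
    have hI (q : ℕ) (F : ℕ → ℝ) : ∑ k ∈ Finset.Icc q (q + 1), F k = F q + F (q + 1) := by
      rw [Finset.sum_Icc_succ_top (by omega)]; simp
    rw [div_mul_eq_mul_div, eq_div_iff hz, mul_comm, hI]
    generalize f 0 = a at h
    generalize g 0 = c at h
    by_cases h₁ : a ≤ c + 1 ∧ c ≤ a + 1
    · rcases Nat.lt_trichotomy a c with h₂ | rfl | h₂
      · obtain rfl : c = a + 1 := by omega
        rw [h.peak_zero a (by omega), zero_add, h.right_succ a rfl rfl,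
          Finset.sum_eq_single_of_mem a (by simp) fun k _ hk => h.valley_zero k (by omega)]
      · cases a with
        | zero =>
          obtain ⟨e1, e2⟩ := h.eq_zero rfl rfl
          simp only [Nat.zero_sub, Finset.Icc_self, Finset.sum_singleton]
          linear_combination e1 + e2
        | succ a =>
          obtain ⟨e1, e2⟩ := h.eq_succ a rfl rfl
          rw [Nat.add_sub_cancel, hI]
          linear_combination e1 + e2
      · obtain rfl : a = c + 1 := by omega
        rw [h.peak_zero (c + 1 + 1) (by omega), add_zero, h.left_succ c rfl rfl, Nat.add_sub_cancel,
          Finset.sum_eq_single_of_mem c (by simp) fun k _ hk => h.valley_zero k (by omega)]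
    · rw [Finset.sum_eq_zero fun k _ => h.valley_zero k (by omega), h.peak_zero _ (by omega),
        h.peak_zero _ (by omega)]
      simp

/-- The weight of adding a horizontal strip to `f` to get `h`. -/
noncomputable def grow (t : ℝ) (f h : ℕ →₀ ℕ) : ℝ :=
  ∏ᶠ k, growFactor t (f k) (f (k + 1)) (h k) (h (k + 1))

/-- The weight of removing a horizontal strip from `f` to get `h`. -/
noncomputable def shrink (t : ℝ) (f h : ℕ →₀ ℕ) : ℝ :=
  ∏ᶠ k, shrinkFactor t (f k) (f (k + 1)) (h k) (h (k + 1))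

lemma mulSupport_finite {T : ℕ → ℕ → ℕ → ℕ → ℝ} (hT : T 0 0 0 0 = 1) (f h : ℕ →₀ ℕ) :
    (Function.mulSupport fun k => T (f k) (f (k + 1)) (h k) (h (k + 1))).Finite := by
  obtain ⟨N₁, h₁⟩ := exists_forall_ge_eq_zero f
  obtain ⟨N₂, h₂⟩ := exists_forall_ge_eq_zero h
  refine (Set.finite_Iio (N₁ + N₂)).subset fun k hk => ?_
  by_contra hk'
  rw [Set.mem_Iio] at hk'
  apply hk
  simp only
  rw [h₁ k (by omega), h₁ (k + 1) (by omega), h₂ k (by omega), h₂ (k + 1) (by omega), hT]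

lemma growFactor_zero (t : ℝ) : growFactor t 0 0 0 0 = 1 := by simp [growFactor, stepWeight]

lemma shrinkFactor_zero (t : ℝ) : shrinkFactor t 0 0 0 0 = 1 := by simp [shrinkFactor, stepWeight]

lemma growFactor_ne_zero_of_grow {t : ℝ} {f h : ℕ →₀ ℕ} (hh : grow t f h ≠ 0) (k : ℕ) :
    growFactor t (f k) (f (k + 1)) (h k) (h (k + 1)) ≠ 0 := fun h0 =>
  hh (finprod_eq_zero _ k h0 (mulSupport_finite (growFactor_zero t) f h))

lemma shrinkFactor_ne_zero_of_shrink {t : ℝ} {f h : ℕ →₀ ℕ} (hh : shrink t f h ≠ 0) (k : ℕ) :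
    shrinkFactor t (f k) (f (k + 1)) (h k) (h (k + 1)) ≠ 0 := fun h0 =>
  hh (finprod_eq_zero _ k h0 (mulSupport_finite (shrinkFactor_zero t) f h))

lemma le_of_grow_ne_zero {t : ℝ} {f h : ℕ →₀ ℕ} (hh : grow t f h ≠ 0) (k : ℕ) :
    f k ≤ h k ∧ h k ≤ f k + 1 := by
  by_contra h1
  exact growFactor_ne_zero_of_grow hh k (if_neg h1)

lemma le_of_shrink_ne_zero {t : ℝ} {f h : ℕ →₀ ℕ} (hh : shrink t f h ≠ 0) (k : ℕ) :
    h k ≤ f k ∧ f k ≤ h k + 1 := by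
  by_contra h1
  exact shrinkFactor_ne_zero_of_shrink hh k (if_neg h1)

lemma antitone_of_grow_ne_zero {t : ℝ} {f h : ℕ →₀ ℕ} (hf : Antitone f) (hh : grow t f h ≠ 0) :
    Antitone h := by
  refine antitone_nat_of_succ_le fun k => ?_
  by_contra h1
  have h2 := le_of_grow_ne_zero hh k
  have h3 := le_of_grow_ne_zero hh (k + 1)
  have h4 := hf (Nat.le_add_right k 1)
  refine growFactor_ne_zero_of_grow hh k ?_
  rw [growFactor, if_pos h2, stepWeight, if_pos (by omega), show f k - f (k + 1) = 0 by omega,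
    pow_zero, sub_self]

lemma antitone_of_shrink_ne_zero {t : ℝ} {f h : ℕ →₀ ℕ} (hf : Antitone f) (hh : shrink t f h ≠ 0) :
    Antitone h := by
  refine antitone_nat_of_succ_le fun k => ?_
  by_contra h1
  have h2 := le_of_shrink_ne_zero hh k
  have h3 := le_of_shrink_ne_zero hh (k + 1)
  have h4 := hf (Nat.le_add_right k 1)
  refine shrinkFactor_ne_zero_of_shrink hh k ?_
  rw [shrinkFactor, if_pos h2, stepWeight, if_pos (by omega), show f k - f (k + 1) = 0 by omega,
    pow_zero, sub_self]

lemma stepWeight_nonneg {t : ℝ} (ht0 : 0 ≤ t) (ht1 : t ≤ 1) (a a' b b' : ℕ) :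
    0 ≤ stepWeight t a a' b b' := by
  unfold stepWeight
  split_ifs
  · exact sub_nonneg.2 (pow_le_one₀ ht0 ht1)
  · exact zero_le_one

lemma grow_nonneg {t : ℝ} (ht0 : 0 ≤ t) (ht1 : t ≤ 1) (f h : ℕ →₀ ℕ) : 0 ≤ grow t f h := by
  refine finprod_nonneg fun k => ?_
  unfold growFactor
  split_ifs
  · exact stepWeight_nonneg ht0 ht1 _ _ _ _
  · exact le_rfl

lemma shrink_nonneg {t : ℝ} (ht0 : 0 ≤ t) (ht1 : t ≤ 1) (f h : ℕ →₀ ℕ) : 0 ≤ shrink t f h := by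
  refine finprod_nonneg fun k => ?_
  unfold shrinkFactor
  split_ifs
  · exact stepWeight_nonneg ht0 ht1 _ _ _ _
  · exact le_rfl

lemma finprod_pow_sub (z : ℝ) {f h : ℕ →₀ ℕ} (hfh : ∀ k, f k ≤ h k) :
    ∏ᶠ k, z ^ (h k - f k) = z ^ (h.degree - f.degree) := by
  have e : h.degree = (h - f).degree + f.degree := by
    rw [← map_add, tsub_add_cancel_of_le (show f ≤ h from hfh)]
  rw [e, Nat.add_sub_cancel, Finsupp.degree_apply, ← Finset.prod_pow_eq_pow_sum]
  refine finprod_eq_prod_of_mulSupport_subset _ fun k hk => ?_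
  rw [Finset.mem_coe, Finsupp.mem_support_iff]
  intro h0
  exact hk (by simp_all)

lemma finite_mulSupport_pow_sub (z : ℝ) (f h : ℕ →₀ ℕ) :
    (Function.mulSupport fun k => z ^ (f k - h k)).Finite :=
  mulSupport_finite (T := fun a _ b _ => z ^ (a - b)) (by simp) f h

lemma degree_le {f h : ℕ →₀ ℕ} (hfh : ∀ k, f k ≤ h k) : f.degree ≤ h.degree := by
  rw [← tsub_add_cancel_of_le (show f ≤ h from hfh), map_add]
  exact Nat.le_add_left _ _

lemma transfer_peak (t z : ℝ) (f h g : ℕ →₀ ℕ) :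
    transfer (peakFactor t z) f h g = grow t f h * shrink t h g * z ^ (h.degree - g.degree) := by
  have e : transfer (peakFactor t z) f h g =
      grow t f h * shrink t h g * ∏ᶠ k, z ^ (h k - g k) := by
    have h1 := mulSupport_finite (growFactor_zero t) f h
    have h2 := mulSupport_finite (shrinkFactor_zero t) h g
    rw [grow, shrink, ← finprod_mul_distrib h1 h2, ← finprod_mul_distrib
      ((h1.union h2).subset (Function.mulSupport_mul _ _)) (finite_mulSupport_pow_sub z h g)]
    rfl
  by_cases hs : shrink t h g = 0
  · simp [e, hs]
  · rw [e, finprod_pow_sub z fun k => (le_of_shrink_ne_zero hs k).1]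

lemma transfer_valley (t z : ℝ) (f h g : ℕ →₀ ℕ) :
    transfer (valleyFactor t z) f h g = shrink t f h * grow t h g * z ^ (f.degree - h.degree) := by
  have e : transfer (valleyFactor t z) f h g =
      shrink t f h * grow t h g * ∏ᶠ k, z ^ (f k - h k) := by
    have h1 := mulSupport_finite (shrinkFactor_zero t) f h
    have h2 := mulSupport_finite (growFactor_zero t) h g
    rw [grow, shrink, ← finprod_mul_distrib h1 h2, ← finprod_mul_distrib
      ((h1.union h2).subset (Function.mulSupport_mul _ _)) (finite_mulSupport_pow_sub z f h)]
    rfl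
  by_cases hs : shrink t f h = 0
  · simp [e, hs]
  · rw [e, finprod_pow_sub z fun k => (le_of_shrink_ne_zero hs k).1]

open ENNReal in
lemma tsum_grow_shrink {t z : ℝ} (ht0 : 0 ≤ t) (ht1 : t ≤ 1) (hz0 : 0 ≤ z) (hz1 : z < 1)
    {f : ℕ →₀ ℕ} (hf : Antitone f) (g : ℕ →₀ ℕ) :
    ∑' h, ENNReal.ofReal (grow t f h) * ENNReal.ofReal (shrink t h g) *
        ENNReal.ofReal z ^ (h.degree - g.degree) =
      ENNReal.ofReal ((1 - t * z) / (1 - z)) *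
        ∑' h, ENNReal.ofReal (shrink t f h) * ENNReal.ofReal (grow t h g) *
          ENNReal.ofReal z ^ (f.degree - h.degree) := by
  by_cases hg : Antitone g
  · obtain ⟨v, u, hv, hu, h⟩ := exists_hasSum_peak_valley (t := t) hz0 hz1 f g hf hg
    have p1 (h) : 0 ≤ transfer (peakFactor t z) f h g := by
      rw [transfer_peak]
      exact mul_nonneg (mul_nonneg (grow_nonneg ht0 ht1 _ _) (shrink_nonneg ht0 ht1 _ _))
        (pow_nonneg hz0 _)
    have p2 (h) : 0 ≤ transfer (valleyFactor t z) f h g := by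
      rw [transfer_valley]
      exact mul_nonneg (mul_nonneg (shrink_nonneg ht0 ht1 _ _) (grow_nonneg ht0 ht1 _ _))
        (pow_nonneg hz0 _)
    have e1 (h : ℕ →₀ ℕ) : ENNReal.ofReal (grow t f h) * ENNReal.ofReal (shrink t h g) *
        ENNReal.ofReal z ^ (h.degree - g.degree) =
          ENNReal.ofReal (transfer (peakFactor t z) f h g) := by
      rw [transfer_peak, ENNReal.ofReal_mul (mul_nonneg (grow_nonneg ht0 ht1 _ _)
        (shrink_nonneg ht0 ht1 _ _)), ENNReal.ofReal_mul (grow_nonneg ht0 ht1 _ _),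
        ENNReal.ofReal_pow hz0]
    have e2 (h : ℕ →₀ ℕ) : ENNReal.ofReal (shrink t f h) * ENNReal.ofReal (grow t h g) *
        ENNReal.ofReal z ^ (f.degree - h.degree) =
          ENNReal.ofReal (transfer (valleyFactor t z) f h g) := by
      rw [transfer_valley, ENNReal.ofReal_mul (mul_nonneg (shrink_nonneg ht0 ht1 _ _)
        (grow_nonneg ht0 ht1 _ _)), ENNReal.ofReal_mul (shrink_nonneg ht0 ht1 _ _),
        ENNReal.ofReal_pow hz0]
    simp only [e1, e2]
    rw [← ENNReal.ofReal_tsum_of_nonneg p1 hv.summable, ← ENNReal.ofReal_tsum_of_nonneg p2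
      hu.summable, hv.tsum_eq, hu.tsum_eq, h, ENNReal.ofReal_mul]
    refine div_nonneg (sub_nonneg.2 ?_) (by linarith)
    nlinarith
  · have e1 (h : ℕ →₀ ℕ) : ENNReal.ofReal (grow t f h) * ENNReal.ofReal (shrink t h g) = 0 := by
      by_cases h1 : grow t f h = 0
      · simp [h1]
      · by_cases h2 : shrink t h g = 0
        · simp [h2]
        · exact absurd (antitone_of_shrink_ne_zero (antitone_of_grow_ne_zero hf h1) h2) hg
    have e2 (h : ℕ →₀ ℕ) : ENNReal.ofReal (shrink t f h) * ENNReal.ofReal (grow t h g) = 0 := by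
      by_cases h1 : shrink t f h = 0
      · simp [h1]
      · by_cases h2 : grow t h g = 0
        · simp [h2]
        · exact absurd (antitone_of_grow_ne_zero (antitone_of_shrink_ne_zero hf h1) h2) hg
    simp [e1, e2]

/-- The weight of a step between consecutive diagonals, growing up to diagonal `r`. -/
noncomputable def stepKernel (t : ℝ) (r n : ℕ) (f h : ℕ →₀ ℕ) : ℝ :=
  if n < r then grow t f h else shrink t f h

lemma stepKernel_nonneg {t : ℝ} (ht0 : 0 ≤ t) (ht1 : t ≤ 1) (r n : ℕ) (f h : ℕ →₀ ℕ) :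
    0 ≤ stepKernel t r n f h := by
  unfold stepKernel
  split_ifs
  exacts [grow_nonneg ht0 ht1 f h, shrink_nonneg ht0 ht1 f h]

open Classical in
/-- The total weight of the chains of `n` steps from the empty partition to a given one. -/
noncomputable def chainSum (t s : ℝ) (r : ℕ) : ℕ → (ℕ →₀ ℕ) → ENNReal
  | 0, h => if h = 0 then 1 else 0
  | n + 1, h => ENNReal.ofReal s ^ h.degree *
      ∑' f, ENNReal.ofReal (stepKernel t r n f h) * chainSum t s r n f

lemma antitone_of_chainSum_ne_zero {t s : ℝ} {r n : ℕ} {h : ℕ →₀ ℕ} (hn : n ≤ r)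
    (hh : chainSum t s r n h ≠ 0) : Antitone h := by
  induction n generalizing h with
  | zero =>
    simp only [chainSum, ne_eq, ite_eq_right_iff, one_ne_zero, imp_false, not_not] at hh
    subst hh
    intro a b _
    simp
  | succ n ih =>
    rw [chainSum] at hh
    have h1 := right_ne_zero_of_mul hh
    rw [Ne, ENNReal.tsum_eq_zero] at h1
    push Not at h1
    obtain ⟨f, hf⟩ := h1
    have h2 : grow t f h ≠ 0 := by
      intro h0
      apply left_ne_zero_of_mul hf
      rw [stepKernel, if_pos (by omega), h0, ENNReal.ofReal_zero]
    exact antitone_of_grow_ne_zero (ih (by omega) (right_ne_zero_of_mul hf)) h2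

lemma ofReal_shrink_mul_pow (t : ℝ) (x : ENNReal) (f h : ℕ →₀ ℕ) :
    ENNReal.ofReal (shrink t f h) * x ^ f.degree =
      ENNReal.ofReal (shrink t f h) * (x ^ h.degree * x ^ (f.degree - h.degree)) := by
  by_cases hs : shrink t f h = 0
  · simp [hs]
  · rw [← pow_add, Nat.add_sub_cancel' (degree_le fun k => (le_of_shrink_ne_zero hs k).1)]

/-- The factor by which a growing and a shrinking step commute. -/
noncomputable def commFactor (t z : ℝ) : ENNReal := ENNReal.ofReal ((1 - t * z) / (1 - z))

lemma tsum_chainSum_shrink {t s : ℝ} (ht0 : 0 ≤ t) (ht1 : t ≤ 1) (hs0 : 0 ≤ s) (hs1 : s < 1)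
    (r n : ℕ) (hn : n ≤ r) (y : ℝ) (hy0 : 0 ≤ y) (hy1 : y ≤ 1) (g : ℕ →₀ ℕ) :
    ∑' h, chainSum t s r n h * ENNReal.ofReal (shrink t h g) *
        ENNReal.ofReal y ^ (h.degree - g.degree) =
      (∏ i ∈ Finset.range n, commFactor t (s ^ (i + 1) * y)) * chainSum t s r n g := by
  induction n generalizing y g with
  | zero =>
    rw [tsum_eq_single 0]
    · by_cases hg : g = 0
      · subst hg
        have : shrink t 0 0 = 1 := by
          simp [shrink, shrinkFactor, stepWeight]
        simp [chainSum, this]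
      · have : shrink t 0 g = 0 := by
          by_contra hs
          apply hg
          ext k
          simpa using (le_of_shrink_ne_zero hs k).1
        simp [chainSum, hg, this]
    · intro h hh
      simp [chainSum, hh]
  | succ n ih =>
    have hz0 : 0 ≤ s * y := mul_nonneg hs0 hy0
    have hz1 : s * y < 1 := lt_of_le_of_lt (mul_le_of_le_one_right hs0 hy1) hs1
    have hk (f h) : stepKernel t r n f h = grow t f h := if_pos (by omega)
    calc
      _ = ∑' h, ∑' f, chainSum t s r n f * ENNReal.ofReal s ^ g.degree *
            (ENNReal.ofReal (grow t f h) * ENNReal.ofReal (shrink t h g) *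
              ENNReal.ofReal (s * y) ^ (h.degree - g.degree)) := by
        refine tsum_congr fun h => ?_
        rw [chainSum]
        simp only [hk]
        rw [← ENNReal.tsum_mul_left, ← ENNReal.tsum_mul_right, ← ENNReal.tsum_mul_right]
        refine tsum_congr fun f => ?_
        rw [ENNReal.ofReal_mul hs0, mul_pow]
        have := ofReal_shrink_mul_pow t (ENNReal.ofReal s) h g
        calc
          _ = ENNReal.ofReal (grow t f h) * chainSum t s r n f *
              ENNReal.ofReal y ^ (h.degree - g.degree) *
              (ENNReal.ofReal (shrink t h g) * ENNReal.ofReal s ^ h.degree) := by ring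
          _ = _ := by rw [this]; ring
      _ = ∑' f, chainSum t s r n f * ENNReal.ofReal s ^ g.degree *
            (commFactor t (s * y) * ∑' h, ENNReal.ofReal (shrink t f h) *
              ENNReal.ofReal (grow t h g) * ENNReal.ofReal (s * y) ^ (f.degree - h.degree)) := by
        rw [ENNReal.tsum_comm]
        refine tsum_congr fun f => ?_
        rw [ENNReal.tsum_mul_left]
        by_cases hf : chainSum t s r n f = 0
        · simp [hf]
        · rw [tsum_grow_shrink ht0 ht1 hz0 hz1 (antitone_of_chainSum_ne_zero (by omega) hf),
            commFactor]
      _ = ∑' h, commFactor t (s * y) * ENNReal.ofReal s ^ g.degree * ENNReal.ofReal (grow t h g) *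
            ∑' f, chainSum t s r n f * ENNReal.ofReal (shrink t f h) *
              ENNReal.ofReal (s * y) ^ (f.degree - h.degree) := by
        simp only [← ENNReal.tsum_mul_left]
        rw [ENNReal.tsum_comm]
        refine tsum_congr fun f => tsum_congr fun h => ?_
        ring
      _ = _ := by
        simp only [ih (by omega) (s * y) hz0 hz1.le]
        rw [chainSum, Finset.prod_range_succ', ← ENNReal.tsum_mul_left, ← ENNReal.tsum_mul_left]
        refine tsum_congr fun f => ?_
        have e (i : ℕ) : s ^ (i + 1) * (s * y) = s ^ (i + 1 + 1) * y := by ring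
        simp only [e, hk]
        rw [zero_add, pow_one]
        ring

lemma chainSum_add {t s : ℝ} (ht0 : 0 ≤ t) (ht1 : t ≤ 1) (hs0 : 0 ≤ s) (hs1 : s < 1)
    (r c : ℕ) (g : ℕ →₀ ℕ) :
    chainSum t s r (r + c) g =
      (∏ j ∈ Finset.range c, ∏ i ∈ Finset.range r, commFactor t (s ^ (i + 1) * s ^ j)) *
        (ENNReal.ofReal s ^ c) ^ g.degree * chainSum t s r r g := by
  induction c generalizing g with
  | zero => simp
  | succ c ih =>
    have hk (f h) : stepKernel t r (r + c) f h = shrink t f h := if_neg (by omega)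
    rw [← add_assoc, chainSum, Finset.prod_range_succ]
    calc
      _ = ENNReal.ofReal s ^ g.degree *
          ((∏ j ∈ Finset.range c, ∏ i ∈ Finset.range r, commFactor t (s ^ (i + 1) * s ^ j)) *
            (ENNReal.ofReal s ^ c) ^ g.degree * ∑' f, chainSum t s r r f *
              ENNReal.ofReal (shrink t f g) *
                ENNReal.ofReal (s ^ c) ^ (f.degree - g.degree)) := by
        congr 1
        rw [← ENNReal.tsum_mul_left]
        refine tsum_congr fun f => ?_
        rw [ih, hk, ENNReal.ofReal_pow hs0]
        have := ofReal_shrink_mul_pow t (ENNReal.ofReal s ^ c) f g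
        calc
          _ = (∏ j ∈ Finset.range c, ∏ i ∈ Finset.range r, commFactor t (s ^ (i + 1) * s ^ j)) *
              chainSum t s r r f *
              (ENNReal.ofReal (shrink t f g) * (ENNReal.ofReal s ^ c) ^ f.degree) := by ring
          _ = _ := by rw [this]; ring
      _ = _ := by
        rw [tsum_chainSum_shrink ht0 ht1 hs0 hs1 r r le_rfl _ (pow_nonneg hs0 c)
          (pow_le_one₀ hs0 hs1.le)]
        ring

lemma chainSum_zero (t s : ℝ) (r n : ℕ) (hn : n ≤ r) : chainSum t s r n 0 = 1 := by
  induction n with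
  | zero => simp [chainSum]
  | succ n ih =>
    have hk (f h) : stepKernel t r n f h = grow t f h := if_pos (by omega)
    rw [chainSum, tsum_eq_single 0, ih (by omega), hk]
    · simp [grow, growFactor, stepWeight]
    · intro f hf
      have : grow t f 0 = 0 := by
        by_contra hs
        apply hf
        ext k
        simpa using (le_of_grow_ne_zero hs k).1
      simp [hk, this]

lemma tsum_chain (t s : ℝ) (r N : ℕ) (φ : (ℕ →₀ ℕ) → ENNReal) [DecidableEq (ℕ →₀ ℕ)] :
    ∑' g : Fin (N + 1) → (ℕ →₀ ℕ), (if g 0 = 0 then 1 else 0) *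
        (∏ i : Fin N, ENNReal.ofReal (stepKernel t r i (g i.castSucc) (g i.succ)) *
          ENNReal.ofReal s ^ (g i.succ).degree) * φ (g (Fin.last N)) =
      ∑' h, chainSum t s r N h * φ h := by
  induction N generalizing φ with
  | zero =>
    rw [← (Equiv.funUnique (Fin 1) (ℕ →₀ ℕ)).symm.tsum_eq]
    refine tsum_congr fun h => ?_
    have : chainSum t s r 0 h = if h = 0 then 1 else 0 := by
      rw [chainSum]
      congr
    simp [this]
  | succ N ih =>
    have e := ih fun f => ∑' h, ENNReal.ofReal (stepKernel t r N f h) *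
          ENNReal.ofReal s ^ h.degree * φ h
    rw [← (Fin.snocEquiv fun _ : Fin (N + 2) => (ℕ →₀ ℕ)).tsum_eq, ENNReal.tsum_prod',
      ENNReal.tsum_comm]
    simp only [chainSum, ← ENNReal.tsum_mul_left, ← ENNReal.tsum_mul_right] at e ⊢
    conv_rhs at e => rw [ENNReal.tsum_comm]
    convert e using 1
    · refine tsum_congr fun g => tsum_congr fun h => ?_
      rw [Fin.prod_univ_castSucc]
      have h0 : (Fin.snocEquiv fun _ : Fin (N + 2) => (ℕ →₀ ℕ)) (h, g) 0 = g 0 :=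
        Fin.snoc_castSucc (α := fun _ => (ℕ →₀ ℕ)) h g 0
      have h1 (i : Fin (N + 1)) :
          (Fin.snocEquiv fun _ : Fin (N + 2) => (ℕ →₀ ℕ)) (h, g) i.castSucc = g i :=
        Fin.snoc_castSucc (α := fun _ => (ℕ →₀ ℕ)) h g i
      have h2 : (Fin.snocEquiv fun _ : Fin (N + 2) => (ℕ →₀ ℕ)) (h, g) (Fin.last (N + 1)) = h :=
        Fin.snoc_last (α := fun _ => (ℕ →₀ ℕ)) h g
      simp only [h0, h1, Fin.succ_castSucc, Fin.succ_last, h2, Fin.val_castSucc, Fin.val_last]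
      ring
    · refine tsum_congr fun h => tsum_congr fun f => ?_
      ring

/-- The conjugate of a partition, given by its column heights. -/
noncomputable def conj (f : ℕ →₀ ℕ) : ℕ →₀ ℕ :=
  Finsupp.onFinset (Finset.range (f.support.sup f)) (fun k => (f.support.filter (k < f ·)).card)
    fun k hk => by
      obtain ⟨m, hm⟩ := Finset.card_ne_zero.1 hk
      rw [Finset.mem_filter] at hm
      exact Finset.mem_range.2 (hm.2.trans_le (Finset.le_sup (f := f) hm.1))

lemma lt_conj_iff {f : ℕ →₀ ℕ} (hf : Antitone f) (k m : ℕ) : m < conj f k ↔ k < f m := by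
  have hc : conj f k = (f.support.filter (k < f ·)).card := rfl
  constructor
  · intro h
    by_contra! hm
    have : f.support.filter (k < f ·) ⊆ Finset.range m := fun a ha => by
      rw [Finset.mem_filter] at ha
      by_contra! hma
      have := hf (by simpa using hma : m ≤ a)
      omega
    have := Finset.card_le_card this
    rw [Finset.card_range] at this
    omega
  · intro h
    have : Finset.range (m + 1) ⊆ f.support.filter (k < f ·) := fun a ha => by
      have := hf (Nat.lt_succ_iff.1 (Finset.mem_range.1 ha))
      rw [Finset.mem_filter, Finsupp.mem_support_iff]
      omega
    have := Finset.card_le_card this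
    rw [Finset.card_range] at this
    omega

lemma antitone_conj {f : ℕ →₀ ℕ} (hf : Antitone f) : Antitone (conj f) := by
  intro a b hab
  by_contra! h
  rw [lt_conj_iff hf] at h
  have h2 := (lt_conj_iff hf a (conj f a)).2 (by omega)
  omega

lemma conj_conj {f : ℕ →₀ ℕ} (hf : Antitone f) : conj (conj f) = f := by
  ext k
  refine eq_of_forall_lt_iff fun m => ?_
  rw [lt_conj_iff (antitone_conj hf), lt_conj_iff hf]

lemma conj_zero : conj 0 = 0 := by
  ext k
  simp [conj]

lemma degree_conj (f : ℕ →₀ ℕ) : (conj f).degree = f.degree := by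
  have h1 : (conj f).support ⊆ Finset.range (f.support.sup f) := Finsupp.support_onFinset_subset
  rw [Finsupp.degree_apply, Finsupp.degree_apply]
  calc
    _ = ∑ k ∈ Finset.range (f.support.sup f), (f.support.filter (k < f ·)).card :=
      Finset.sum_subset h1 fun k _ hk => Finsupp.notMem_support_iff.1 hk
    _ = ∑ m ∈ f.support, ((Finset.range (f.support.sup f)).filter (· < f m)).card :=
      Finset.sum_card_bipartiteAbove_eq_sum_card_bipartiteBelow fun k m => k < f m
    _ = _ := by
      refine Finset.sum_congr rfl fun m hm => ?_
      have : (Finset.range (f.support.sup f)).filter (· < f m) = Finset.range (f m) := by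
        ext k
        have := Finset.le_sup (f := f) hm
        simp only [Finset.mem_filter, Finset.mem_range]
        omega
      rw [this, Finset.card_range]

/-- The `m`-th box of the `n`-th diagonal, the main diagonal having index `r`. -/
def box (r n m : ℕ) : ℕ × ℕ := (m + (r - n), m + (n - r))

lemma box_injective (r n : ℕ) : Function.Injective (box r n) := fun a b h => by
  simp only [box, Prod.mk.injEq] at h
  omega

lemma box_of_le (r i j : ℕ) (h : i ≤ r + j) : box r (r + j - i) (min i j) = (i, j) := by
  simp only [box, Prod.mk.injEq]
  omega

lemma part_antitone (π : PlanePartition) {i i' j j' : ℕ} (hi : i ≤ i') (hj : j ≤ j') :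
    π.part i' j' ≤ π.part i j :=
  (antitone_nat_of_succ_le (f := fun a => π.part a j') (fun a => π.col_decr a j') hi).trans
    (antitone_nat_of_succ_le (f := fun b => π.part i b) (fun b => π.row_decr i b) hj)

/-- The entries of a plane partition along a diagonal. -/
noncomputable def diagonal (π : PlanePartition) (r n : ℕ) : ℕ →₀ ℕ :=
  Finsupp.ofSupportFinite (fun m => π.part (box r n m).1 (box r n m).2)
    (π.finite_supp.preimage (box_injective r n).injOn)

lemma diagonal_apply (π : PlanePartition) (r n m : ℕ) :
    diagonal π r n m = π.part (box r n m).1 (box r n m).2 := rfl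

lemma antitone_diagonal (π : PlanePartition) (r n : ℕ) : Antitone (diagonal π r n) := by
  intro a b hab
  exact part_antitone π (by simp only [box]; omega) (by simp only [box]; omega)

/-- The column heights of the partition on a diagonal. -/
noncomputable def columns (π : PlanePartition) (r n : ℕ) : ℕ →₀ ℕ := conj (diagonal π r n)

lemma lt_columns_iff (π : PlanePartition) (r n k m : ℕ) :
    m < columns π r n k ↔ k < π.part (box r n m).1 (box r n m).2 :=
  lt_conj_iff (antitone_diagonal π r n) k m

lemma antitone_columns (π : PlanePartition) (r n : ℕ) : Antitone (columns π r n) :=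
  antitone_conj (antitone_diagonal π r n)

lemma columns_of_lt (π : PlanePartition) {r n : ℕ} (hn : n < r) (k : ℕ) :
    columns π r n k ≤ columns π r (n + 1) k ∧ columns π r (n + 1) k ≤ columns π r n k + 1 := by
  constructor
  · refine le_of_forall_lt fun m hm => ?_
    rw [lt_columns_iff] at hm ⊢
    exact hm.trans_le (part_antitone π (by simp only [box]; omega) (by simp only [box]; omega))
  · refine le_of_forall_lt fun m hm => ?_
    cases m with
    | zero => omega
    | succ m =>
      rw [Nat.succ_lt_succ_iff]
      rw [lt_columns_iff] at hm ⊢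
      exact hm.trans_le (part_antitone π (by simp only [box]; omega) (by simp only [box]; omega))

lemma columns_of_le (π : PlanePartition) {r n : ℕ} (hn : r ≤ n) (k : ℕ) :
    columns π r (n + 1) k ≤ columns π r n k ∧ columns π r n k ≤ columns π r (n + 1) k + 1 := by
  constructor
  · refine le_of_forall_lt fun m hm => ?_
    rw [lt_columns_iff] at hm ⊢
    exact hm.trans_le (part_antitone π (by simp only [box]; omega) (by simp only [box]; omega))
  · refine le_of_forall_lt fun m hm => ?_
    cases m with
    | zero => omega
    | succ m =>
      rw [Nat.succ_lt_succ_iff]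
      rw [lt_columns_iff] at hm ⊢
      exact hm.trans_le (part_antitone π (by simp only [box]; omega) (by simp only [box]; omega))

lemma columns_eq_zero {π : PlanePartition} {r c : ℕ}
    (hπ : ∀ i j, r ≤ i ∨ c ≤ j → π.part i j = 0) {n : ℕ} (hn : n = 0 ∨ r + c ≤ n) :
    columns π r n = 0 := by
  have : diagonal π r n = 0 := by
    ext m
    rw [diagonal_apply]
    exact hπ _ _ (by simp only [box]; omega)
  rw [columns, this, conj_zero]

lemma weight_eq_sum {π : PlanePartition} {r c : ℕ}
    (hπ : ∀ i j, r ≤ i ∨ c ≤ j → π.part i j = 0) :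
    π.weight = ∑ n ∈ Finset.range (r + c), (columns π r (n + 1)).degree := by
  have h0 : (columns π r 0).degree = 0 := by rw [columns_eq_zero hπ (Or.inl rfl)]; simp
  rw [← add_zero (∑ n ∈ Finset.range (r + c), _), ← h0,
    ← Finset.sum_range_succ' (fun n => (columns π r n).degree),
    PlanePartition.weight, finsum_eq_sum_of_support_subset (s := Finset.range r ×ˢ Finset.range c)]
  · rw [← Finset.sum_fiberwise_of_maps_to (t := Finset.range (r + c + 1))
      (g := fun p : ℕ × ℕ => r + p.2 - p.1)]
    · refine Finset.sum_congr rfl fun n _ => ?_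
      rw [columns, degree_conj, Finsupp.degree_apply]
      symm
      refine Finset.sum_of_injOn (box r n) (box_injective r n).injOn ?_ ?_ fun m _ => rfl
      · intro m hm
        rw [Finset.mem_coe, Finsupp.mem_support_iff, diagonal_apply] at hm
        have h1 : ¬ (r ≤ (box r n m).1 ∨ c ≤ (box r n m).2) := fun h => hm (hπ _ _ h)
        simp only [Finset.coe_filter, Finset.mem_product, Finset.mem_range, Set.mem_ofPred_eq,
          box] at h1 ⊢
        omega
      · rintro ⟨i, j⟩ hp hm
        simp only [Finset.mem_filter, Finset.mem_product, Finset.mem_range] at hp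
        by_contra h
        have e := box_of_le r i j (by omega)
        rw [hp.2] at e
        refine hm ⟨min i j, ?_, e⟩
        rwa [Finset.mem_coe, Finsupp.mem_support_iff, diagonal_apply, e]
    · intro p hp
      simp only [Finset.mem_product, Finset.mem_range] at hp ⊢
      omega
  · intro p hp
    by_contra h
    refine hp (hπ _ _ ?_)
    simp only [Finset.coe_product, Finset.coe_range, Set.mem_prod, Set.mem_Iio] at h
    omega

lemma columns_injective {r c : ℕ} {π ρ : PlanePartition}
    (hπ : ∀ i j, r ≤ i ∨ c ≤ j → π.part i j = 0) (hρ : ∀ i j, r ≤ i ∨ c ≤ j → ρ.part i j = 0)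
    (h : ∀ n ≤ r + c, columns π r n = columns ρ r n) : π = ρ := by
  have : π.part = ρ.part := by
    ext i j
    by_cases hij : r ≤ i ∨ c ≤ j
    · rw [hπ i j hij, hρ i j hij]
    · have e := box_of_le r i j (by omega)
      have h1 := congrArg conj (h (r + j - i) (by omega))
      rw [columns, columns, conj_conj (antitone_diagonal _ _ _),
        conj_conj (antitone_diagonal _ _ _)] at h1
      have h2 := DFunLike.congr_fun h1 (min i j)
      rwa [diagonal_apply, diagonal_apply, e] at h2
  cases π
  cases ρ
  cases this
  rfl

lemma exists_columns_eq {r c : ℕ} {G : ℕ → (ℕ →₀ ℕ)} (hG : ∀ n, Antitone (G n))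
    (h0 : G 0 = 0) (hz : G (r + c) = 0)
    (hgrow : ∀ n < r, ∀ k, G n k ≤ G (n + 1) k ∧ G (n + 1) k ≤ G n k + 1)
    (hshrink : ∀ n, r ≤ n → ∀ k, G (n + 1) k ≤ G n k ∧ G n k ≤ G (n + 1) k + 1) :
    ∃ π : PlanePartition, (∀ i j, r ≤ i ∨ c ≤ j → π.part i j = 0) ∧
      ∀ n, columns π r n = G n := by
  set P : ℕ → ℕ → ℕ := fun i j => conj (G (r + j - i)) (min i j) with hP
  have hlt (i j k) : k < P i j ↔ min i j < G (r + j - i) k := lt_conj_iff (hG _) _ _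
  have hrow (i j) : P i (j + 1) ≤ P i j := by
    refine le_of_forall_lt fun k hk => ?_
    rw [hlt] at hk ⊢
    by_cases h : i ≤ r + j
    · have e : r + (j + 1) - i = r + j - i + 1 := by omega
      rw [e] at hk
      by_cases hn : r + j - i < r
      · have := hgrow _ hn k
        omega
      · have := hshrink (r + j - i) (by omega) k
        omega
    · have e : r + (j + 1) - i = 0 := by omega
      rw [e, h0] at hk
      simp at hk
  have hcol (i j) : P (i + 1) j ≤ P i j := by
    refine le_of_forall_lt fun k hk => ?_
    rw [hlt] at hk ⊢
    by_cases h : i < r + j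
    · have e : r + j - i = r + j - (i + 1) + 1 := by omega
      rw [e]
      by_cases hn : r + j - (i + 1) < r
      · have := hgrow _ hn k
        omega
      · have := hshrink (r + j - (i + 1)) (by omega) k
        omega
    · have e : r + j - (i + 1) = 0 := by omega
      rw [e, h0] at hk
      simp at hk
  have hle {i i' j j'} (hi : i ≤ i') (hj : j ≤ j') : P i' j' ≤ P i j :=
    (antitone_nat_of_succ_le (f := fun a => P a j') (fun a => hcol a j') hi).trans
      (antitone_nat_of_succ_le (f := fun b => P i b) (fun b => hrow i b) hj)
  have hout (i j) (hij : r ≤ i ∨ c ≤ j) : P i j = 0 := by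
    rcases hij with hi | hj
    · have : P r 0 = 0 := by simp [hP, h0, conj_zero]
      have := hle hi (Nat.zero_le j)
      omega
    · have : P 0 c = 0 := by simp [hP, hz, conj_zero]
      have := hle (Nat.zero_le i) hj
      omega
  refine ⟨⟨P, hrow, hcol, ?_⟩, hout, fun n => ?_⟩
  · refine (Finset.range r ×ˢ Finset.range c).finite_toSet.subset fun p hp => ?_
    by_contra h
    refine hp (hout _ _ ?_)
    simp only [Finset.coe_product, Finset.coe_range, Set.mem_prod, Set.mem_Iio] at h
    omega
  · ext k
    refine eq_of_forall_lt_iff fun m => ?_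
    rw [lt_columns_iff, hlt]
    have e1 : r + (box r n m).2 - (box r n m).1 = n := by simp only [box]; omega
    have e2 : min (box r n m).1 (box r n m).2 = m := by simp only [box]; omega
    rw [e1, e2]

open Classical in
/-- The weight of a chain of partitions that starts and ends at the empty one. -/
noncomputable def chainWeight (t s : ℝ) (r N : ℕ) (g : Fin (N + 1) → (ℕ →₀ ℕ)) : ENNReal :=
  (if g 0 = 0 then 1 else 0) *
    (∏ i : Fin N, ENNReal.ofReal (stepKernel t r i (g i.castSucc) (g i.succ)) *
      ENNReal.ofReal s ^ (g i.succ).degree) * if g (Fin.last N) = 0 then 1 else 0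

lemma exists_columns_of_chainWeight_ne_zero {t s : ℝ} {r c : ℕ}
    {g : Fin (r + c + 1) → (ℕ →₀ ℕ)} (hg : chainWeight t s r (r + c) g ≠ 0) :
    ∃ π : PlanePartition, (∀ i j, r ≤ i ∨ c ≤ j → π.part i j = 0) ∧
      (fun i : Fin (r + c + 1) => columns π r i) = g := by
  have hg0 : g 0 = 0 := by
    by_contra h
    simp [chainWeight, h] at hg
  have hgN : g (Fin.last (r + c)) = 0 := by
    by_contra h
    simp [chainWeight, h] at hg
  have hstep (i : Fin (r + c)) : stepKernel t r i (g i.castSucc) (g i.succ) ≠ 0 := by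
    intro h
    have := Finset.prod_ne_zero_iff.1 (right_ne_zero_of_mul (left_ne_zero_of_mul hg)) i
      (Finset.mem_univ i)
    simp [h] at this
  set G : ℕ → (ℕ →₀ ℕ) := fun n => if h : n < r + c + 1 then g ⟨n, h⟩ else 0
  have hG (i : Fin (r + c + 1)) : G i = g i := dif_pos i.2
  have hG' {n : ℕ} (hn : r + c < n) : G n = 0 := dif_neg (by omega)
  have h0 : G 0 = 0 := (hG 0).trans hg0
  have hz : G (r + c) = 0 := (hG (Fin.last (r + c))).trans hgN
  have hstep' {n : ℕ} (hn : n < r + c) : stepKernel t r n (G n) (G (n + 1)) ≠ 0 := by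
    have h1 := hG (Fin.castSucc ⟨n, hn⟩)
    have h2 := hG (Fin.succ ⟨n, hn⟩)
    have := hstep ⟨n, hn⟩
    rw [← h1, ← h2] at this
    exact this
  have hanti (n : ℕ) : Antitone (G n) := by
    induction n with
    | zero =>
      rw [h0]
      intro a b _
      simp
    | succ n ih =>
      by_cases hn : n < r + c
      · have := hstep' hn
        unfold stepKernel at this
        split_ifs at this
        · exact antitone_of_grow_ne_zero ih this
        · exact antitone_of_shrink_ne_zero ih this
      · rw [hG' (by omega)]
        intro a b _
        simp
  obtain ⟨π, hπ, h⟩ := exists_columns_eq (c := c) hanti h0 hz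
    (fun n hn => by
      have := hstep' (show n < r + c by omega)
      rw [stepKernel, if_pos hn] at this
      exact le_of_grow_ne_zero this)
    (fun n hn k => by
      by_cases hn' : n < r + c
      · have := hstep' hn'
        rw [stepKernel, if_neg (by omega)] at this
        exact le_of_shrink_ne_zero this k
      · have e : G n = 0 := by
          rcases (not_lt.1 hn').eq_or_lt with h | h
          · rw [← h, hz]
          · exact hG' h
        simp [e, hG' (show r + c < n + 1 by omega)])
  exact ⟨π, hπ, funext fun i => (h i).trans (hG i)⟩

lemma tsum_chainWeight_columns (t s : ℝ) (r c : ℕ) :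
    ∑' π : {π : PlanePartition // ∀ i j, r ≤ i ∨ c ≤ j → π.part i j = 0},
        chainWeight t s r (r + c) (fun i => columns π.1 r i) = chainSum t s r (r + c) 0 := by
  classical
  have inj : Function.Injective
      fun (π : {π : PlanePartition // ∀ i j, r ≤ i ∨ c ≤ j → π.part i j = 0})
        (i : Fin (r + c + 1)) => columns π.1 r i := fun π ρ h =>
    Subtype.ext (columns_injective π.2 ρ.2 fun n hn => congrFun h ⟨n, by omega⟩)
  rw [inj.tsum_eq (f := chainWeight t s r (r + c))]
  · simp only [chainWeight]
    have := tsum_chain t s r (r + c) fun h => if h = 0 then 1 else 0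
    simp only [mul_ite, mul_one, mul_zero, tsum_ite_eq] at this
    convert this using 4
    simp
  · intro g hg
    obtain ⟨π, hπ, h⟩ := exists_columns_of_chainWeight_ne_zero hg
    exact ⟨⟨π, hπ⟩, h⟩

lemma chainWeight_columns {t s : ℝ} (ht0 : 0 ≤ t) (ht1 : t ≤ 1) (hs0 : 0 ≤ s) {r c : ℕ}
    {π : PlanePartition} (hπ : ∀ i j, r ≤ i ∨ c ≤ j → π.part i j = 0) :
    chainWeight t s r (r + c) (fun i => columns π r i) =
      ENNReal.ofReal ((∏ n ∈ Finset.range (r + c),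
        stepKernel t r n (columns π r n) (columns π r (n + 1))) * s ^ π.weight) := by
  have h0 : columns π r ((0 : Fin (r + c + 1)) : ℕ) = 0 := columns_eq_zero hπ (Or.inl rfl)
  have h1 : columns π r (Fin.last (r + c) : ℕ) = 0 := columns_eq_zero hπ (Or.inr le_rfl)
  have hk (n : ℕ) : 0 ≤ stepKernel t r n (columns π r n) (columns π r (n + 1)) :=
    stepKernel_nonneg ht0 ht1 _ _ _ _
  rw [chainWeight, if_pos h0, if_pos h1, one_mul, mul_one,
    ENNReal.ofReal_mul (Finset.prod_nonneg fun n _ => hk n), weight_eq_sum hπ,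
    ENNReal.ofReal_pow hs0, ENNReal.ofReal_prod_of_nonneg fun n _ => hk n,
    ← Finset.prod_pow_eq_pow_sum, ← Finset.prod_mul_distrib, Finset.prod_range]
  rfl

lemma connStep_symm {g : ℕ → ℕ → ℕ} {p q : ℕ × ℕ} (h : ConnStep g p q) : ConnStep g q p := by
  obtain ⟨ha, he, hn⟩ := h
  refine ⟨?_, he.symm, he ▸ hn⟩
  unfold Adjacent at ha ⊢
  omega

lemma borderStep_symm {g : ℕ → ℕ → ℕ} {p q : ℕ × ℕ} (h : BorderStep g p q) :
    BorderStep g q p := ⟨connStep_symm h.1, h.2.symm⟩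

lemma sameComponent_add_iff (π : PlanePartition) (i j h : ℕ) (hp : π.part i j ≠ 0) :
    SameComponent π.part (i, j) (i + h, j + h) ↔ π.part (i + h) (j + h) = π.part i j := by
  constructor
  · rintro ⟨-, hc⟩
    generalize hq : (i + h, j + h) = q at hc
    have : π.part q.1 q.2 = π.part i j := by
      clear hq
      induction hc with
      | refl => rfl
      | tail _ hs ih => rw [← hs.2.1, ih]
    rwa [← hq] at this
  · intro he
    have key (a b : ℕ) (ha : a ≤ h) (hb : b ≤ h) : π.part (i + a) (j + b) = π.part i j := by
      have h1 := part_antitone π (show i ≤ i + a by omega) (show j ≤ j + b by omega)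
      have h2 := part_antitone π (show i + a ≤ i + h by omega) (show j + b ≤ j + h by omega)
      omega
    refine ⟨hp, ?_⟩
    have right (b : ℕ) (hb : b ≤ h) :
        Relation.ReflTransGen (ConnStep π.part) (i, j) (i, j + b) := by
      induction b with
      | zero => exact .refl
      | succ b ih =>
        refine (ih (by omega)).tail ⟨Or.inl ⟨rfl, Or.inl (by simp; omega)⟩, ?_, ?_⟩
        · have h1 := key 0 b (by omega) (by omega)
          have h2 := key 0 (b + 1) (by omega) (by omega)
          exact h1.trans h2.symm
        · have h1 := key 0 b (by omega) (by omega)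
          exact fun h0 => hp (h1.symm.trans h0)
    have down (a : ℕ) (ha : a ≤ h) :
        Relation.ReflTransGen (ConnStep π.part) (i, j) (i + a, j + h) := by
      induction a with
      | zero => exact right h le_rfl
      | succ a ih =>
        refine (ih (by omega)).tail ⟨Or.inr ⟨rfl, Or.inl (by simp; omega)⟩, ?_, ?_⟩
        · exact (key a h (by omega) le_rfl).trans (key (a + 1) h (by omega) le_rfl).symm
        · exact fun h0 => hp ((key a h (by omega) le_rfl).symm.trans h0)
    exact down h le_rfl

/-- The number of parts of a given size on a diagonal. -/
noncomputable def gap (π : PlanePartition) (r n k : ℕ) : ℕ :=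
  columns π r n k - columns π r n (k + 1)

/-- The box with entry `k + 1` and level `h` on the `n`-th diagonal. -/
noncomputable def levelBox (π : PlanePartition) (r n k h : ℕ) : ℕ × ℕ :=
  box r n (columns π r n k - h)

lemma part_box_eq_iff (π : PlanePartition) (r n m k : ℕ) :
    π.part (box r n m).1 (box r n m).2 = k + 1 ↔
      columns π r n (k + 1) ≤ m ∧ m < columns π r n k := by
  rw [← not_lt, lt_columns_iff, lt_columns_iff]
  omega

lemma level_box (π : PlanePartition) {r n m k : ℕ}
    (h : π.part (box r n m).1 (box r n m).2 = k + 1) :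
    level π.part (box r n m) = columns π r n k - m := by
  have hm := (part_box_eq_iff π r n m k).1 h
  have e (a : ℕ) : SameComponent π.part (box r n m) ((box r n m).1 + a, (box r n m).2 + a) ↔
      m + a < columns π r n k := by
    have h1 := sameComponent_add_iff π (box r n m).1 (box r n m).2 a (by omega)
    have e2 : π.part ((box r n m).1 + a) ((box r n m).2 + a) =
        π.part (box r n (m + a)).1 (box r n (m + a)).2 := by
      congr 1 <;> simp only [box] <;> omega
    rw [e2, h, part_box_eq_iff] at h1
    rw [Prod.mk.eta] at h1
    rw [h1]
    omega
  unfold level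
  simp only [e]
  refine IsLeast.csInf_eq ⟨?_, fun a ha => ?_⟩
  · simp only [Set.mem_ofPred_eq]
    omega
  · simp only [Set.mem_ofPred_eq] at ha
    omega

lemma part_levelBox (π : PlanePartition) {r n k h : ℕ} (h0 : 0 < h) (h1 : h ≤ gap π r n k) :
    π.part (levelBox π r n k h).1 (levelBox π r n k h).2 = k + 1 := by
  rw [levelBox, part_box_eq_iff]
  unfold gap at h1
  omega

lemma level_levelBox (π : PlanePartition) {r n k h : ℕ} (h0 : 0 < h) (h1 : h ≤ gap π r n k) :
    level π.part (levelBox π r n k h) = h := by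
  have := level_box π (part_levelBox π h0 h1)
  rw [← levelBox] at this
  unfold gap at h1
  omega

lemma exists_eq_levelBox (π : PlanePartition) {r : ℕ} {p : ℕ × ℕ} (hp : π.part p.1 p.2 ≠ 0)
    (hr : p.1 < r) :
    levelBox π r (r + p.2 - p.1) (π.part p.1 p.2 - 1) (level π.part p) = p ∧
      0 < level π.part p ∧
      level π.part p ≤ gap π r (r + p.2 - p.1) (π.part p.1 p.2 - 1) := by
  obtain ⟨i, j⟩ := p
  have e := box_of_le r i j (by simp at hr; omega)
  simp only at hp hr ⊢
  obtain ⟨k, hk⟩ := Nat.exists_eq_succ_of_ne_zero hp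
  set n := r + j - i
  set m := min i j
  have h1 : π.part (box r n m).1 (box r n m).2 = k + 1 := by rw [e]; exact hk
  have h2 := level_box π h1
  have h3 := (part_box_eq_iff π r n m k).1 h1
  rw [e] at h2
  rw [hk, Nat.succ_eq_add_one, Nat.add_sub_cancel, levelBox, h2]
  refine ⟨?_, by omega, ?_⟩
  · rw [← e]
    congr 1
    omega
  · unfold gap
    omega

lemma columns_succ (π : PlanePartition) (r n k : ℕ) :
    (n < r ∧ columns π r n k ≤ columns π r (n + 1) k ∧
      columns π r (n + 1) k ≤ columns π r n k + 1) ∨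
    (r ≤ n ∧ columns π r (n + 1) k ≤ columns π r n k ∧
      columns π r n k ≤ columns π r (n + 1) k + 1) := by
  rcases lt_or_ge n r with h | h
  · exact Or.inl ⟨h, columns_of_lt π h k⟩
  · exact Or.inr ⟨h, columns_of_le π h k⟩

lemma borderStep_levelBox (π : PlanePartition) {r n k h : ℕ} (h0 : 0 < h)
    (h1 : h ≤ gap π r n k) (h2 : h ≤ gap π r (n + 1) k) :
    BorderStep π.part (levelBox π r n k h) (levelBox π r (n + 1) k h) := by
  refine ⟨⟨?_, ?_, ?_⟩, ?_⟩
  · have := columns_succ π r n k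
    unfold gap at h1 h2
    simp only [Adjacent, levelBox, box]
    omega
  · rw [part_levelBox π h0 h1, part_levelBox π h0 h2]
  · rw [part_levelBox π h0 h1]
    omega
  · rw [level_levelBox π h0 h1, level_levelBox π h0 h2]

lemma exists_of_borderStep {π : PlanePartition} {r n k h : ℕ}
    (hπ : ∀ i j, r ≤ i → π.part i j = 0) (h0 : 0 < h) (h1 : h ≤ gap π r n k) {q : ℕ × ℕ}
    (hs : BorderStep π.part (levelBox π r n k h) q) :
    ∃ n', (n' = n + 1 ∨ n = n' + 1) ∧ h ≤ gap π r n' k ∧ q = levelBox π r n' k h := by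
  obtain ⟨⟨ha, he, hn⟩, hl⟩ := hs
  rw [part_levelBox π h0 h1] at he
  rw [level_levelBox π h0 h1] at hl
  have hr : q.1 < r := by
    by_contra! hr
    have := hπ q.1 q.2 hr
    omega
  have hr' : (levelBox π r n k h).1 < r := by
    by_contra! hr
    exact hn (hπ _ _ hr)
  obtain ⟨e1, e2, e3⟩ := exists_eq_levelBox π (r := r) (p := q) (by omega) hr
  rw [← he, Nat.add_sub_cancel, ← hl] at e1 e3
  refine ⟨_, ?_, e3, e1.symm⟩
  simp only [Adjacent, levelBox, box] at ha hr'
  omega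

lemma level_eq_of_reflTransGen {g : ℕ → ℕ → ℕ} {p q : ℕ × ℕ}
    (h : Relation.ReflTransGen (BorderStep g) p q) :
    g q.1 q.2 = g p.1 p.2 ∧ level g q = level g p := by
  induction h with
  | refl => exact ⟨rfl, rfl⟩
  | tail _ hs ih => exact ⟨hs.1.2.1.symm.trans ih.1, hs.2.symm.trans ih.2⟩

lemma sameBorder_congr {g : ℕ → ℕ → ℕ} {p q : ℕ × ℕ}
    (h : Relation.ReflTransGen (BorderStep g) p q) :
    {x | SameBorder g p x} = {x | SameBorder g q x} := by
  have hsymm : Relation.ReflTransGen (BorderStep g) q p :=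
    Relation.ReflTransGen.mono (fun _ _ => borderStep_symm) _ _ h.swap
  have he := (level_eq_of_reflTransGen h).1
  ext x
  simp only [Set.mem_ofPred_eq, SameBorder, he]
  exact ⟨fun hx => ⟨hx.1, hsymm.trans hx.2⟩, fun hx => ⟨hx.1, h.trans hx.2⟩⟩

lemma borderLevel_eq {g : ℕ → ℕ → ℕ} {p : ℕ × ℕ} (hp : g p.1 p.2 ≠ 0) :
    borderLevel g {x | SameBorder g p x} = level g p := by
  have : {h : ℕ | ∃ q ∈ {x | SameBorder g p x}, level g q = h} = {level g p} := by
    ext h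
    simp only [Set.mem_ofPred_eq, Set.mem_singleton_iff]
    constructor
    · rintro ⟨q, hq, rfl⟩
      exact (level_eq_of_reflTransGen hq.2).2
    · rintro rfl
      exact ⟨p, ⟨hp, .refl⟩, rfl⟩
  rw [borderLevel, this, csInf_singleton]

lemma gap_le_gap_succ (π : PlanePartition) (r n k : ℕ) :
    gap π r n k ≤ gap π r (n + 1) k + 1 := by
  have h1 := columns_succ π r n k
  have h2 := columns_succ π r n (k + 1)
  unfold gap
  omega

lemma exists_le_of_reflTransGen {π : PlanePartition} {r n k h : ℕ}
    (hπ : ∀ i j, r ≤ i → π.part i j = 0) (h0 : 0 < h) (h1 : h ≤ gap π r n k)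
    (h2 : gap π r (n + 1) k < h) {q : ℕ × ℕ}
    (hq : Relation.ReflTransGen (BorderStep π.part) (levelBox π r n k h) q) :
    ∃ n' ≤ n, h ≤ gap π r n' k ∧ q = levelBox π r n' k h := by
  induction hq with
  | refl => exact ⟨n, le_rfl, h1, rfl⟩
  | tail _ hs ih =>
    obtain ⟨n', hn', hg, rfl⟩ := ih
    obtain ⟨m, hm, hg', rfl⟩ := exists_of_borderStep hπ h0 hg hs
    refine ⟨m, ?_, hg', rfl⟩
    rcases hm with rfl | rfl
    · rcases hn'.eq_or_lt with rfl | hlt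
      · omega
      · omega
    · omega

lemma exists_terminal {π : PlanePartition} {r c n k h : ℕ}
    (hπ : ∀ i j, r ≤ i ∨ c ≤ j → π.part i j = 0) (h0 : 0 < h) (h1 : h ≤ gap π r n k) :
    ∃ n' < r + c, gap π r (n' + 1) k < h ∧ h ≤ gap π r n' k ∧
      Relation.ReflTransGen (BorderStep π.part) (levelBox π r n k h) (levelBox π r n' k h) := by
  have hn : n < r + c := by
    by_contra! hn
    rw [gap, columns_eq_zero hπ (Or.inr hn)] at h1
    simp at h1
    omega
  obtain ⟨d, hd⟩ : ∃ d, r + c = n + 1 + d := ⟨r + c - (n + 1), by omega⟩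
  induction d generalizing n with
  | zero =>
    refine ⟨n, hn, ?_, h1, .refl⟩
    rw [gap, columns_eq_zero hπ (Or.inr (by omega))]
    simpa using h0
  | succ d ih =>
    by_cases h2 : h ≤ gap π r (n + 1) k
    · obtain ⟨n', hn', h3, h4, h5⟩ := ih h2 (by omega) (by omega)
      exact ⟨n', hn', h3, h4, .head (borderStep_levelBox π h0 h1 h2) h5⟩
    · exact ⟨n, hn, by omega, h1, .refl⟩

lemma levelBox_diag (π : PlanePartition) (r n k h : ℕ) :
    r + (levelBox π r n k h).2 - (levelBox π r n k h).1 = n := by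
  simp only [levelBox, box]
  omega

/-- Indices `(n, k)` for which the number of parts `k + 1` drops after the `n`-th diagonal. -/
def drops (π : PlanePartition) (r N : ℕ) : Set (ℕ × ℕ) :=
  {x | x.1 < N ∧ gap π r (x.1 + 1) x.2 < gap π r x.1 x.2}

lemma bijOn_drops {π : PlanePartition} {r c : ℕ}
    (hπ : ∀ i j, r ≤ i ∨ c ≤ j → π.part i j = 0) :
    Set.BijOn (fun x : ℕ × ℕ =>
        {q | SameBorder π.part (levelBox π r x.1 x.2 (gap π r x.1 x.2)) q})
      (drops π r (r + c)) (borderComponents π.part) := by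
  have hπ' : ∀ i j, r ≤ i → π.part i j = 0 := fun i j h => hπ i j (Or.inl h)
  refine ⟨?_, ?_, ?_⟩
  · rintro ⟨n, k⟩ ⟨hn, hd⟩
    simp only at hd
    refine ⟨_, ?_, rfl⟩
    rw [part_levelBox π (h := gap π r n k) (by omega) le_rfl]
    omega
  · rintro ⟨n, k⟩ ⟨hn, hd⟩ ⟨n', k'⟩ ⟨hn', hd'⟩ he
    simp only at hn hd hn' hd' he
    have p1 := part_levelBox π (r := r) (n := n) (k := k) (h := gap π r n k) (by omega) le_rfl
    have p2 := part_levelBox π (r := r) (n := n') (k := k') (h := gap π r n' k') (by omega) le_rfl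
    have m1 : levelBox π r n' k' (gap π r n' k') ∈
        {q | SameBorder π.part (levelBox π r n k (gap π r n k)) q} := by
      rw [he]
      exact ⟨by omega, .refl⟩
    have m2 : levelBox π r n k (gap π r n k) ∈
        {q | SameBorder π.part (levelBox π r n' k' (gap π r n' k')) q} := by
      rw [← he]
      exact ⟨by omega, .refl⟩
    obtain ⟨a, ha, -, ea⟩ := exists_le_of_reflTransGen hπ' (by omega) le_rfl hd m1.2
    obtain ⟨b, hb, -, eb⟩ := exists_le_of_reflTransGen hπ' (by omega) le_rfl hd' m2.2
    have q1 := levelBox_diag π r n' k' (gap π r n' k')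
    have q2 := levelBox_diag π r n k (gap π r n k)
    rw [ea, levelBox_diag] at q1
    rw [eb, levelBox_diag] at q2
    have hk := (level_eq_of_reflTransGen m1.2).1
    rw [Prod.mk.injEq]
    omega
  · rintro B ⟨p, hp, rfl⟩
    have hr : p.1 < r := by
      by_contra! hr
      exact hp (hπ' _ _ hr)
    obtain ⟨e1, e2, e3⟩ := exists_eq_levelBox π hp hr
    obtain ⟨n', hn', h3, h4, h5⟩ := exists_terminal hπ e2 e3
    rw [e1] at h5
    have := gap_le_gap_succ π r n' (π.part p.1 p.2 - 1)
    have e : gap π r n' (π.part p.1 p.2 - 1) = level π.part p := by omega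
    refine ⟨(n', π.part p.1 p.2 - 1), ⟨hn', by simpa only [e] using h3⟩, ?_⟩
    simp only [e]
    exact (sameBorder_congr h5).symm

lemma columns_eq_zero_of_le (π : PlanePartition) (r n : ℕ) {k : ℕ} (hk : π.part 0 0 ≤ k) :
    columns π r n k = 0 := by
  by_contra h
  have := (lt_columns_iff π r n k 0).1 (by omega)
  have := part_antitone π (Nat.zero_le (box r n 0).1) (Nat.zero_le (box r n 0).2)
  omega

lemma stepKernel_columns (t : ℝ) (π : PlanePartition) (r n : ℕ) :
    stepKernel t r n (columns π r n) (columns π r (n + 1)) =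
      ∏ k ∈ Finset.range (π.part 0 0),
        if gap π r (n + 1) k < gap π r n k then 1 - t ^ gap π r n k else 1 := by
  have key : stepKernel t r n (columns π r n) (columns π r (n + 1)) =
      ∏ᶠ k, stepWeight t (columns π r n k) (columns π r n (k + 1))
        (columns π r (n + 1) k) (columns π r (n + 1) (k + 1)) := by
    unfold stepKernel grow shrink
    split_ifs with h
    · exact finprod_congr fun k => if_pos (columns_of_lt π h k)
    · exact finprod_congr fun k => if_pos (columns_of_le π (not_lt.1 h) k)
  rw [key, finprod_eq_prod_of_mulSupport_subset (s := Finset.range (π.part 0 0))]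
  · refine Finset.prod_congr rfl fun k _ => ?_
    have h1 := antitone_columns π r n (Nat.le_succ k)
    have h2 := antitone_columns π r (n + 1) (Nat.le_succ k)
    simp only [stepWeight, gap]
    refine if_congr ?_ rfl rfl
    simp only [Nat.succ_eq_add_one] at h1 h2
    omega
  · intro k hk
    by_contra h
    rw [Finset.mem_coe, Finset.mem_range, not_lt] at h
    apply hk
    simp [columns_eq_zero_of_le π r _ h, columns_eq_zero_of_le π r _ (h.trans (Nat.le_succ k)),
      stepWeight]

lemma Apoly_eq_prod (t : ℝ) {π : PlanePartition} {r c : ℕ}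
    (hπ : ∀ i j, r ≤ i ∨ c ≤ j → π.part i j = 0) :
    Apoly t π = ∏ n ∈ Finset.range (r + c),
      stepKernel t r n (columns π r n) (columns π r (n + 1)) := by
  classical
  rw [Apoly, ← finprod_mem_eq_of_bijOn (f := fun x => 1 - t ^ gap π r x.1 x.2) _ (bijOn_drops hπ)]
  · have : drops π r (r + c) = ((Finset.range (r + c) ×ˢ Finset.range (π.part 0 0)).filter
        fun x => gap π r (x.1 + 1) x.2 < gap π r x.1 x.2 : Finset (ℕ × ℕ)) := by
      ext ⟨n, k⟩
      simp only [drops, Set.mem_ofPred_eq, Finset.coe_filter, Finset.mem_product, Finset.mem_range]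
      refine ⟨fun h => ⟨⟨h.1, ?_⟩, h.2⟩, fun h => ⟨h.1.1, h.2⟩⟩
      by_contra! hk
      have := h.2
      simp only [gap, columns_eq_zero_of_le π r _ hk] at this
      omega
    rw [this, finprod_mem_coe_finset, Finset.prod_filter, Finset.prod_product]
    simp only [stepKernel_columns]
  · rintro ⟨n, k⟩ ⟨-, hd⟩
    simp only at hd ⊢
    rw [borderLevel_eq, level_levelBox π (by omega) le_rfl]
    rw [part_levelBox π (by omega) le_rfl]
    omega

lemma tsum_Apoly_mul_pow {t s : ℝ} (ht0 : 0 ≤ t) (ht1 : t ≤ 1) (hs0 : 0 ≤ s) (hs1 : s < 1)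
    (r c : ℕ) :
    ∑' π : {π : PlanePartition // ∀ i j, r ≤ i ∨ c ≤ j → π.part i j = 0},
        Apoly t π.1 * s ^ π.1.weight =
      ∏ i ∈ Finset.range r, ∏ j ∈ Finset.range c,
        (1 - t * s ^ (i + j + 1)) / (1 - s ^ (i + j + 1)) := by
  have hnonneg (π : {π : PlanePartition // ∀ i j, r ≤ i ∨ c ≤ j → π.part i j = 0}) :
      0 ≤ Apoly t π.1 * s ^ π.1.weight := by
    rw [Apoly_eq_prod t π.2]
    exact mul_nonneg (Finset.prod_nonneg fun n _ => stepKernel_nonneg ht0 ht1 _ _ _ _)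
      (pow_nonneg hs0 _)
  have hfactor (n : ℕ) : 0 ≤ (1 - t * s ^ n) / (1 - s ^ n) := by
    have h1 := pow_le_one₀ (n := n) hs0 hs1.le
    have h2 := pow_nonneg hs0 n
    exact div_nonneg (by nlinarith) (by linarith)
  have h := tsum_chainWeight_columns t s r c
  rw [chainSum_add ht0 ht1 hs0 hs1, chainSum_zero t s r r le_rfl, Finset.prod_comm] at h
  simp only [map_zero, pow_zero, mul_one, commFactor, ← pow_add] at h
  have e (i j : ℕ) : i + 1 + j = i + j + 1 := by omega
  simp only [e] at h
  have h' := congrArg ENNReal.toReal h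
  rw [ENNReal.toReal_prod] at h'
  simp only [ENNReal.toReal_prod, ENNReal.toReal_ofReal (hfactor _)] at h'
  rw [← h', ENNReal.tsum_toReal_eq]
  · refine tsum_congr fun π => ?_
    rw [chainWeight_columns ht0 ht1 hs0 π.2, ← Apoly_eq_prod t π.2,
      ENNReal.toReal_ofReal (hnonneg π)]
  · intro π
    rw [chainWeight_columns ht0 ht1 hs0 π.2]
    exact ENNReal.ofReal_ne_top

end HallLittlewood

/-- **Generalized MacMahon's formula (Hall–Littlewood's case, boxed version).**
For positive integers `r`, `c`,
`∑_{π ∈ P(r,c)} A_π(t) s^{|π|}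
  = ∏_{i=1}^{r} ∏_{j=1}^{c} (1 - t s^{i+j-1}) / (1 - s^{i+j-1})`,
for real parameters `0 ≤ t, s < 1`. -/
theorem generalized_macmahon_hall_littlewood_boxed
    (t s : ℝ) (ht0 : 0 ≤ t) (ht1 : t < 1) (hs0 : 0 ≤ s) (hs1 : s < 1)
    (r c : ℕ) (hr : 0 < r) (hc : 0 < c) :
    ∑' π : {π : PlanePartition // ∀ i j, r ≤ i ∨ c ≤ j → π.part i j = 0},
        Apoly t π.1 * s ^ π.1.weight =
      ∏ i ∈ Finset.range r, ∏ j ∈ Finset.range c,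
        (1 - t * s ^ (i + j + 1)) / (1 - s ^ (i + j + 1)) :=
  HallLittlewood.tsum_Apoly_mul_pow ht0 ht1.le hs0 hs1 r c
end

section
/- Generalized MacMahon's formula (Hall-Littlewood's case, full version): ∑_{π ∈ P} A_π(t) s^{|π|} = ∏_{n=1}^{∞} [ (1 - t s^n) / (1 - s^n) ]^n, where the sum is over all plane partitions, as an identity of formal power series in s whose coefficients are polynomials in t (equivalently, for real parameters 0 ≤ t, s < 1). -/
open scoped BigOperators

set_option linter.unusedSimpArgs false


/-- Weakly decreasing sequences of naturals that are eventually zero (partitions). -/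
def DecrSeq : Type := {f : ℕ → ℕ // Antitone f ∧ ∃ K, f K = 0}

namespace DecrSeq

instance : CoeFun DecrSeq (fun _ => ℕ → ℕ) := ⟨fun f => f.1⟩

theorem antitone (α : DecrSeq) : Antitone α := α.2.1

theorem eq_zero_of_le (α : DecrSeq) {K k : ℕ} (h : α K = 0) (hk : K ≤ k) : α k = 0 :=
  Nat.le_zero.1 ((α.antitone hk).trans h.le)

theorem ext {α β : DecrSeq} (h : ∀ k, α k = β k) : α = β := Subtype.ext (funext h)

/-- The empty partition. -/
def empty : DecrSeq := ⟨fun _ => 0, fun _ _ _ => le_rfl, 0, rfl⟩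

@[simp] theorem empty_apply (k : ℕ) : empty k = 0 := rfl

/-- Removal of the first term. -/
def tail (α : DecrSeq) : DecrSeq :=
  ⟨fun k => α (k + 1), fun _ _ h => α.antitone (Nat.succ_le_succ h), by
    obtain ⟨K, hK⟩ := α.2.2
    exact ⟨K, α.eq_zero_of_le hK (Nat.le_succ K)⟩⟩

@[simp] theorem tail_apply (α : DecrSeq) (k : ℕ) : α.tail k = α (k + 1) := rfl

/-- Insertion of a new first term. -/
def cons (n : ℕ) (α : DecrSeq) (h : α 0 ≤ n) : DecrSeq :=
  ⟨fun k => Nat.casesOn k n α, by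
    apply antitone_nat_of_succ_le
    intro k
    cases k with
    | zero => exact h
    | succ k => exact α.antitone (Nat.le_succ k), by
    obtain ⟨K, hK⟩ := α.2.2
    exact ⟨K + 1, hK⟩⟩

@[simp] theorem cons_zero (n : ℕ) (α : DecrSeq) (h : α 0 ≤ n) : cons n α h 0 = n := rfl

@[simp] theorem cons_succ (n : ℕ) (α : DecrSeq) (h : α 0 ≤ n) (k : ℕ) :
    cons n α h (k + 1) = α k := rfl

@[simp] theorem tail_cons (n : ℕ) (α : DecrSeq) (h : α 0 ≤ n) : (cons n α h).tail = α := rfl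

theorem tail_zero_le (α : DecrSeq) : α.tail 0 ≤ α 0 := α.antitone (Nat.zero_le 1)

theorem cons_tail (α : DecrSeq) : cons (α 0) α.tail α.tail_zero_le = α :=
  ext fun k => by cases k <;> rfl

theorem hasSum_of_tail {n : ℕ} {h : DecrSeq → ℝ} {a : ℝ}
    (H : HasSum (fun τ : DecrSeq => if τ 0 ≤ n then h τ else 0) a) :
    HasSum (fun α : DecrSeq => if α 0 = n then h α.tail else 0) a := by
  have key : ∀ x : Function.support (fun τ : DecrSeq => if τ 0 ≤ n then h τ else 0),
      x.1 0 ≤ n := fun x => by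
    by_contra hx
    exact x.2 (if_neg hx)
  refine (hasSum_iff_hasSum_of_ne_zero_bij (fun x => cons n x.1 (key x)) ?_ ?_ ?_).2 H
  · intro x y hxy
    exact Subtype.ext (by simpa using congrArg tail hxy)
  · intro α hα
    have h0 : α 0 = n := by
      by_contra hne
      exact hα (if_neg hne)
    have h1 : h α.tail ≠ 0 := fun h1 => hα (by simp [h1])
    have h2 : α.tail 0 ≤ n := h0 ▸ α.tail_zero_le
    refine ⟨⟨α.tail, ?_⟩, ?_⟩
    · simpa [h1] using h2
    · subst h0
      exact α.cons_tail
  · intro x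
    have := key x
    simp [this]

end DecrSeq

theorem finprod_nat_eq_prod_range {M : Type*} [CommMonoid M] {f : ℕ → M} {K : ℕ}
    (h : ∀ k, K ≤ k → f k = 1) : ∏ᶠ k, f k = ∏ k ∈ Finset.range K, f k := by
  refine finprod_eq_prod_of_mulSupport_subset f fun k hk => ?_
  by_contra hK
  exact hk (h k (by simpa using hK))

theorem finprod_nat_succ {M : Type*} [CommMonoid M] {f : ℕ → M} {K : ℕ}
    (h : ∀ k, K ≤ k → f k = 1) : ∏ᶠ k, f k = f 0 * ∏ᶠ k, f (k + 1) := by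
  rw [finprod_nat_eq_prod_range (K := K + 1) fun k hk => h k (by omega),
    finprod_nat_eq_prod_range (f := fun k => f (k + 1)) (K := K) fun k hk => h _ (by omega),
    Finset.prod_range_succ', mul_comm]

/-- The weight of a step from `a` to `b`, allowing `b = a` or `b = a + 1`. -/
def stepWeight (x : ℝ) (a b : ℕ) : ℝ := if b = a then 1 else if b = a + 1 then x else 0

/-- The factor `1 - t ^ (a - a')` recording that the multiplicity `a - a'` exceeds `b - b'`. -/
def dropFactor (t : ℝ) (a a' b b' : ℕ) : ℝ := if b + a' < a + b' then 1 - t ^ (a - a') else 1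

/-- The one-variable Hall-Littlewood weight for adding a horizontal strip to `α`
(in terms of conjugate partitions). -/
noncomputable def upKernel (t x : ℝ) (α β : DecrSeq) : ℝ :=
  ∏ᶠ k, stepWeight x (α k) (β k) * dropFactor t (α k) (α (k + 1)) (β k) (β (k + 1))

/-- The one-variable Hall-Littlewood weight for removing a horizontal strip from `α`
(in terms of conjugate partitions). -/
noncomputable def downKernel (t y : ℝ) (α β : DecrSeq) : ℝ :=
  ∏ᶠ k, stepWeight y (β k) (α k) * dropFactor t (α k) (α (k + 1)) (β k) (β (k + 1))

@[simp] theorem stepWeight_self (x : ℝ) (a : ℕ) : stepWeight x a a = 1 := if_pos rfl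

theorem stepWeight_nonneg {x : ℝ} (hx : 0 ≤ x) (a b : ℕ) : 0 ≤ stepWeight x a b := by
  unfold stepWeight
  split_ifs <;> positivity

theorem dropFactor_nonneg {t : ℝ} (h0 : 0 ≤ t) (h1 : t ≤ 1) (a a' b b' : ℕ) :
    0 ≤ dropFactor t a a' b b' := by
  unfold dropFactor
  split_ifs
  · exact sub_nonneg.2 (pow_le_one₀ h0 h1)
  · exact zero_le_one

theorem upKernel_nonneg {t x : ℝ} (h0 : 0 ≤ t) (h1 : t ≤ 1) (hx : 0 ≤ x) (α β : DecrSeq) :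
    0 ≤ upKernel t x α β :=
  finprod_nonneg fun _ => mul_nonneg (stepWeight_nonneg hx _ _) (dropFactor_nonneg h0 h1 _ _ _ _)

theorem downKernel_nonneg {t y : ℝ} (h0 : 0 ≤ t) (h1 : t ≤ 1) (hy : 0 ≤ y) (α β : DecrSeq) :
    0 ≤ downKernel t y α β :=
  finprod_nonneg fun _ => mul_nonneg (stepWeight_nonneg hy _ _) (dropFactor_nonneg h0 h1 _ _ _ _)

theorem upKernel_factor_eq_one (t x : ℝ) {α β : DecrSeq} {K : ℕ} (hα : α K = 0) (hβ : β K = 0)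
    (k : ℕ) (hk : K ≤ k) :
    stepWeight x (α k) (β k) * dropFactor t (α k) (α (k + 1)) (β k) (β (k + 1)) = 1 := by
  simp [α.eq_zero_of_le hα hk, β.eq_zero_of_le hβ hk, α.eq_zero_of_le hα (hk.trans k.le_succ),
    β.eq_zero_of_le hβ (hk.trans k.le_succ), dropFactor]

theorem downKernel_factor_eq_one (t y : ℝ) {α β : DecrSeq} {K : ℕ} (hα : α K = 0) (hβ : β K = 0)
    (k : ℕ) (hk : K ≤ k) :
    stepWeight y (β k) (α k) * dropFactor t (α k) (α (k + 1)) (β k) (β (k + 1)) = 1 := by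
  simp [α.eq_zero_of_le hα hk, β.eq_zero_of_le hβ hk, α.eq_zero_of_le hα (hk.trans k.le_succ),
    β.eq_zero_of_le hβ (hk.trans k.le_succ), dropFactor]

theorem DecrSeq.exists_common_bound (α β : DecrSeq) : ∃ K, α K = 0 ∧ β K = 0 := by
  obtain ⟨K, hK⟩ := α.2.2
  obtain ⟨L, hL⟩ := β.2.2
  exact ⟨max K L, α.eq_zero_of_le hK (le_max_left _ _), β.eq_zero_of_le hL (le_max_right _ _)⟩

theorem upKernel_eq_prod (t x : ℝ) {α β : DecrSeq} {K : ℕ} (hα : α K = 0) (hβ : β K = 0) :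
    upKernel t x α β = ∏ k ∈ Finset.range K,
      stepWeight x (α k) (β k) * dropFactor t (α k) (α (k + 1)) (β k) (β (k + 1)) :=
  finprod_nat_eq_prod_range (upKernel_factor_eq_one t x hα hβ)

theorem downKernel_eq_prod (t y : ℝ) {α β : DecrSeq} {K : ℕ} (hα : α K = 0) (hβ : β K = 0) :
    downKernel t y α β = ∏ k ∈ Finset.range K,
      stepWeight y (β k) (α k) * dropFactor t (α k) (α (k + 1)) (β k) (β (k + 1)) :=
  finprod_nat_eq_prod_range (downKernel_factor_eq_one t y hα hβ)

theorem upKernel_succ (t x : ℝ) (α β : DecrSeq) :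
    upKernel t x α β = stepWeight x (α 0) (β 0) * dropFactor t (α 0) (α 1) (β 0) (β 1) *
      upKernel t x α.tail β.tail := by
  obtain ⟨K, hα, hβ⟩ := α.exists_common_bound β
  exact finprod_nat_succ (upKernel_factor_eq_one t x hα hβ)

theorem downKernel_succ (t y : ℝ) (α β : DecrSeq) :
    downKernel t y α β = stepWeight y (β 0) (α 0) * dropFactor t (α 0) (α 1) (β 0) (β 1) *
      downKernel t y α.tail β.tail := by
  obtain ⟨K, hα, hβ⟩ := α.exists_common_bound β
  exact finprod_nat_succ (downKernel_factor_eq_one t y hα hβ)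

theorem upKernel_step {t x : ℝ} {α β : DecrSeq} (h : upKernel t x α β ≠ 0) (k : ℕ) :
    β k = α k ∨ β k = α k + 1 := by
  obtain ⟨K, hα, hβ⟩ := α.exists_common_bound β
  by_contra! hk
  rcases lt_or_ge k K with hlt | hle
  · rw [upKernel_eq_prod t x hα hβ, Finset.prod_ne_zero_iff] at h
    exact h k (Finset.mem_range.2 hlt) (by simp [stepWeight, hk])
  · exact hk.1 (by rw [α.eq_zero_of_le hα hle, β.eq_zero_of_le hβ hle])

theorem downKernel_step {t y : ℝ} {α β : DecrSeq} (h : downKernel t y α β ≠ 0) (k : ℕ) :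
    α k = β k ∨ α k = β k + 1 := by
  obtain ⟨K, hα, hβ⟩ := α.exists_common_bound β
  by_contra! hk
  rcases lt_or_ge k K with hlt | hle
  · rw [downKernel_eq_prod t y hα hβ, Finset.prod_ne_zero_iff] at h
    exact h k (Finset.mem_range.2 hlt) (by simp [stepWeight, hk])
  · exact hk.1 (by rw [α.eq_zero_of_le hα hle, β.eq_zero_of_le hβ hle])

theorem stepWeight_of_eq (x : ℝ) {a b : ℕ} (h : b = a) : stepWeight x a b = 1 := if_pos h

theorem stepWeight_of_eq_succ (x : ℝ) {a b : ℕ} (h : b = a + 1) : stepWeight x a b = x := by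
  simp [stepWeight, h]

theorem stepWeight_of_ne (x : ℝ) {a b : ℕ} (h : b ≠ a) (h' : b ≠ a + 1) :
    stepWeight x a b = 0 := by
  simp [stepWeight, h, h']

theorem dropFactor_of_lt (t : ℝ) {a a' b b' : ℕ} (h : b + a' < a + b') :
    dropFactor t a a' b b' = 1 - t ^ (a - a') := if_pos h

theorem dropFactor_of_le (t : ℝ) {a a' b b' : ℕ} (h : a + b' ≤ b + a') :
    dropFactor t a a' b b' = 1 := if_neg (not_lt.2 h)

/-- The linear relations linking the two boundary vectors in the one-variable
skew Cauchy identity. -/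
structure BalancedVectors (t x y : ℝ) (a b : ℕ) (A₀ A₁ B₀ B₁ : ℝ) : Prop where
  bottom : min a b = 0 → B₀ = 0
  free_sum : a = b → (1 - x * y) * (A₀ + A₁) = (1 - t * (x * y)) * (B₀ + B₁)
  free_twist : a = b → (1 - x * y) * (A₁ + x * y * t * A₀) =
    (1 - t * (x * y)) * (x * y * B₁ + t * B₀)
  forced_left : a ≠ b → A₀ = 0 ∧ B₀ = 0
  forced_right : a ≠ b → (1 - x * y) * A₁ = (1 - t * (x * y)) * B₁
  far : a ≠ b → a ≠ b + 1 → b ≠ a + 1 → A₁ = 0 ∧ B₁ = 0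

/-- The transfer weight between consecutive columns on the outer side. -/
noncomputable def outerTransfer (t x y : ℝ) (a a' b b' n n' : ℕ) : ℝ :=
  if n' ≤ n then stepWeight x a n * dropFactor t a a' n n' *
    (stepWeight y b n * dropFactor t n n' b b') else 0

/-- The transfer weight between consecutive columns on the inner side. -/
noncomputable def innerTransfer (t x y : ℝ) (a a' b b' n n' : ℕ) : ℝ :=
  if n' ≤ n then stepWeight y n a * dropFactor t a a' n n' *
    (stepWeight x n b * dropFactor t n n' b b') else 0

theorem BalancedVectors.transfer {t x y : ℝ} {a b a' b' : ℕ} (ha : a' ≤ a) (hb : b' ≤ b)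
    (hpos : ¬ (a = 0 ∧ b = 0)) {A₀ A₁ B₀ B₁ : ℝ}
    (h : BalancedVectors t x y a' b' A₀ A₁ B₀ B₁) :
    BalancedVectors t x y a b
      (outerTransfer t x y a a' b b' (min a b) (min a' b') * A₀ +
        outerTransfer t x y a a' b b' (min a b) (min a' b' + 1) * A₁)
      (outerTransfer t x y a a' b b' (min a b + 1) (min a' b') * A₀ +
        outerTransfer t x y a a' b b' (min a b + 1) (min a' b' + 1) * A₁)
      (if min a b = 0 then 0 else
        innerTransfer t x y a a' b b' (min a b - 1) (min a' b' - 1) * B₀ +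
        innerTransfer t x y a a' b b' (min a b - 1) (min a' b') * B₁)
      (innerTransfer t x y a a' b b' (min a b) (min a' b' - 1) * B₀ +
        innerTransfer t x y a a' b b' (min a b) (min a' b') * B₁) := by
  have exp_eq : ∀ c q : ℕ, c + (1 + q) - (c + 1) = q := fun c q => by omega
  have exp_eq' : ∀ c : ℕ, c + 1 + 1 - (c + 1) = 1 := fun c => by omega
  obtain ⟨h1, h2, h3, h4, h5, h6⟩ := h
  have far : a ≠ b → a ≠ b + 1 → b ≠ a + 1 → ∀ n n' : ℕ,
      outerTransfer t x y a a' b b' n n' = 0 ∧ innerTransfer t x y a a' b b' n n' = 0 := by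
    intro g1 g2 g3 n n'
    constructor
    · rw [outerTransfer]
      by_cases k1 : n = a ∨ n = a + 1
      · rw [stepWeight_of_ne y (by omega : n ≠ b) (by omega)]; simp
      · rw [stepWeight_of_ne x (by omega : n ≠ a) (by omega)]; simp
    · rw [innerTransfer]
      by_cases k1 : a = n ∨ a = n + 1
      · rw [stepWeight_of_ne x (by omega : b ≠ n) (by omega)]; simp
      · rw [stepWeight_of_ne y (by omega : a ≠ n) (by omega)]; simp
  have sup : a ≠ b → ∀ n', outerTransfer t x y a a' b b' (min a b) n' = 0 ∧ (min a b ≠ 0 →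
      innerTransfer t x y a a' b b' (min a b - 1) n' = 0) := by
    intro hne n'
    constructor
    · rw [outerTransfer]
      rcases lt_or_ge a b with k | k
      · rw [stepWeight_of_ne y (by omega : min a b ≠ b) (by omega)]; simp
      · rw [stepWeight_of_ne x (by omega : min a b ≠ a) (by omega)]; simp
    · intro hm
      rw [innerTransfer]
      rcases lt_or_ge a b with k | k
      · rw [stepWeight_of_ne x (by omega : b ≠ min a b - 1) (by omega)]; simp
      · rw [stepWeight_of_ne y (by omega : a ≠ min a b - 1) (by omega)]; simp
  have tails : a' = b' ∨ (a' = b' + 1 ∧ A₀ = 0 ∧ B₀ = 0) ∨ (b' = a' + 1 ∧ A₀ = 0 ∧ B₀ = 0) ∨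
      (A₀ = 0 ∧ B₀ = 0 ∧ A₁ = 0 ∧ B₁ = 0) := by
    rcases eq_or_ne a' b' with h | h
    · exact Or.inl h
    rcases eq_or_ne a' (b' + 1) with g | g
    · exact Or.inr (Or.inl ⟨g, h4 h⟩)
    rcases eq_or_ne b' (a' + 1) with l | l
    · exact Or.inr (Or.inr (Or.inl ⟨l, h4 h⟩))
    exact Or.inr (Or.inr (Or.inr ⟨(h4 h).1, (h4 h).2, h6 h g l⟩))
  have free : a = b → (1 - x * y) * ((outerTransfer t x y a a' b b' (min a b) (min a' b') * A₀ +
        outerTransfer t x y a a' b b' (min a b) (min a' b' + 1) * A₁) +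
      (outerTransfer t x y a a' b b' (min a b + 1) (min a' b') * A₀ +
        outerTransfer t x y a a' b b' (min a b + 1) (min a' b' + 1) * A₁)) =
      (1 - t * (x * y)) * ((innerTransfer t x y a a' b b' (min a b - 1) (min a' b' - 1) * B₀ +
        innerTransfer t x y a a' b b' (min a b - 1) (min a' b') * B₁) +
      (innerTransfer t x y a a' b b' (min a b) (min a' b' - 1) * B₀ +
        innerTransfer t x y a a' b b' (min a b) (min a' b') * B₁)) ∧
      (1 - x * y) * ((outerTransfer t x y a a' b b' (min a b + 1) (min a' b') * A₀ +
        outerTransfer t x y a a' b b' (min a b + 1) (min a' b' + 1) * A₁) +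
       x * y * t * (outerTransfer t x y a a' b b' (min a b) (min a' b') * A₀ +
        outerTransfer t x y a a' b b' (min a b) (min a' b' + 1) * A₁)) =
      (1 - t * (x * y)) * (x * y *
      (innerTransfer t x y a a' b b' (min a b) (min a' b' - 1) * B₀ +
        innerTransfer t x y a a' b b' (min a b) (min a' b') * B₁) +
       t * (innerTransfer t x y a a' b b' (min a b - 1) (min a' b' - 1) * B₀ +
        innerTransfer t x y a a' b b' (min a b - 1) (min a' b') * B₁)) := by
    rintro rfl
    clear sup far
    rcases tails with rfl | ⟨rfl, rfl, rfl⟩ | ⟨rfl, rfl, rfl⟩ | ⟨rfl, rfl, rfl, rfl⟩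
    · obtain ⟨r, rfl⟩ := Nat.exists_eq_add_of_le ha
      simp only [min_self, forall_const] at h1 h2 h3 ⊢
      rcases r with - | r
      · obtain ⟨c, rfl⟩ := Nat.exists_eq_succ_of_ne_zero (by omega : a' ≠ 0)
        simp (disch := omega) only [outerTransfer, innerTransfer, stepWeight_of_eq,
          stepWeight_of_eq_succ, stepWeight_of_ne, dropFactor_of_lt, dropFactor_of_le,
          if_pos, if_neg, mul_one, one_mul, zero_mul, mul_zero, add_zero, zero_add,
          Nat.add_sub_cancel_left, add_assoc, Nat.succ_eq_add_one, Nat.add_sub_cancel, Nat.sub_self, pow_zero, sub_self,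
          pow_one, tsub_zero, exp_eq, exp_eq']
        constructor
        · linear_combination (1 + x * y) * h2 - h3
        · linear_combination (x * y * (1 + t) - t * (x * y)) * h2
      · rcases a' with - | c
        · obtain rfl : B₀ = 0 := h1 rfl
          simp (disch := omega) only [outerTransfer, innerTransfer, stepWeight_of_eq,
            stepWeight_of_eq_succ, stepWeight_of_ne, dropFactor_of_lt, dropFactor_of_le,
            if_pos, if_neg, mul_one, one_mul, zero_mul, mul_zero, add_zero, zero_add,
            Nat.add_sub_cancel_left, add_assoc, Nat.succ_eq_add_one, Nat.add_sub_cancel, Nat.sub_self, pow_zero, sub_self,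
          pow_one, tsub_zero, exp_eq, exp_eq']
          constructor
          · linear_combination (1 + x * y) * h2 - t ^ (r + 1) * h3
          · linear_combination (x * y * (1 + t) - x * y * t * t ^ (r + 1)) * h2
        simp (disch := omega) only [outerTransfer, innerTransfer, stepWeight_of_eq,
          stepWeight_of_eq_succ, stepWeight_of_ne, dropFactor_of_lt, dropFactor_of_le,
          if_pos, if_neg, mul_one, one_mul, zero_mul, mul_zero, add_zero, zero_add,
          Nat.add_sub_cancel_left, add_assoc, Nat.succ_eq_add_one, Nat.add_sub_cancel, Nat.sub_self, pow_zero, sub_self,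
          pow_one, tsub_zero, exp_eq, exp_eq']
        constructor
        · linear_combination (1 + x * y) * h2 - t ^ (r + 1) * h3
        · linear_combination (x * y * (1 + t) - x * y * t * t ^ (r + 1)) * h2
    · obtain ⟨r, rfl⟩ := Nat.exists_eq_add_of_le ha
      simp only [ne_eq, Nat.succ_ne_self, not_false_eq_true, forall_const, add_eq_left, one_ne_zero] at h5
      simp (disch := omega) only [min_self, min_eq_right, outerTransfer, innerTransfer, stepWeight_of_eq,
          stepWeight_of_eq_succ, stepWeight_of_ne, dropFactor_of_lt, dropFactor_of_le,
          if_pos, if_neg, mul_one, one_mul, zero_mul, mul_zero, add_zero, zero_add,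
          Nat.add_sub_cancel_left, add_assoc, Nat.succ_eq_add_one, Nat.add_sub_cancel, Nat.sub_self, pow_zero, sub_self,
          pow_one, tsub_zero, exp_eq, exp_eq']
      constructor
      · linear_combination (1 + x * y) * h5
      · linear_combination x * y * (1 + t) * h5
    · obtain ⟨r, rfl⟩ := Nat.exists_eq_add_of_le hb
      simp only [ne_eq, Nat.succ_ne_self, not_false_eq_true, forall_const, left_eq_add, one_ne_zero] at h5
      simp (disch := omega) only [min_self, min_eq_left, outerTransfer, innerTransfer, stepWeight_of_eq,
          stepWeight_of_eq_succ, stepWeight_of_ne, dropFactor_of_lt, dropFactor_of_le,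
          if_pos, if_neg, mul_one, one_mul, zero_mul, mul_zero, add_zero, zero_add,
          Nat.add_sub_cancel_left, add_assoc, Nat.succ_eq_add_one, Nat.add_sub_cancel, Nat.sub_self, pow_zero, sub_self,
          pow_one, tsub_zero, exp_eq, exp_eq']
      constructor
      · linear_combination (1 - t ^ (r + 1)) * (1 + x * y) * h5
      · linear_combination (1 - t ^ (r + 1)) * (x * y * (1 + t)) * h5
    · simp
  constructor
  · intro h
    simp [h]
  · intro h
    rw [if_neg (by omega), (free h).1]
  · intro h
    rw [if_neg (by omega), (free h).2]
  · intro hne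
    refine ⟨by simp [sup hne], ?_⟩
    split_ifs with hm
    · rfl
    · simp [sup hne, hm]
  · intro hne
    have sup0 := fun n' => (sup hne n').1
    rcases eq_or_ne a (b + 1) with rfl | g1
    · clear sup far free
      rcases tails with rfl | ⟨rfl, rfl, rfl⟩ | ⟨rfl, rfl, rfl⟩ | ⟨rfl, rfl, rfl, rfl⟩
      · obtain ⟨r, rfl⟩ := Nat.exists_eq_add_of_le hb
        simp only [min_self, forall_const] at h1 h2 h3
        rcases a' with - | c
        · obtain rfl : B₀ = 0 := h1 rfl
          simp (disch := omega) only [min_self, min_eq_right, outerTransfer, innerTransfer, stepWeight_of_eq,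
          stepWeight_of_eq_succ, stepWeight_of_ne, dropFactor_of_lt, dropFactor_of_le,
          if_pos, if_neg, mul_one, one_mul, zero_mul, mul_zero, add_zero, zero_add,
          Nat.add_sub_cancel_left, add_assoc, Nat.succ_eq_add_one, Nat.add_sub_cancel, Nat.sub_self, pow_zero, sub_self,
          pow_one, tsub_zero, exp_eq, exp_eq']
          linear_combination y * (1 - t ^ (r + 1)) * h2
        simp (disch := omega) only [min_self, min_eq_right, outerTransfer, innerTransfer, stepWeight_of_eq,
          stepWeight_of_eq_succ, stepWeight_of_ne, dropFactor_of_lt, dropFactor_of_le,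
          if_pos, if_neg, mul_one, one_mul, zero_mul, mul_zero, add_zero, zero_add,
          Nat.add_sub_cancel_left, add_assoc, Nat.succ_eq_add_one, Nat.add_sub_cancel, Nat.sub_self, pow_zero, sub_self,
          pow_one, tsub_zero, exp_eq, exp_eq']
        linear_combination y * (1 - t ^ (r + 1)) * h2
      · obtain ⟨r, rfl⟩ := Nat.exists_eq_add_of_le hb
        simp only [ne_eq, Nat.succ_ne_self, not_false_eq_true, forall_const, add_eq_left, one_ne_zero] at h5
        simp (disch := omega) only [min_self, min_eq_right, outerTransfer, innerTransfer, stepWeight_of_eq,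
          stepWeight_of_eq_succ, stepWeight_of_ne, dropFactor_of_lt, dropFactor_of_le,
          if_pos, if_neg, mul_one, one_mul, zero_mul, mul_zero, add_zero, zero_add,
          Nat.add_sub_cancel_left, add_assoc, Nat.succ_eq_add_one, Nat.add_sub_cancel, Nat.sub_self, pow_zero, sub_self,
          pow_one, tsub_zero, exp_eq, exp_eq']
        linear_combination y * h5
      · obtain ⟨r, rfl⟩ := Nat.exists_eq_add_of_le hb
        simp only [ne_eq, Nat.succ_ne_self, not_false_eq_true, forall_const, left_eq_add, one_ne_zero] at h5
        simp (disch := omega) only [min_self, min_eq_left, min_eq_right, outerTransfer, innerTransfer, stepWeight_of_eq,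
          stepWeight_of_eq_succ, stepWeight_of_ne, dropFactor_of_lt, dropFactor_of_le,
          if_pos, if_neg, mul_one, one_mul, zero_mul, mul_zero, add_zero, zero_add,
          Nat.add_sub_cancel_left, add_assoc, Nat.succ_eq_add_one, Nat.add_sub_cancel, Nat.sub_self, pow_zero, sub_self,
          pow_one, tsub_zero, exp_eq, exp_eq']
        linear_combination (1 - t ^ (r + 2)) * y * (1 - t ^ (r + 1)) * h5
      · simp
    rcases eq_or_ne b (a + 1) with rfl | g2
    · clear sup far free
      rcases tails with rfl | ⟨rfl, rfl, rfl⟩ | ⟨rfl, rfl, rfl⟩ | ⟨rfl, rfl, rfl, rfl⟩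
      · obtain ⟨r, rfl⟩ := Nat.exists_eq_add_of_le ha
        simp only [min_self, forall_const] at h1 h2 h3
        rcases a' with - | c
        · obtain rfl : B₀ = 0 := h1 rfl
          simp (disch := omega) only [min_self, min_eq_left, outerTransfer, innerTransfer, stepWeight_of_eq,
          stepWeight_of_eq_succ, stepWeight_of_ne, dropFactor_of_lt, dropFactor_of_le,
          if_pos, if_neg, mul_one, one_mul, zero_mul, mul_zero, add_zero, zero_add,
          Nat.add_sub_cancel_left, add_assoc, Nat.succ_eq_add_one, Nat.add_sub_cancel, Nat.sub_self, pow_zero, sub_self,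
          pow_one, tsub_zero, exp_eq, exp_eq']
          linear_combination x * h2
        simp (disch := omega) only [min_self, min_eq_left, outerTransfer, innerTransfer, stepWeight_of_eq,
          stepWeight_of_eq_succ, stepWeight_of_ne, dropFactor_of_lt, dropFactor_of_le,
          if_pos, if_neg, mul_one, one_mul, zero_mul, mul_zero, add_zero, zero_add,
          Nat.add_sub_cancel_left, add_assoc, Nat.succ_eq_add_one, Nat.add_sub_cancel, Nat.sub_self, pow_zero, sub_self,
          pow_one, tsub_zero, exp_eq, exp_eq']
        linear_combination x * h2
      · obtain ⟨r, rfl⟩ := Nat.exists_eq_add_of_le ha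
        simp only [ne_eq, Nat.succ_ne_self, not_false_eq_true, forall_const, add_eq_left, one_ne_zero] at h5
        simp (disch := omega) only [min_self, min_eq_left, min_eq_right, outerTransfer, innerTransfer, stepWeight_of_eq,
          stepWeight_of_eq_succ, stepWeight_of_ne, dropFactor_of_lt, dropFactor_of_le,
          if_pos, if_neg, mul_one, one_mul, zero_mul, mul_zero, add_zero, zero_add,
          Nat.add_sub_cancel_left, add_assoc, Nat.succ_eq_add_one, Nat.add_sub_cancel, Nat.sub_self, pow_zero, sub_self,
          pow_one, tsub_zero, exp_eq, exp_eq']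
        linear_combination x * h5
      · obtain ⟨r, rfl⟩ := Nat.exists_eq_add_of_le ha
        simp only [ne_eq, Nat.succ_ne_self, not_false_eq_true, forall_const, left_eq_add, one_ne_zero] at h5
        simp (disch := omega) only [min_self, min_eq_left, outerTransfer, innerTransfer, stepWeight_of_eq,
          stepWeight_of_eq_succ, stepWeight_of_ne, dropFactor_of_lt, dropFactor_of_le,
          if_pos, if_neg, mul_one, one_mul, zero_mul, mul_zero, add_zero, zero_add,
          Nat.add_sub_cancel_left, add_assoc, Nat.succ_eq_add_one, Nat.add_sub_cancel, Nat.sub_self, pow_zero, sub_self,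
          pow_one, tsub_zero, exp_eq, exp_eq']
        linear_combination x * h5
      · simp
    simp [far hne g1 g2]
  · intro g1 g2 g3
    simp [far g1 g2 g3]

theorem upKernel_self (t x : ℝ) (α : DecrSeq) : upKernel t x α α = 1 := by
  unfold upKernel
  exact finprod_eq_one_of_forall_eq_one fun k => by simp [stepWeight, dropFactor]

theorem downKernel_self (t y : ℝ) (α : DecrSeq) : downKernel t y α α = 1 := by
  unfold downKernel
  exact finprod_eq_one_of_forall_eq_one fun k => by simp [stepWeight, dropFactor]

theorem eq_empty_of_downKernel_ne_zero {t y : ℝ} {β : DecrSeq}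
    (h : downKernel t y DecrSeq.empty β ≠ 0) : β = DecrSeq.empty :=
  DecrSeq.ext fun k => by
    have := downKernel_step h k
    simp only [DecrSeq.empty_apply] at this ⊢
    omega

theorem eq_empty_of_upKernel_ne_zero {t x : ℝ} {α : DecrSeq}
    (h : upKernel t x α DecrSeq.empty ≠ 0) : α = DecrSeq.empty :=
  DecrSeq.ext fun k => by
    have := upKernel_step h k
    simp only [DecrSeq.empty_apply] at this ⊢
    omega

namespace DecrSeq

/-- The sequence `1, …, 1, 0, 0, …` with `j` ones. -/
def ones (j : ℕ) : DecrSeq :=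
  ⟨fun k => if k < j then 1 else 0, fun a b h => by
    show (if b < j then 1 else 0) ≤ if a < j then 1 else 0
    split_ifs
    all_goals omega, j, by simp⟩

theorem ones_apply (j k : ℕ) : ones j k = if k < j then 1 else 0 := rfl

theorem ones_zero : ones 0 = empty := ext fun k => by simp [ones_apply]

theorem ones_injective : Function.Injective ones := by
  intro i j h
  have h1 : ones i i = ones j i := by rw [h]
  have h2 : ones i j = ones j j := by rw [h]
  simp only [ones_apply, lt_irrefl, if_false] at h1 h2
  split_ifs at h1 h2 <;> omega

theorem tail_ones_succ (j : ℕ) : (ones (j + 1)).tail = ones j :=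
  ext fun k => by simp [ones_apply]

theorem exists_eq_ones {α : DecrSeq} (h : α 0 ≤ 1) : ∃ j, ones j = α := by
  classical
  refine ⟨Nat.find α.2.2, ext fun k => ?_⟩
  rw [ones_apply]
  split_ifs with hk
  · have h1 : α k ≠ 0 := Nat.find_min α.2.2 hk
    have h2 := α.antitone (Nat.zero_le k)
    omega
  · exact (α.eq_zero_of_le (Nat.find_spec α.2.2) (not_lt.1 hk)).symm

theorem eq_empty_of_zero {α : DecrSeq} (h : α 0 = 0) : α = empty :=
  ext fun k => α.eq_zero_of_le h (Nat.zero_le k)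

end DecrSeq

theorem upKernel_empty_ones (t x : ℝ) (j : ℕ) :
    upKernel t x DecrSeq.empty (DecrSeq.ones j) = x ^ j := by
  induction j with
  | zero => rw [DecrSeq.ones_zero, upKernel_self, pow_zero]
  | succ j ih =>
    rw [upKernel_succ, DecrSeq.tail_ones_succ, show DecrSeq.empty.tail = DecrSeq.empty from rfl, ih]
    have h : dropFactor t 0 0 1 (DecrSeq.ones (j + 1) 1) = 1 := by
      rw [DecrSeq.ones_apply]
      split_ifs <;> simp [dropFactor]
    simp only [DecrSeq.empty_apply]
    rw [show DecrSeq.ones (j + 1) 0 = 1 from rfl, h]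
    simp [stepWeight, pow_succ']

theorem downKernel_ones_succ_empty (t y : ℝ) (j : ℕ) :
    downKernel t y (DecrSeq.ones (j + 1)) DecrSeq.empty = y ^ (j + 1) * (1 - t) := by
  induction j with
  | zero =>
    rw [downKernel_succ, DecrSeq.tail_ones_succ, show DecrSeq.empty.tail = DecrSeq.empty from rfl,
      DecrSeq.ones_zero, downKernel_self]
    simp [stepWeight, dropFactor, DecrSeq.ones_apply]
  | succ j ih =>
    rw [downKernel_succ, DecrSeq.tail_ones_succ, show DecrSeq.empty.tail = DecrSeq.empty from rfl,
      ih]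
    simp [stepWeight, dropFactor, DecrSeq.ones_apply, pow_succ']
    ring

theorem hasSum_outer_empty {t x y : ℝ} (h0 : 0 ≤ x * y) (h1 : x * y < 1) (φ : ℕ → ℝ) :
    HasSum (fun β : DecrSeq => φ (β 0) *
      (upKernel t x DecrSeq.empty β * downKernel t y β DecrSeq.empty))
      (φ 0 * 1 + φ 1 * (x * y * (1 - t) / (1 - x * y))) := by
  rw [← DecrSeq.ones_injective.hasSum_iff]
  · refine (hasSum_nat_add_iff' 1).1 ?_
    have h := ((hasSum_geometric_of_lt_one h0 h1).mul_left (φ 1 * (x * y * (1 - t))))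
    have hf : ∀ j : ℕ, φ (DecrSeq.ones (j + 1) 0) *
        (upKernel t x DecrSeq.empty (DecrSeq.ones (j + 1)) *
          downKernel t y (DecrSeq.ones (j + 1)) DecrSeq.empty) =
        φ 1 * (x * y * (1 - t)) * (x * y) ^ j := fun j => by
      rw [upKernel_empty_ones, downKernel_ones_succ_empty,
        show DecrSeq.ones (j + 1) 0 = 1 from rfl]
      ring
    have hz : φ (DecrSeq.ones 0 0) * (upKernel t x DecrSeq.empty (DecrSeq.ones 0) *
          downKernel t y (DecrSeq.ones 0) DecrSeq.empty) = φ 0 * 1 := by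
      rw [DecrSeq.ones_zero, upKernel_self, downKernel_self, DecrSeq.empty_apply, mul_one]
    simp only [Function.comp_apply, hf, Finset.sum_range_one, hz, add_sub_cancel_left]
    rw [mul_div_assoc', div_eq_mul_inv]
    exact h
  · intro β hβ
    by_contra hne
    have h2 := upKernel_step (left_ne_zero_of_mul (right_ne_zero_of_mul hne)) 0
    simp only [DecrSeq.empty_apply] at h2
    exact hβ (DecrSeq.exists_eq_ones (by omega))

theorem hasSum_inner_empty (t x y : ℝ) (φ : ℕ → ℝ) :
    HasSum (fun β : DecrSeq => φ (β 0) *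
      (downKernel t y DecrSeq.empty β * upKernel t x β DecrSeq.empty)) (φ 0) := by
  convert hasSum_single DecrSeq.empty ?_ using 1
  · simp [upKernel_self, downKernel_self]
  · intro β hβ
    by_contra hne
    exact hβ (eq_empty_of_downKernel_ne_zero (left_ne_zero_of_mul (right_ne_zero_of_mul hne)))

theorem DecrSeq.hasSum_of_two_heads {f : DecrSeq → ℝ} {g : ℕ → DecrSeq → ℝ} {m n : ℕ} {a b : ℝ}
    (hmn : m ≠ n) (hf : ∀ α : DecrSeq, f α = g (α 0) α.tail)
    (hsupp : ∀ α : DecrSeq, f α ≠ 0 → α 0 = m ∨ α 0 = n)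
    (hm : HasSum (fun τ : DecrSeq => if τ 0 ≤ m then g m τ else 0) a)
    (hn : HasSum (fun τ : DecrSeq => if τ 0 ≤ n then g n τ else 0) b) : HasSum f (a + b) := by
  convert (hasSum_of_tail hm).add (hasSum_of_tail hn) using 1
  funext α
  by_cases h1 : α 0 = m
  · have h2 : α 0 ≠ n := h1 ▸ hmn
    simp [hf, h1, hmn]
  by_cases h2 : α 0 = n
  · simp [hf, h2, hmn.symm]
  have : f α = 0 := by
    by_contra h
    rcases hsupp α h with h | h <;> contradiction
  simp [this, h1, h2]

theorem exists_balancedVectors {t x y : ℝ} (hxy0 : 0 ≤ x * y) (hxy1 : x * y < 1) (K : ℕ) :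
    ∀ μ ν : DecrSeq, μ K = 0 → ν K = 0 → ∃ A₀ A₁ B₀ B₁ : ℝ,
      BalancedVectors t x y (μ 0) (ν 0) A₀ A₁ B₀ B₁ ∧
      (∀ φ : ℕ → ℝ, HasSum (fun β : DecrSeq => φ (β 0) * (upKernel t x μ β * downKernel t y β ν))
        (φ (min (μ 0) (ν 0)) * A₀ + φ (min (μ 0) (ν 0) + 1) * A₁)) ∧
      (∀ φ : ℕ → ℝ, HasSum (fun β : DecrSeq => φ (β 0) * (downKernel t y μ β * upKernel t x β ν))
        (φ (min (μ 0) (ν 0) - 1) * B₀ + φ (min (μ 0) (ν 0)) * B₁)) := by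
  induction K with
  | zero =>
    intro μ ν hμ hν
    obtain rfl := DecrSeq.eq_empty_of_zero hμ
    obtain rfl := DecrSeq.eq_empty_of_zero hν
    have hne : 1 - x * y ≠ 0 := (sub_pos.2 hxy1).ne'
    refine ⟨1, x * y * (1 - t) / (1 - x * y), 0, 1, ⟨fun _ => rfl, fun _ => ?_, fun _ => ?_, ?_, ?_, ?_⟩,
      fun φ => ?_, fun φ => ?_⟩
    · field_simp
      ring
    · field_simp
      ring
    · simp
    · simp
    · simp
    · simpa using hasSum_outer_empty hxy0 hxy1 φ
    · simpa using hasSum_inner_empty t x y φ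
  | succ K ih =>
    intro μ ν hμ hν
    by_cases hpos : μ 0 = 0 ∧ ν 0 = 0
    · exact ih μ ν (μ.eq_zero_of_le hpos.1 K.zero_le) (ν.eq_zero_of_le hpos.2 K.zero_le)
    obtain ⟨A₀, A₁, B₀, B₁, hbal, hA, hB⟩ := ih μ.tail ν.tail hμ hν
    refine ⟨_, _, _, _, hbal.transfer μ.tail_zero_le ν.tail_zero_le hpos, fun φ => ?_, fun φ => ?_⟩
    · have key : ∀ n, HasSum (fun τ : DecrSeq => if τ 0 ≤ n then
          φ n * (stepWeight x (μ 0) n * dropFactor t (μ 0) (μ 1) n (τ 0) *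
          (stepWeight y (ν 0) n * dropFactor t n (τ 0) (ν 0) (ν 1))) *
          (upKernel t x μ.tail τ * downKernel t y τ ν.tail) else 0)
          (φ n * (outerTransfer t x y (μ 0) (μ 1) (ν 0) (ν 1) n (min (μ 1) (ν 1)) * A₀ +
            outerTransfer t x y (μ 0) (μ 1) (ν 0) (ν 1) n (min (μ 1) (ν 1) + 1) * A₁)) := by
        intro n
        have h := hA fun n' => φ n * outerTransfer t x y (μ 0) (μ 1) (ν 0) (ν 1) n n'
        simp only [DecrSeq.tail_apply, zero_add] at h
        rw [mul_add, ← mul_assoc, ← mul_assoc]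
        convert h using 2 with τ
        simp only [outerTransfer]
        split_ifs <;> ring
      refine DecrSeq.hasSum_of_two_heads (m := min (μ 0) (ν 0)) (n := min (μ 0) (ν 0) + 1)
        (g := fun n τ => φ n * (stepWeight x (μ 0) n * dropFactor t (μ 0) (μ 1) n (τ 0) *
          (stepWeight y (ν 0) n * dropFactor t n (τ 0) (ν 0) (ν 1))) *
          (upKernel t x μ.tail τ * downKernel t y τ ν.tail))
        (Nat.succ_ne_self _).symm ?_ ?_ (key _) (key _)
      · intro β
        rw [upKernel_succ, downKernel_succ]
        simp only [DecrSeq.tail_apply]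
        ring
      · intro β hβ
        have h1 := upKernel_step (left_ne_zero_of_mul (right_ne_zero_of_mul hβ)) 0
        have h2 := downKernel_step (right_ne_zero_of_mul (right_ne_zero_of_mul hβ)) 0
        omega
    · have key : ∀ n, HasSum (fun τ : DecrSeq => if τ 0 ≤ n then
          φ n * (stepWeight y n (μ 0) * dropFactor t (μ 0) (μ 1) n (τ 0) *
          (stepWeight x n (ν 0) * dropFactor t n (τ 0) (ν 0) (ν 1))) *
          (downKernel t y μ.tail τ * upKernel t x τ ν.tail) else 0)
          (φ n * (innerTransfer t x y (μ 0) (μ 1) (ν 0) (ν 1) n (min (μ 1) (ν 1) - 1) * B₀ +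
            innerTransfer t x y (μ 0) (μ 1) (ν 0) (ν 1) n (min (μ 1) (ν 1)) * B₁)) := by
        intro n
        have h := hB fun n' => φ n * innerTransfer t x y (μ 0) (μ 1) (ν 0) (ν 1) n n'
        simp only [DecrSeq.tail_apply, zero_add] at h
        rw [mul_add, ← mul_assoc, ← mul_assoc]
        convert h using 2 with τ
        simp only [innerTransfer]
        split_ifs <;> ring
      have hf : ∀ β : DecrSeq, φ (β 0) * (downKernel t y μ β * upKernel t x β ν) =
          φ (β 0) * (stepWeight y (β 0) (μ 0) * dropFactor t (μ 0) (μ 1) (β 0) (β.tail 0) *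
          (stepWeight x (β 0) (ν 0) * dropFactor t (β 0) (β.tail 0) (ν 0) (ν 1))) *
          (downKernel t y μ.tail β.tail * upKernel t x β.tail ν.tail) := by
        intro β
        rw [upKernel_succ, downKernel_succ]
        simp only [DecrSeq.tail_apply]
        ring
      have hs : ∀ β : DecrSeq, φ (β 0) * (downKernel t y μ β * upKernel t x β ν) ≠ 0 →
          (μ 0 = β 0 ∨ μ 0 = β 0 + 1) ∧ (ν 0 = β 0 ∨ ν 0 = β 0 + 1) := fun β hβ =>
        ⟨downKernel_step (left_ne_zero_of_mul (right_ne_zero_of_mul hβ)) 0,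
          upKernel_step (right_ne_zero_of_mul (right_ne_zero_of_mul hβ)) 0⟩
      by_cases hmin : min (μ 0) (ν 0) = 0
      · rw [if_pos hmin, mul_zero, zero_add, hmin]
        have h := DecrSeq.hasSum_of_tail (n := 0) (h := fun τ => φ 0 * (stepWeight y 0 (μ 0) *
          dropFactor t (μ 0) (μ 1) 0 (τ 0) *
          (stepWeight x 0 (ν 0) * dropFactor t 0 (τ 0) (ν 0) (ν 1))) *
          (downKernel t y μ.tail τ * upKernel t x τ ν.tail)) (key 0)
        convert h using 2 with β
        · by_cases hβ : β 0 = 0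
          · rw [if_pos hβ, hf, hβ]
          · rw [if_neg hβ]
            by_contra hne
            have := hs β hne
            omega
        · rfl
      · rw [if_neg hmin]
        refine DecrSeq.hasSum_of_two_heads (m := min (μ 0) (ν 0) - 1) (n := min (μ 0) (ν 0))
          (g := fun n τ => φ n * (stepWeight y n (μ 0) * dropFactor t (μ 0) (μ 1) n (τ 0) *
          (stepWeight x n (ν 0) * dropFactor t n (τ 0) (ν 0) (ν 1))) *
          (downKernel t y μ.tail τ * upKernel t x τ ν.tail))
          (by omega) hf ?_ (key _) (key _)
        intro β hβ
        have := hs β hβ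
        omega

/-- The skew Cauchy identity for a single pair of variables. -/
theorem hasSum_skew_cauchy {t x y : ℝ} (hxy0 : 0 ≤ x * y) (hxy1 : x * y < 1) (μ ν : DecrSeq) :
    ∃ c : ℝ, HasSum (fun β : DecrSeq => downKernel t y μ β * upKernel t x β ν) c ∧
      HasSum (fun β : DecrSeq => upKernel t x μ β * downKernel t y β ν)
        ((1 - t * (x * y)) / (1 - x * y) * c) := by
  obtain ⟨K, hμ, hν⟩ := DecrSeq.exists_common_bound μ ν
  obtain ⟨A₀, A₁, B₀, B₁, h, hA, hB⟩ := exists_balancedVectors (t := t) hxy0 hxy1 K μ ν hμ hν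
  have hA := hA fun _ => 1
  have hB := hB fun _ => 1
  simp only [one_mul] at hA hB
  refine ⟨_, hB, ?_⟩
  have hne : 1 - x * y ≠ 0 := (sub_pos.2 hxy1).ne'
  have : (1 - x * y) * (A₀ + A₁) = (1 - t * (x * y)) * (B₀ + B₁) := by
    by_cases hμν : μ 0 = ν 0
    · exact h.free_sum hμν
    · obtain ⟨h1, h2⟩ := h.forced_left hμν
      rw [h1, h2, zero_add, zero_add]
      exact h.forced_right hμν
  rw [div_mul_eq_mul_div, ← this, mul_div_cancel_left₀ _ hne]
  exact hA

open scoped ENNReal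

/-- The operator on `[0, ∞]`-valued functions given by a kernel. -/
noncomputable def kernelApply (k : DecrSeq → DecrSeq → ℝ≥0∞) (f : DecrSeq → ℝ≥0∞)
    (α : DecrSeq) : ℝ≥0∞ := ∑' β, k α β * f β

/-- The kernel of an up-step. -/
noncomputable def upKernelENNReal (t x : ℝ) (α β : DecrSeq) : ℝ≥0∞ :=
  ENNReal.ofReal (upKernel t x α β)

/-- The kernel of a down-step. -/
noncomputable def downKernelENNReal (t y : ℝ) (α β : DecrSeq) : ℝ≥0∞ :=
  ENNReal.ofReal (downKernel t y α β)

/-- The indicator function of the empty sequence. -/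
noncomputable def vacuum : DecrSeq → ℝ≥0∞ := Set.indicator {DecrSeq.empty} 1

/-- The factor picked up when exchanging an up-step and a down-step. -/
noncomputable def exchangeFactor (t z : ℝ) : ℝ≥0∞ := ENNReal.ofReal ((1 - t * z) / (1 - z))

theorem kernelApply_const_mul (k : DecrSeq → DecrSeq → ℝ≥0∞) (c : ℝ≥0∞) (f : DecrSeq → ℝ≥0∞) :
    kernelApply k (fun β => c * f β) = fun α => c * kernelApply k f α := by
  funext α
  simp only [kernelApply, ← ENNReal.tsum_mul_left]
  exact tsum_congr fun β => by ring

theorem kernelApply_kernelApply (k l : DecrSeq → DecrSeq → ℝ≥0∞) (f : DecrSeq → ℝ≥0∞)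
    (α : DecrSeq) :
    kernelApply k (kernelApply l f) α = ∑' γ, (∑' β, k α β * l β γ) * f γ := by
  simp only [kernelApply, ← ENNReal.tsum_mul_left, ← ENNReal.tsum_mul_right]
  rw [ENNReal.tsum_comm]
  exact tsum_congr fun γ => tsum_congr fun β => by ring

theorem kernelApply_up_down {t x y : ℝ} (ht0 : 0 ≤ t) (ht1 : t ≤ 1) (hx : 0 ≤ x) (hy : 0 ≤ y)
    (hxy : x * y < 1) (f : DecrSeq → ℝ≥0∞) :
    kernelApply (upKernelENNReal t x) (kernelApply (downKernelENNReal t y) f) =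
      fun α => exchangeFactor t (x * y) *
        kernelApply (downKernelENNReal t y) (kernelApply (upKernelENNReal t x) f) α := by
  funext α
  rw [kernelApply_kernelApply, kernelApply_kernelApply, ← ENNReal.tsum_mul_left]
  refine tsum_congr fun γ => ?_
  rw [← mul_assoc]
  congr 1
  obtain ⟨c, h1, h2⟩ := hasSum_skew_cauchy (t := t) (mul_nonneg hx hy) hxy α γ
  have hu : ∀ a b, 0 ≤ upKernel t x a b := upKernel_nonneg ht0 ht1 hx
  have hd : ∀ a b, 0 ≤ downKernel t y a b := downKernel_nonneg ht0 ht1 hy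
  simp only [upKernelENNReal, downKernelENNReal, ← ENNReal.ofReal_mul (hu _ _),
    ← ENNReal.ofReal_mul (hd _ _)]
  rw [← ENNReal.ofReal_tsum_of_nonneg (fun _ => mul_nonneg (hu _ _) (hd _ _)) h2.summable,
    ← ENNReal.ofReal_tsum_of_nonneg (fun _ => mul_nonneg (hd _ _) (hu _ _)) h1.summable,
    h1.tsum_eq, h2.tsum_eq, exchangeFactor, ← ENNReal.ofReal_mul]
  have : x * y * t ≤ x * y := mul_le_of_le_one_right (mul_nonneg hx hy) ht1
  exact div_nonneg (by linarith) (by linarith)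

theorem kernelApply_up_vacuum (t x : ℝ) : kernelApply (upKernelENNReal t x) vacuum = vacuum := by
  funext α
  rw [kernelApply, tsum_eq_single DecrSeq.empty fun β hβ => by simp [vacuum, hβ]]
  by_cases hα : α = DecrSeq.empty
  · subst hα
    simp [upKernelENNReal, upKernel_self]
  · have h : upKernel t x α DecrSeq.empty = 0 := by
      by_contra h
      exact hα (eq_empty_of_upKernel_ne_zero h)
    simp [upKernelENNReal, h, vacuum, hα]

theorem kernelApply_down_empty (t y : ℝ) (f : DecrSeq → ℝ≥0∞) :
    kernelApply (downKernelENNReal t y) f DecrSeq.empty = f DecrSeq.empty := by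
  rw [kernelApply, tsum_eq_single DecrSeq.empty]
  · simp [downKernelENNReal, downKernel_self]
  · intro β hβ
    have h : downKernel t y DecrSeq.empty β = 0 := by
      by_contra h
      exact hβ (eq_empty_of_downKernel_ne_zero h)
    simp [downKernelENNReal, h]

/-- The composition of `n` kernel operators. -/
noncomputable def kernelIterate :
    ℕ → (ℕ → DecrSeq → DecrSeq → ℝ≥0∞) → (DecrSeq → ℝ≥0∞) → DecrSeq → ℝ≥0∞
  | 0, _, f => f
  | n + 1, k, f => kernelApply (k 0) (kernelIterate n (fun i => k (i + 1)) f)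

theorem kernelIterate_add (n m : ℕ) (k : ℕ → DecrSeq → DecrSeq → ℝ≥0∞) (f : DecrSeq → ℝ≥0∞) :
    kernelIterate (n + m) k f = kernelIterate n k (kernelIterate m (fun i => k (i + n)) f) := by
  induction n generalizing k with
  | zero => simp [kernelIterate]
  | succ n ih =>
    rw [Nat.add_right_comm, kernelIterate, kernelIterate, ih]
    simp only [Nat.add_right_comm, Nat.add_assoc]

theorem kernelIterate_congr (n : ℕ) {k l : ℕ → DecrSeq → DecrSeq → ℝ≥0∞} (h : ∀ i < n, k i = l i)
    (f : DecrSeq → ℝ≥0∞) : kernelIterate n k f = kernelIterate n l f := by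
  induction n generalizing k l with
  | zero => rfl
  | succ n ih =>
    rw [kernelIterate, kernelIterate, h 0 n.succ_pos, ih fun i hi => h (i + 1) (by omega)]

theorem kernelApply_up_kernelIterate_down {t x : ℝ} (ht0 : 0 ≤ t) (ht1 : t ≤ 1) (hx : 0 ≤ x)
    (m : ℕ) {y : ℕ → ℝ} (hy : ∀ j < m, 0 ≤ y j) (hxy : ∀ j < m, x * y j < 1) :
    kernelApply (upKernelENNReal t x)
        (kernelIterate m (fun j => downKernelENNReal t (y j)) vacuum) =
      fun α => (∏ j ∈ Finset.range m, exchangeFactor t (x * y j)) *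
        kernelIterate m (fun j => downKernelENNReal t (y j)) vacuum α := by
  induction m generalizing y with
  | zero => simp [kernelIterate, kernelApply_up_vacuum]
  | succ m ih =>
    rw [kernelIterate, kernelApply_up_down ht0 ht1 hx (hy 0 m.succ_pos) (hxy 0 m.succ_pos),
      ih (y := fun j => y (j + 1)) (fun j hj => hy _ (by omega)) (fun j hj => hxy _ (by omega)),
      kernelApply_const_mul]
    funext α
    rw [Finset.prod_range_succ']
    ring

theorem kernelIterate_up_of_eigen {t : ℝ} {x : ℕ → ℝ} {c : ℕ → ℝ≥0∞} {f : DecrSeq → ℝ≥0∞} (n : ℕ)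
    (h : ∀ i < n, kernelApply (upKernelENNReal t (x i)) f = fun α => c i * f α) :
    kernelIterate n (fun i => upKernelENNReal t (x i)) f =
      fun α => (∏ i ∈ Finset.range n, c i) * f α := by
  induction n generalizing x c with
  | zero => simp [kernelIterate]
  | succ n ih =>
    rw [kernelIterate, ih (x := fun i => x (i + 1)) (c := fun i => c (i + 1))
      (fun i hi => h _ (by omega)), kernelApply_const_mul, h 0 n.succ_pos]
    funext α
    rw [Finset.prod_range_succ', mul_assoc]

theorem kernelIterate_down_empty (t : ℝ) (m : ℕ) (y : ℕ → ℝ) (f : DecrSeq → ℝ≥0∞) :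
    kernelIterate m (fun j => downKernelENNReal t (y j)) f DecrSeq.empty = f DecrSeq.empty := by
  induction m generalizing y with
  | zero => rfl
  | succ m ih => rw [kernelIterate, kernelApply_down_empty, ih fun j => y (j + 1)]

/-- The kernels of `n` up-steps followed by down-steps. -/
noncomputable def mountainKernel (t : ℝ) (x y : ℕ → ℝ) (n i : ℕ) : DecrSeq → DecrSeq → ℝ≥0∞ :=
  if i < n then upKernelENNReal t (x i) else downKernelENNReal t (y (i - n))

theorem kernelIterate_mountainKernel {t : ℝ} (ht0 : 0 ≤ t) (ht1 : t ≤ 1) {x y : ℕ → ℝ} {n m : ℕ}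
    (hx : ∀ i < n, 0 ≤ x i) (hy : ∀ j < m, 0 ≤ y j) (hxy : ∀ i < n, ∀ j < m, x i * y j < 1) :
    kernelIterate (n + m) (mountainKernel t x y n) vacuum DecrSeq.empty =
      ∏ i ∈ Finset.range n, ∏ j ∈ Finset.range m, exchangeFactor t (x i * y j) := by
  have h1 : ∀ f, kernelIterate m (fun i => mountainKernel t x y n (i + n)) f =
      kernelIterate m (fun j => downKernelENNReal t (y j)) f :=
    kernelIterate_congr m fun i _ => by simp [mountainKernel]
  have h2 : ∀ f, kernelIterate n (mountainKernel t x y n) f =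
      kernelIterate n (fun i => upKernelENNReal t (x i)) f :=
    kernelIterate_congr n fun i hi => by simp [mountainKernel, hi]
  rw [kernelIterate_add, h1, h2, kernelIterate_up_of_eigen n fun i hi =>
    kernelApply_up_kernelIterate_down ht0 ht1 (hx i hi) m hy (hxy i hi)]
  simp only [kernelIterate_down_empty]
  simp [vacuum]

theorem kernelIterate_eq_tsum (n : ℕ) (k : ℕ → DecrSeq → DecrSeq → ℝ≥0∞) (f : DecrSeq → ℝ≥0∞)
    (α : DecrSeq) :
    kernelIterate n k f α = ∑' p : Fin n → DecrSeq,
      (∏ i : Fin n, k i ((Fin.cons α p : Fin (n + 1) → DecrSeq) i.castSucc)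
        ((Fin.cons α p : Fin (n + 1) → DecrSeq) i.succ)) *
        f ((Fin.cons α p : Fin (n + 1) → DecrSeq) (Fin.last n)) := by
  induction n generalizing k α with
  | zero => simp [kernelIterate]
  | succ n ih =>
    rw [← (Fin.consEquiv fun _ : Fin (n + 1) => DecrSeq).tsum_eq, ENNReal.tsum_prod',
      kernelIterate, kernelApply]
    refine tsum_congr fun β => ?_
    rw [ih, ← ENNReal.tsum_mul_left]
    refine tsum_congr fun p => ?_
    rw [Fin.prod_univ_succ, ← mul_assoc, ← Fin.succ_last]
    simp [Fin.consEquiv]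

namespace DecrSeq

/-- The conjugate sequence: `conj α k` counts the `r` with `k < α r`. -/
noncomputable def conjFun (α : DecrSeq) (k : ℕ) : ℕ := sInf {r | α r ≤ k}

theorem lt_conjFun (α : DecrSeq) {r k : ℕ} : r < conjFun α k ↔ k < α r := by
  have hne : {r | α r ≤ k}.Nonempty := by
    obtain ⟨K, hK⟩ := α.2.2
    exact ⟨K, by show α K ≤ k; rw [hK]; exact Nat.zero_le k⟩
  constructor
  · intro h
    by_contra hk
    exact Nat.notMem_of_lt_sInf h (not_lt.1 hk)
  · intro h
    by_contra hr
    have h1 : α (conjFun α k) ≤ k := Nat.sInf_mem hne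
    have h2 := α.antitone (not_lt.1 hr)
    omega

/-- The conjugate of a decreasing sequence. -/
noncomputable def conj (α : DecrSeq) : DecrSeq :=
  ⟨conjFun α, fun k l hkl => by
    by_contra! h
    have h1 := (lt_conjFun α).1 h
    have h2 := (lt_conjFun α).2 (lt_of_le_of_lt hkl h1)
    omega, α 0, by
    by_contra h
    have := (lt_conjFun α).1 (Nat.pos_of_ne_zero h)
    omega⟩

theorem lt_conj (α : DecrSeq) {r k : ℕ} : r < conj α k ↔ k < α r := lt_conjFun α

theorem conj_le (α : DecrSeq) {r k : ℕ} : conj α k ≤ r ↔ α r ≤ k := by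
  rw [← not_lt, lt_conj, not_lt]

theorem conj_conj (α : DecrSeq) : conj (conj α) = α :=
  ext fun r => eq_of_forall_ge_iff fun k => by rw [conj_le, conj_le]

theorem conj_mono {α β : DecrSeq} (h : ∀ r, α r ≤ β r) (k : ℕ) : conj α k ≤ conj β k :=
  (conj_le α).2 ((h _).trans ((conj_le β).1 le_rfl))

theorem conj_le_succ {α β : DecrSeq} (h : ∀ r, β (r + 1) ≤ α r) (k : ℕ) :
    conj β k ≤ conj α k + 1 :=
  (conj_le β).2 ((h _).trans ((conj_le α).1 le_rfl))

theorem conj_shift {α β : DecrSeq} (h : ∀ k, β k ≤ α k + 1) (r : ℕ) :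
    conj β (r + 1) ≤ conj α r :=
  (conj_le β).2 ((h _).trans (Nat.succ_le_succ ((conj_le α).1 le_rfl)))

theorem conj_eq_zero {α : DecrSeq} {k : ℕ} (h : α 0 ≤ k) : conj α k = 0 :=
  Nat.le_zero.1 ((conj_le α).2 h)

theorem sum_conj (α : DecrSeq) {R K : ℕ} (hR : α R = 0) (hK : α 0 ≤ K) :
    ∑ k ∈ Finset.range K, conj α k = ∑ r ∈ Finset.range R, α r := by
  have h1 : ∀ k, conj α k = ∑ r ∈ Finset.range R, if k < α r then 1 else 0 := fun k => by
    rw [← Finset.card_filter, ← Finset.card_range (conj α k)]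
    congr 1
    ext r
    simp only [Finset.mem_range, Finset.mem_filter, lt_conj]
    refine ⟨fun h => ⟨?_, h⟩, fun h => h.2⟩
    by_contra hr
    rw [α.eq_zero_of_le hR (not_lt.1 hr)] at h
    omega
  have h2 : ∀ r, α r = ∑ k ∈ Finset.range K, if k < α r then 1 else 0 := fun r => by
    rw [← Finset.card_filter, ← Finset.card_range (α r)]
    congr 1
    ext k
    simp only [Finset.mem_range, Finset.mem_filter, Finset.card_range]
    have := α.antitone (Nat.zero_le r)
    omega
  rw [Finset.sum_congr rfl fun k _ => h1 k, Finset.sum_comm]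
  exact Finset.sum_congr rfl fun r _ => (h2 r).symm

end DecrSeq

namespace PlanePartition

theorem part_antitone (π : PlanePartition) {i i' j j' : ℕ} (hi : i ≤ i') (hj : j ≤ j') :
    π.part i' j' ≤ π.part i j :=
  (antitone_nat_of_succ_le (f := fun a => π.part a j') (fun a => π.col_decr a j') hi).trans
    (antitone_nat_of_succ_le (f := π.part i) (π.row_decr i) hj)

/-- The diagonal partition of `π` of content `d - N`. -/
def diagonal (π : PlanePartition) (N d : ℕ) : DecrSeq :=
  ⟨fun r => π.part (r + (N - d)) (r + (d - N)),
    fun _ _ h => π.part_antitone (Nat.add_le_add_right h _) (Nat.add_le_add_right h _), by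
    have hinj : Function.Injective fun r : ℕ => (r + (N - d), r + (d - N)) := fun a b h => by
      simp only [Prod.mk.injEq] at h
      omega
    by_contra! h
    exact Set.infinite_range_of_injective hinj
      (π.finite_supp.subset (Set.range_subset_iff.2 fun r => h r))⟩

theorem diagonal_apply (π : PlanePartition) (N d r : ℕ) :
    π.diagonal N d r = π.part (r + (N - d)) (r + (d - N)) := rfl

/-- The conjugates of the diagonal partitions of `π`. -/
noncomputable def profile (π : PlanePartition) (N d : ℕ) : DecrSeq := (π.diagonal N d).conj

theorem lt_profile (π : PlanePartition) {N d r k : ℕ} :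
    r < π.profile N d k ↔ k < π.part (r + (N - d)) (r + (d - N)) := DecrSeq.lt_conj _

theorem profile_le_succ_le (π : PlanePartition) {N d : ℕ} (hd : d < N) (k : ℕ) :
    π.profile N d k ≤ π.profile N (d + 1) k ∧ π.profile N (d + 1) k ≤ π.profile N d k + 1 :=
  ⟨DecrSeq.conj_mono (fun r => π.part_antitone (by omega) (by omega)) k,
    DecrSeq.conj_le_succ (fun r => π.part_antitone (by omega) (by omega)) k⟩

theorem profile_succ_le_le (π : PlanePartition) {N d : ℕ} (hd : N ≤ d) (k : ℕ) :
    π.profile N (d + 1) k ≤ π.profile N d k ∧ π.profile N d k ≤ π.profile N (d + 1) k + 1 :=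
  ⟨DecrSeq.conj_mono (fun r => π.part_antitone (by omega) (by omega)) k,
    DecrSeq.conj_le_succ (fun r => π.part_antitone (by omega) (by omega)) k⟩

theorem profile_eq_zero_of_le (π : PlanePartition) {N d k : ℕ} (h : π.part 0 0 ≤ k) :
    π.profile N d k = 0 :=
  DecrSeq.conj_eq_zero ((π.part_antitone (Nat.zero_le _) (Nat.zero_le _)).trans h)

/-- The support of `π` lies in the `N × N` box. -/
def InBox (N : ℕ) (π : PlanePartition) : Prop := ∀ i j, π.part i j ≠ 0 → i < N ∧ j < N

theorem InBox.profile_zero {N : ℕ} {π : PlanePartition} (h : π.InBox N) :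
    π.profile N 0 = DecrSeq.empty :=
  DecrSeq.ext fun k => by
    by_contra hk
    have := π.lt_profile.1 (Nat.pos_of_ne_zero hk)
    have := h _ _ (Nat.ne_zero_of_lt this)
    omega

theorem InBox.profile_two_mul {N : ℕ} {π : PlanePartition} (h : π.InBox N) :
    π.profile N (N + N) = DecrSeq.empty :=
  DecrSeq.ext fun k => by
    by_contra hk
    have := π.lt_profile.1 (Nat.pos_of_ne_zero hk)
    have := h _ _ (Nat.ne_zero_of_lt this)
    omega

theorem InBox.weight_eq {N K : ℕ} {π : PlanePartition} (h : π.InBox N) (hK : π.part 0 0 ≤ K) :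
    π.weight = ∑ d ∈ Finset.range (N + N), ∑ k ∈ Finset.range K, π.profile N d k := by
  have h1 : π.weight = ∑ p ∈ Finset.range N ×ˢ Finset.range N, π.part p.1 p.2 := by
    refine finsum_eq_sum_of_support_subset _ fun p hp => ?_
    have := h _ _ hp
    simpa using this
  have h2 : ∀ d, ∑ k ∈ Finset.range K, π.profile N d k =
      ∑ r ∈ Finset.range N, π.part (r + (N - d)) (r + (d - N)) := fun d => by
    refine DecrSeq.sum_conj _ ?_ ((π.part_antitone (Nat.zero_le _) (Nat.zero_le _)).trans hK)
    by_contra hne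
    have := h _ _ hne
    omega
  rw [h1, Finset.sum_congr rfl fun d _ => h2 d, ← Finset.sum_product']
  refine Finset.sum_of_injOn (fun p => (N + p.2 - p.1, min p.1 p.2)) ?_ ?_ ?_ ?_
  · rintro ⟨i, j⟩ hi ⟨i', j'⟩ hi' heq
    simp only [Finset.coe_product, Set.mem_prod, Finset.mem_coe, Finset.mem_range,
      Prod.mk.injEq] at hi hi' heq ⊢
    omega
  · rintro ⟨i, j⟩ hi
    simp only [Finset.coe_product, Set.mem_prod, Finset.mem_coe, Finset.mem_range] at hi ⊢
    omega
  · rintro ⟨d, r⟩ - hr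
    by_contra hne
    have hb := h _ _ hne
    refine hr ⟨(r + (N - d), r + (d - N)), ?_, ?_⟩
    · simpa using hb
    · simp only [Prod.mk.injEq]
      omega
  · rintro ⟨i, j⟩ hi
    simp only [Finset.mem_product, Finset.mem_range] at hi ⊢
    congr 1 <;> omega

end PlanePartition

theorem sum_up_exponents (S : ℕ → ℕ) (n : ℕ) (h0 : S 0 = 0) (h : ∀ d < n, S d ≤ S (d + 1)) :
    ∑ d ∈ Finset.range n, (n - 1 - d) * (S (d + 1) - S d) = ∑ d ∈ Finset.range n, S d := by
  have htel : ∀ m ≤ n, ∑ d ∈ Finset.range m, (S (d + 1) - S d) = S m := by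
    intro m
    induction m with
    | zero => simp [h0]
    | succ m ih =>
      intro hm
      rw [Finset.sum_range_succ, ih (by omega)]
      have := h m hm
      omega
  induction n with
  | zero => rfl
  | succ n ih =>
    rw [Finset.sum_range_succ, Finset.sum_range_succ,
      ← ih (fun d hd => h d (by omega)) (fun m hm => htel m (by omega)),
      ← htel n n.le_succ, ← Finset.sum_add_distrib]
    simp only [Nat.add_sub_cancel, Nat.sub_self, zero_mul, add_zero]
    refine Finset.sum_congr rfl fun d hd => ?_
    rw [← Nat.succ_mul]
    congr 1
    have := Finset.mem_range.1 hd
    omega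

theorem sum_down_exponents (T : ℕ → ℕ) (n : ℕ) (h : ∀ d < n, T (d + 1) ≤ T d) :
    ∑ d ∈ Finset.range n, (d + 1) * (T d - T (d + 1)) + n * T n = ∑ d ∈ Finset.range n, T d := by
  induction n with
  | zero => simp
  | succ n ih =>
    rw [Finset.sum_range_succ, Finset.sum_range_succ, ← ih fun d hd => h d (by omega)]
    obtain ⟨c, hc⟩ := Nat.exists_eq_add_of_le (h n n.lt_succ_self)
    rw [hc, Nat.add_sub_cancel_left]
    ring

namespace PlanePartition

theorem part_eq_of_connected {g : ℕ → ℕ → ℕ} {p q : ℕ × ℕ}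
    (h : Relation.ReflTransGen (ConnStep g) p q) : g p.1 p.2 = g q.1 q.2 := by
  induction h with
  | refl => rfl
  | tail _ h ih => exact ih.trans h.2.1

theorem sameComponent_diagonal (π : PlanePartition) {i j : ℕ} (h0 : π.part i j ≠ 0) (h : ℕ) :
    SameComponent π.part (i, j) (i + h, j + h) ↔ π.part (i + h) (j + h) = π.part i j := by
  refine ⟨fun hc => (part_eq_of_connected hc.2).symm, fun heq => ⟨h0, ?_⟩⟩
  induction h with
  | zero => exact .refl
  | succ h ih =>
    have h1 := π.part_antitone (show i ≤ i + h by omega) (show j ≤ j + h by omega)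
    have h2 := π.part_antitone (show i + h ≤ i + h + 1 by omega) (le_refl (j + h))
    have h3 := π.part_antitone (le_refl (i + h + 1)) (show j + h ≤ j + h + 1 by omega)
    simp only [← Nat.add_assoc] at heq
    refine ((ih (by omega)).tail (b := (i + h, j + h)) (c := (i + h + 1, j + h))
      ⟨Or.inr ⟨rfl, Or.inl rfl⟩, ?_, ?_⟩).tail ⟨Or.inl ⟨rfl, Or.inl rfl⟩, ?_, ?_⟩ <;>
    simp only [← Nat.add_assoc] <;> omega

/-- The number of entries `k + 1` on a diagonal of `π`. -/
noncomputable def mult (π : PlanePartition) (N d k : ℕ) : ℕ :=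
  π.profile N d k - π.profile N d (k + 1)

/-- The box of level `l` and entry `k + 1` on a diagonal of `π`. -/
noncomputable def levelBox (π : PlanePartition) (N d k l : ℕ) : ℕ × ℕ :=
  (π.profile N d k - l + (N - d), π.profile N d k - l + (d - N))

theorem profile_succ_le (π : PlanePartition) (N d k : ℕ) :
    π.profile N d (k + 1) ≤ π.profile N d k := (π.profile N d).antitone k.le_succ

theorem part_levelBox (π : PlanePartition) {N d k l : ℕ} (h1 : 1 ≤ l) (h2 : l ≤ π.mult N d k) :
    π.part (π.levelBox N d k l).1 (π.levelBox N d k l).2 = k + 1 := by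
  have h3 := π.profile_succ_le N d k
  have h4 : π.profile N d k - l < π.profile N d k := by unfold mult at h2; omega
  have h5 : ¬ π.profile N d k - l < π.profile N d (k + 1) := by unfold mult at h2; omega
  rw [lt_profile] at h4 h5
  unfold levelBox
  dsimp only
  omega

theorem level_levelBox (π : PlanePartition) {N d k l : ℕ} (h1 : 1 ≤ l) (h2 : l ≤ π.mult N d k) :
    level π.part (π.levelBox N d k l) = l := by
  have hp := π.part_levelBox h1 h2
  have h3 := π.profile_succ_le N d k
  have hiff : ∀ h, ¬ SameComponent π.part (π.levelBox N d k l)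
      ((π.levelBox N d k l).1 + h, (π.levelBox N d k l).2 + h) ↔ l ≤ h := fun h => by
    have hc := π.sameComponent_diagonal (i := (π.levelBox N d k l).1)
      (j := (π.levelBox N d k l).2) (by omega) h
    rw [Prod.mk.eta] at hc
    rw [hc, hp]
    have hmono := π.part_antitone (show (π.levelBox N d k l).1 ≤ (π.levelBox N d k l).1 + h by omega)
      (show (π.levelBox N d k l).2 ≤ (π.levelBox N d k l).2 + h by omega)
    have hlt := π.lt_profile (N := N) (d := d) (k := k) (r := π.profile N d k - l + h)
    have e1 : π.profile N d k - l + h + (N - d) = (π.levelBox N d k l).1 + h := by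
      unfold levelBox
      dsimp only
      omega
    have e2 : π.profile N d k - l + h + (d - N) = (π.levelBox N d k l).2 + h := by
      unfold levelBox
      dsimp only
      omega
    rw [e1, e2] at hlt
    unfold mult at h2
    omega
  unfold level
  refine le_antisymm (Nat.sInf_le ⟨h1, (hiff l).2 le_rfl⟩) ?_
  exact le_csInf ⟨l, h1, (hiff l).2 le_rfl⟩ fun h hh => (hiff h).1 hh.2

theorem InBox.exists_eq_levelBox {N : ℕ} {π : PlanePartition} (h : π.InBox N) {p : ℕ × ℕ}
    (hp : π.part p.1 p.2 ≠ 0) :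
    ∃ d k l, d < N + N ∧ 1 ≤ l ∧ l ≤ π.mult N d k ∧ p = π.levelBox N d k l := by
  obtain ⟨i, j⟩ := p
  dsimp only at hp
  have hb := h i j hp
  have e1 : min i j + (N - (N + j - i)) = i := by omega
  have e2 : min i j + (N + j - i - N) = j := by omega
  have h1 := π.lt_profile (N := N) (d := N + j - i) (k := π.part i j - 1) (r := min i j)
  have h2 := π.lt_profile (N := N) (d := N + j - i) (k := π.part i j - 1 + 1) (r := min i j)
  rw [e1, e2] at h1 h2
  refine ⟨N + j - i, π.part i j - 1,
    π.profile N (N + j - i) (π.part i j - 1) - min i j, by omega, by omega, ?_, ?_⟩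
  · unfold mult
    omega
  · unfold levelBox
    rw [Prod.mk.injEq]
    omega

theorem adjacent_levelBox (π : PlanePartition) {N d k l : ℕ} (h1 : l ≤ π.profile N d k)
    (h2 : l ≤ π.profile N (d + 1) k) :
    Adjacent (π.levelBox N d k l) (π.levelBox N (d + 1) k l) := by
  unfold Adjacent levelBox
  dsimp only
  rcases lt_or_ge d N with hd | hd
  · have := π.profile_le_succ_le hd k
    omega
  · have := π.profile_succ_le_le hd k
    omega

theorem borderStep_levelBox (π : PlanePartition) {N d k l : ℕ} (h0 : 1 ≤ l)
    (h1 : l ≤ π.mult N d k) (h2 : l ≤ π.mult N (d + 1) k) :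
    BorderStep π.part (π.levelBox N d k l) (π.levelBox N (d + 1) k l) := by
  refine ⟨⟨π.adjacent_levelBox (h1.trans (Nat.sub_le _ _)) (h2.trans (Nat.sub_le _ _)), ?_, ?_⟩, ?_⟩
  · rw [π.part_levelBox h0 h1, π.part_levelBox h0 h2]
  · rw [π.part_levelBox h0 h1]
    exact k.succ_ne_zero
  · rw [π.level_levelBox h0 h1, π.level_levelBox h0 h2]

theorem levelBox_borderPath (π : PlanePartition) {N d k l : ℕ} (h0 : 1 ≤ l) (n : ℕ)
    (h : ∀ e, d ≤ e → e ≤ d + n → l ≤ π.mult N e k) :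
    Relation.ReflTransGen (BorderStep π.part) (π.levelBox N d k l) (π.levelBox N (d + n) k l) := by
  induction n with
  | zero => exact .refl
  | succ n ih =>
    exact (ih fun e h1 h2 => h e h1 (by omega)).tail
      (π.borderStep_levelBox h0 (h _ (by omega) (by omega)) (h _ (by omega) (by omega)))

theorem InBox.eq_levelBox_of_borderStep {N : ℕ} {π : PlanePartition} (h : π.InBox N) {d k l : ℕ}
    (h0 : 1 ≤ l) (h1 : l ≤ π.mult N d k) {q : ℕ × ℕ}
    (hq : BorderStep π.part (π.levelBox N d k l) q) :
    ∃ d', (d' = d + 1 ∨ d' + 1 = d) ∧ l ≤ π.mult N d' k ∧ q = π.levelBox N d' k l := by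
  obtain ⟨⟨hadj, hval, hne⟩, hlev⟩ := hq
  obtain ⟨d', k', l', -, hl1, hl2, rfl⟩ := h.exists_eq_levelBox (hval ▸ hne)
  rw [π.part_levelBox h0 h1, π.part_levelBox hl1 hl2] at hval
  obtain rfl : k = k' := by omega
  rw [π.level_levelBox h0 h1, π.level_levelBox hl1 hl2] at hlev
  subst hlev
  refine ⟨d', ?_, hl2, rfl⟩
  unfold Adjacent levelBox at hadj
  dsimp only at hadj
  omega

theorem InBox.eq_levelBox_of_borderPath {N : ℕ} {π : PlanePartition} (h : π.InBox N) {d k l : ℕ}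
    (h0 : 1 ≤ l) (h1 : l ≤ π.mult N d k) {q : ℕ × ℕ}
    (hq : Relation.ReflTransGen (BorderStep π.part) (π.levelBox N d k l) q) :
    ∃ d', q = π.levelBox N d' k l ∧ ∀ e, min d d' ≤ e → e ≤ max d d' → l ≤ π.mult N e k := by
  induction hq with
  | refl => exact ⟨d, rfl, fun e h2 h3 => by rwa [show e = d by omega]⟩
  | tail _ hs ih =>
    obtain ⟨d', rfl, hd'⟩ := ih
    obtain ⟨d'', h2, h3, rfl⟩ :=
      h.eq_levelBox_of_borderStep h0 (hd' d' (by omega) (by omega)) hs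
    refine ⟨d'', rfl, fun e h4 h5 => ?_⟩
    by_cases he : e = d''
    · rwa [he]
    · exact hd' e (by omega) (by omega)

instance borderStep_symm (g : ℕ → ℕ → ℕ) : Std.Symm (BorderStep g) := by
  refine ⟨?_⟩
  rintro p q ⟨⟨hadj, hval, hne⟩, hlev⟩
  refine ⟨⟨?_, hval.symm, hval ▸ hne⟩, hlev.symm⟩
  unfold Adjacent at hadj ⊢
  omega

theorem mult_le_succ (π : PlanePartition) (N d k : ℕ) :
    π.mult N d k ≤ π.mult N (d + 1) k + 1 := by
  unfold mult
  rcases lt_or_ge d N with hd | hd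
  · have := π.profile_le_succ_le hd k
    have := π.profile_le_succ_le hd (k + 1)
    omega
  · have := π.profile_succ_le_le hd k
    have := π.profile_succ_le_le hd (k + 1)
    omega

/-- The border component ending on a given diagonal. -/
noncomputable def endComponent (π : PlanePartition) (N : ℕ) (e : ℕ × ℕ) : Set (ℕ × ℕ) :=
  {q | SameBorder π.part (π.levelBox N e.1 e.2 (π.mult N e.1 e.2)) q}

theorem InBox.borderLevel_endComponent {N : ℕ} {π : PlanePartition} (h : π.InBox N) {e : ℕ × ℕ}
    (he : 1 ≤ π.mult N e.1 e.2) :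
    borderLevel π.part (π.endComponent N e) = π.mult N e.1 e.2 := by
  unfold borderLevel
  have : {l : ℕ | ∃ p ∈ π.endComponent N e, level π.part p = l} = {π.mult N e.1 e.2} := by
    ext l
    simp only [Set.mem_ofPred_eq, Set.mem_singleton_iff]
    constructor
    · rintro ⟨p, hp, rfl⟩
      obtain ⟨d, rfl, hd⟩ := h.eq_levelBox_of_borderPath he le_rfl hp.2
      exact π.level_levelBox he (hd d (by omega) (by omega))
    · rintro rfl
      refine ⟨_, ⟨?_, .refl⟩, π.level_levelBox he le_rfl⟩
      rw [π.part_levelBox he le_rfl]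
      exact Nat.succ_ne_zero _
  rw [this, csInf_singleton]

theorem InBox.endComponent_injOn {N : ℕ} {π : PlanePartition} (h : π.InBox N) :
    Set.InjOn (π.endComponent N) {e | π.mult N (e.1 + 1) e.2 < π.mult N e.1 e.2} := by
  rintro ⟨d, k⟩ he ⟨d', k'⟩ he' heq
  simp only [Set.mem_ofPred_eq] at he he'
  have hmem : π.levelBox N d' k' (π.mult N d' k') ∈ π.endComponent N (d, k) := by
    rw [heq]
    refine ⟨?_, .refl⟩
    rw [π.part_levelBox (show 1 ≤ π.mult N d' k' by omega) le_rfl]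
    exact Nat.succ_ne_zero _
  obtain ⟨d'', hbox, hd⟩ := h.eq_levelBox_of_borderPath (d := d) (k := k) (by omega) le_rfl hmem.2
  have hd'' := hd d'' (by omega) (by omega)
  have hval := π.part_levelBox (N := N) (d := d') (k := k') (by omega) le_rfl
  have hlev := π.level_levelBox (N := N) (d := d') (k := k') (by omega) le_rfl
  rw [hbox, π.part_levelBox (by omega) hd''] at hval
  rw [hbox, π.level_levelBox (by omega) hd''] at hlev
  obtain rfl : k = k' := by omega
  obtain rfl : d'' = d' := by
    unfold levelBox at hbox
    rw [Prod.mk.injEq] at hbox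
    omega
  rcases lt_trichotomy d d'' with hlt | rfl | hlt
  · have := hd (d + 1) (by omega) (by omega)
    omega
  · rfl
  · have := hd (d'' + 1) (by omega) (by omega)
    omega

theorem InBox.borderComponents_eq {N K : ℕ} {π : PlanePartition} (h : π.InBox N)
    (hK : π.part 0 0 ≤ K) :
    borderComponents π.part = π.endComponent N ''
      ((Finset.range (N + N) ×ˢ Finset.range K).filter
        fun e => π.mult N (e.1 + 1) e.2 < π.mult N e.1 e.2 : Finset (ℕ × ℕ)) := by
  classical
  ext B
  simp only [Set.mem_image, Finset.mem_coe, Finset.mem_filter, Finset.mem_product,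
    Finset.mem_range]
  constructor
  · rintro ⟨p, hp, rfl⟩
    obtain ⟨d, k, l, hd, hl1, hl2, rfl⟩ := h.exists_eq_levelBox hp
    have hex : ∃ n, π.mult N (d + n + 1) k < l := by
      refine ⟨N + N - d - 1, ?_⟩
      rw [show d + (N + N - d - 1) + 1 = N + N by omega]
      unfold mult
      rw [h.profile_two_mul]
      simp only [DecrSeq.empty_apply]
      omega
    have hn := Nat.find_spec hex
    have hmin : ∀ m < Nat.find hex, l ≤ π.mult N (d + m + 1) k :=
      fun m hm => not_lt.1 (Nat.find_min hex hm)
    set n := Nat.find hex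
    have hrun : ∀ e, d ≤ e → e ≤ d + n → l ≤ π.mult N e k := fun e h1 h2 => by
      by_cases hed : e = d
      · rwa [hed]
      · have := hmin (e - d - 1) (by omega)
        rwa [show d + (e - d - 1) + 1 = e by omega] at this
    have hlast := hrun (d + n) (by omega) le_rfl
    have hstep := π.mult_le_succ N (d + n) k
    have hl : π.mult N (d + n) k = l := by omega
    have hdn : d + n < N + N := by
      by_contra hge
      have := hrun (N + N) (by omega) (by omega)
      unfold mult at this
      rw [h.profile_two_mul] at this
      simp only [DecrSeq.empty_apply] at this
      omega
    refine ⟨(d + n, k), ⟨⟨hdn, ?_⟩, by dsimp only; omega⟩, ?_⟩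
    · by_contra hk
      have := π.profile_eq_zero_of_le (N := N) (d := d) (k := k) (hK.trans (not_lt.1 hk))
      unfold mult at hl2
      omega
    · have hpath := π.levelBox_borderPath hl1 n hrun
      ext q
      simp only [endComponent, Set.mem_ofPred_eq, hl]
      constructor
      · rintro ⟨-, hq⟩
        exact ⟨hp, hpath.trans hq⟩
      · rintro ⟨-, hq⟩
        refine ⟨?_, (Std.Symm.symm _ _ hpath).trans hq⟩
        rw [π.part_levelBox hl1 hlast]
        exact k.succ_ne_zero
  · rintro ⟨⟨d, k⟩, ⟨-, he⟩, rfl⟩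
    refine ⟨_, ?_, rfl⟩
    rw [π.part_levelBox (show 1 ≤ π.mult N d k by dsimp only at he; omega) le_rfl]
    exact k.succ_ne_zero

theorem InBox.Apoly_eq {N K : ℕ} {π : PlanePartition} (h : π.InBox N) (hK : π.part 0 0 ≤ K)
    (t : ℝ) :
    Apoly t π = ∏ d ∈ Finset.range (N + N), ∏ k ∈ Finset.range K,
      dropFactor t (π.profile N d k) (π.profile N d (k + 1))
        (π.profile N (d + 1) k) (π.profile N (d + 1) (k + 1)) := by
  unfold Apoly
  rw [h.borderComponents_eq hK, finprod_mem_image (h.endComponent_injOn.mono fun e he => by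
    simpa using (Finset.mem_filter.1 (Finset.mem_coe.1 he)).2), finprod_mem_coe_finset,
    Finset.prod_filter, Finset.prod_product]
  refine Finset.prod_congr rfl fun d _ => Finset.prod_congr rfl fun k _ => ?_
  dsimp only
  have h1 := π.profile_succ_le N d k
  have h2 := π.profile_succ_le N (d + 1) k
  split_ifs with hlt
  · rw [h.borderLevel_endComponent (e := (d, k)) (by dsimp only; omega), dropFactor_of_lt]
    · rfl
    · unfold mult at hlt
      omega
  · rw [dropFactor_of_le]
    unfold mult at hlt
    omega

end PlanePartition

theorem prod_stepWeight (x : ℝ) (K : ℕ) {α β : ℕ → ℕ} (h : ∀ k, α k ≤ β k ∧ β k ≤ α k + 1) :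
    ∏ k ∈ Finset.range K, stepWeight x (α k) (β k) =
      x ^ (∑ k ∈ Finset.range K, β k - ∑ k ∈ Finset.range K, α k) := by
  rw [← Finset.sum_tsub_distrib _ fun k _ => (h k).1, ← Finset.prod_pow_eq_pow_sum]
  refine Finset.prod_congr rfl fun k _ => ?_
  obtain ⟨h1, h2⟩ := h k
  rcases (by omega : β k = α k ∨ β k = α k + 1) with h | h
  · rw [stepWeight_of_eq x h, h, Nat.sub_self, pow_zero]
  · rw [stepWeight_of_eq_succ x h, h, Nat.add_sub_cancel_left, pow_one]

namespace PlanePartition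

theorem InBox.prod_mountainKernel {N : ℕ} {π : PlanePartition} (h : π.InBox N) {t s : ℝ}
    (ht0 : 0 ≤ t) (ht1 : t ≤ 1) (hs0 : 0 ≤ s) :
    ∏ i ∈ Finset.range (N + N), mountainKernel t (fun i => s ^ (N - 1 - i)) (fun j => s ^ (j + 1))
      N i (π.profile N i) (π.profile N (i + 1)) = ENNReal.ofReal (Apoly t π * s ^ π.weight) := by
  set K := π.part 0 0 with hK
  set S : ℕ → ℕ := fun d => ∑ k ∈ Finset.range K, π.profile N d k with hS
  set D : ℕ → ℝ := fun d => ∏ k ∈ Finset.range K,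
    dropFactor t (π.profile N d k) (π.profile N d (k + 1))
      (π.profile N (d + 1) k) (π.profile N (d + 1) (k + 1)) with hD
  set e : ℕ → ℕ := fun d => if d < N then (N - 1 - d) * (S (d + 1) - S d) else
    (d - N + 1) * (S d - S (d + 1)) with he
  have hzero : ∀ d, π.profile N d K = 0 := fun d => π.profile_eq_zero_of_le le_rfl
  have hD0 : ∀ d, 0 ≤ D d := fun d => Finset.prod_nonneg fun k _ => dropFactor_nonneg ht0 ht1 _ _ _ _
  have hstep : ∀ d, mountainKernel t (fun i => s ^ (N - 1 - i)) (fun j => s ^ (j + 1))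
      N d (π.profile N d) (π.profile N (d + 1)) = ENNReal.ofReal (s ^ e d * D d) := fun d => by
    rcases lt_or_ge d N with hd | hd
    · simp only [mountainKernel, he, if_pos hd, upKernelENNReal]
      rw [upKernel_eq_prod t _ (hzero d) (hzero (d + 1)), Finset.prod_mul_distrib,
        prod_stepWeight _ _ (π.profile_le_succ_le hd), pow_mul]
    · simp only [mountainKernel, he, if_neg (not_lt.2 hd), downKernelENNReal]
      rw [downKernel_eq_prod t _ (hzero d) (hzero (d + 1)), Finset.prod_mul_distrib,
        prod_stepWeight _ _ (π.profile_succ_le_le hd), pow_mul]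
  have hexp : ∑ d ∈ Finset.range (N + N), e d = π.weight := by
    rw [h.weight_eq le_rfl, Finset.sum_range_add, Finset.sum_range_add]
    congr 1
    · rw [← sum_up_exponents S N (by simp [hS, h.profile_zero]) fun d hd =>
        Finset.sum_le_sum fun k _ => (π.profile_le_succ_le hd k).1]
      exact Finset.sum_congr rfl fun d hd => if_pos (Finset.mem_range.1 hd)
    · have hdown := sum_down_exponents (fun d => S (N + d)) N fun d _ =>
        Finset.sum_le_sum fun k _ => (π.profile_succ_le_le (Nat.le_add_right N d) k).1
      rw [show S (N + N) = 0 by simp [hS, h.profile_two_mul], mul_zero, add_zero] at hdown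
      refine Eq.trans ?_ hdown
      refine Finset.sum_congr rfl fun d _ => ?_
      simp only [he, if_neg (not_lt.2 (Nat.le_add_right N d)), Nat.add_sub_cancel_left,
        Nat.add_assoc]
  rw [Finset.prod_congr rfl fun d _ => hstep d,
    ← ENNReal.ofReal_prod_of_nonneg fun d _ => mul_nonneg (pow_nonneg hs0 _) (hD0 d),
    Finset.prod_mul_distrib, Finset.prod_pow_eq_pow_sum, hexp, h.Apoly_eq le_rfl, mul_comm]

theorem exists_profile_eq {N : ℕ} {q : ℕ → DecrSeq} (h0 : q 0 = DecrSeq.empty)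
    (h2 : q (N + N) = DecrSeq.empty)
    (hup : ∀ d < N, ∀ k, q d k ≤ q (d + 1) k ∧ q (d + 1) k ≤ q d k + 1)
    (hdown : ∀ d, N ≤ d → d < N + N → ∀ k, q (d + 1) k ≤ q d k ∧ q d k ≤ q (d + 1) k + 1) :
    ∃ π : PlanePartition, π.InBox N ∧ ∀ d ≤ N + N, π.profile N d = q d := by
  classical
  have hstep : ∀ d < N + N, ∀ k, q (d + 1) k ≤ q d k + 1 ∧ q d k ≤ q (d + 1) k + 1 :=
    fun d hd k => by
      rcases lt_or_ge d N with h | h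
      · have := hup d h k
        omega
      · have := hdown d h hd k
        omega
  have hle : ∀ d ≤ N + N, ∀ k, q d k ≤ d := by
    intro d
    induction d with
    | zero => simp [h0]
    | succ d ih =>
      intro hd k
      have := (hstep d hd k).1
      have := ih (by omega) k
      omega
  have hle' : ∀ m ≤ N + N, ∀ k, q (N + N - m) k ≤ m := by
    intro m
    induction m with
    | zero => simp [h2]
    | succ m ih =>
      intro hm k
      have h3 := (hstep (N + N - (m + 1)) (by omega) k).2
      rw [show N + N - (m + 1) + 1 = N + N - m by omega] at h3
      have := ih (by omega) k
      omega
  let f : ℕ → ℕ → ℕ := fun i j =>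
    if i < N ∧ j < N then (q (N + j - i)).conj (min i j) else 0
  have hf : ∀ i j, f i j = if i < N ∧ j < N then (q (N + j - i)).conj (min i j) else 0 :=
    fun _ _ => rfl
  have hbox : ∀ i j, f i j ≠ 0 → i < N ∧ j < N := fun i j h => by
    by_contra hn
    exact h (if_neg hn)
  let π : PlanePartition :=
    { part := f
      row_decr := fun i j => by
        rw [hf i (j + 1), hf i j]
        by_cases h : i < N ∧ j + 1 < N
        · rw [if_pos h, if_pos (by omega)]
          rcases lt_or_ge j i with hji | hji
          · rw [show min i (j + 1) = j + 1 by omega, show min i j = j by omega,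
              show N + (j + 1) - i = N + j - i + 1 by omega]
            exact DecrSeq.conj_shift (fun k => (hup _ (by omega) k).2) j
          · rw [show min i (j + 1) = i by omega, show min i j = i by omega,
              show N + (j + 1) - i = N + j - i + 1 by omega]
            exact DecrSeq.conj_mono (fun k => (hdown _ (by omega) (by omega) k).1) i
        · rw [if_neg h]
          exact Nat.zero_le _
      col_decr := fun i j => by
        rw [hf (i + 1) j, hf i j]
        by_cases h : i + 1 < N ∧ j < N
        · rw [if_pos h, if_pos (by omega)]
          rcases lt_or_ge i j with hji | hji
          · rw [show min (i + 1) j = i + 1 by omega, show min i j = i by omega,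
              show N + j - i = N + j - (i + 1) + 1 by omega]
            exact DecrSeq.conj_shift (fun k => (hdown _ (by omega) (by omega) k).2) i
          · rw [show min (i + 1) j = j by omega, show min i j = j by omega,
              show N + j - i = N + j - (i + 1) + 1 by omega]
            exact DecrSeq.conj_mono (fun k => (hup _ (by omega) k).1) j
        · rw [if_neg h]
          exact Nat.zero_le _
      finite_supp := ((Finset.range N ×ˢ Finset.range N).finite_toSet).subset fun p hp => by
        simpa using hbox p.1 p.2 hp }
  refine ⟨π, hbox, fun d hd => ?_⟩
  have hdiag : π.diagonal N d = (q d).conj := DecrSeq.ext fun r => by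
    rw [diagonal_apply]
    change f _ _ = _
    rw [hf]
    split_ifs with h
    · rw [show N + (r + (d - N)) - (r + (N - d)) = d by omega,
        show min (r + (N - d)) (r + (d - N)) = r by omega]
    · have h3 := hle d hd 0
      have h4 := hle' (N + N - d) (by omega) 0
      rw [show N + N - (N + N - d) = d by omega] at h4
      exact (DecrSeq.conj_eq_zero (by omega)).symm
  rw [profile, hdiag, DecrSeq.conj_conj]

/-- The path of profiles of a plane partition. -/
noncomputable def profilePath (N : ℕ) (π : PlanePartition) (i : Fin (N + N)) : DecrSeq :=
  π.profile N (i + 1)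

theorem InBox.cons_profilePath {N : ℕ} {π : PlanePartition} (h : π.InBox N)
    (i : Fin (N + N + 1)) :
    (Fin.cons DecrSeq.empty (profilePath N π) : Fin (N + N + 1) → DecrSeq) i = π.profile N i := by
  refine Fin.cases ?_ (fun j => ?_) i
  · simp [h.profile_zero]
  · simp [profilePath]

theorem ext {π ρ : PlanePartition} (h : ∀ i j, π.part i j = ρ.part i j) : π = ρ := by
  cases π
  cases ρ
  congr
  funext i j
  exact h i j

theorem InBox.eq_of_profile_eq {N : ℕ} {π ρ : PlanePartition} (hπ : π.InBox N) (hρ : ρ.InBox N)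
    (h : ∀ d ≤ N + N, π.profile N d = ρ.profile N d) : π = ρ := by
  refine ext fun i j => ?_
  by_cases hb : i < N ∧ j < N
  · have hd := congrArg DecrSeq.conj (h (N + j - i) (by omega))
    rw [profile, profile, DecrSeq.conj_conj, DecrSeq.conj_conj] at hd
    have hr : π.diagonal N (N + j - i) (min i j) = ρ.diagonal N (N + j - i) (min i j) := by
      rw [hd]
    rw [diagonal_apply, diagonal_apply, show min i j + (N - (N + j - i)) = i by omega,
      show min i j + (N + j - i - N) = j by omega] at hr
    exact hr
  · have h1 : π.part i j = 0 := by
      by_contra hne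
      exact hb (hπ i j hne)
    have h2 : ρ.part i j = 0 := by
      by_contra hne
      exact hb (hρ i j hne)
    rw [h1, h2]

theorem tsum_inBox {t s : ℝ} (ht0 : 0 ≤ t) (ht1 : t ≤ 1) (hs0 : 0 ≤ s) (hs1 : s < 1) (N : ℕ) :
    ∑' π : {π : PlanePartition // π.InBox N},
      ENNReal.ofReal (Apoly t π.1 * s ^ π.1.weight) =
      ∏ i ∈ Finset.range N, ∏ j ∈ Finset.range N, exchangeFactor t (s ^ (i + j + 1)) := by
  set x : ℕ → ℝ := fun i => s ^ (N - 1 - i) with hx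
  set y : ℕ → ℝ := fun j => s ^ (j + 1) with hy
  have hmul : ∀ i j, x i * y j = s ^ (N - 1 - i + j + 1) := fun i j => by
    rw [hx, hy, ← pow_add, Nat.add_assoc]
  have hvac := kernelIterate_mountainKernel ht0 ht1 (x := x) (y := y) (n := N) (m := N)
    (fun i _ => pow_nonneg hs0 _) (fun j _ => pow_nonneg hs0 _)
    (fun i _ j _ => by rw [hmul]; exact pow_lt_one₀ hs0 hs1 (Nat.succ_ne_zero _))
  simp only [hmul] at hvac
  rw [Finset.prod_range_reflect (fun i => ∏ j ∈ Finset.range N,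
    exchangeFactor t (s ^ (i + j + 1)))] at hvac
  rw [← hvac, kernelIterate_eq_tsum]
  have hinj : Function.Injective
      fun π : {π : PlanePartition // π.InBox N} => profilePath N π.1 := by
    rintro ⟨π, hπ⟩ ⟨ρ, hρ⟩ heq
    refine Subtype.ext (hπ.eq_of_profile_eq hρ fun d hd => ?_)
    have h1 := hπ.cons_profilePath ⟨d, by omega⟩
    have h2 := hρ.cons_profilePath ⟨d, by omega⟩
    dsimp only at heq
    rw [← h1, ← h2, heq]
  rw [← hinj.tsum_eq]
  · refine tsum_congr fun π => ?_
    simp only [π.2.cons_profilePath]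
    simp only [Fin.val_castSucc, Fin.val_succ, Fin.val_last]
    rw [Fin.prod_univ_eq_prod_range (fun i => mountainKernel t x y N i (π.1.profile N i)
      (π.1.profile N (i + 1))), π.2.prod_mountainKernel ht0 ht1 hs0, π.2.profile_two_mul]
    simp [vacuum]
  · intro p hp
    rw [Function.mem_support] at hp
    have hprod := left_ne_zero_of_mul hp
    rw [Finset.prod_ne_zero_iff] at hprod
    have hlast := right_ne_zero_of_mul hp
    set c : Fin (N + N + 1) → DecrSeq := Fin.cons DecrSeq.empty p with hc
    let q : ℕ → DecrSeq := fun d => if h : d < N + N + 1 then c ⟨d, h⟩ else DecrSeq.empty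
    have hq : ∀ d (h : d < N + N + 1), q d = c ⟨d, h⟩ := fun d h => dif_pos h
    have hstep : ∀ d < N + N, mountainKernel t x y N d (q d) (q (d + 1)) ≠ 0 := fun d hd => by
      rw [hq d (by omega), hq (d + 1) (by omega)]
      exact hprod ⟨d, hd⟩ (Finset.mem_univ _)
    obtain ⟨π, hπ, hprof⟩ := exists_profile_eq (N := N) (q := q) (by rw [hq 0 (by omega)]; rfl)
      (by
        rw [hq (N + N) (by omega)]
        by_contra hne
        exact hlast (Set.indicator_of_notMem (s := {DecrSeq.empty})
          (show c (Fin.last (N + N)) ∉ ({DecrSeq.empty} : Set DecrSeq) from hne) _))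
      (fun d hd k => by
        have h := hstep d (by omega)
        simp only [mountainKernel, if_pos hd, upKernelENNReal] at h
        have := upKernel_step (fun h0 => h (by rw [h0, ENNReal.ofReal_zero])) k
        omega)
      (fun d hd hd' k => by
        have h := hstep d hd'
        simp only [mountainKernel, if_neg (not_lt.2 hd), downKernelENNReal] at h
        have := downKernel_step (fun h0 => h (by rw [h0, ENNReal.ofReal_zero])) k
        omega)
    refine ⟨⟨π, hπ⟩, funext fun i => ?_⟩
    change π.profile N (i + 1) = p i
    rw [hprof _ i.2, hq _ (Nat.succ_lt_succ i.2), hc]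
    exact Fin.cons_succ (α := fun _ => DecrSeq) _ p i

end PlanePartition

theorem macMahonFactor_nonneg {t z : ℝ} (ht1 : t ≤ 1) (hz0 : 0 ≤ z) (hz1 : z < 1) :
    0 ≤ (1 - t * z) / (1 - z) := by
  have : t * z ≤ z := mul_le_of_le_one_left hz0 ht1
  exact div_nonneg (by linarith) (by linarith)

theorem multipliable_macMahonFactor {t s : ℝ} (ht1 : t ≤ 1) (hs0 : 0 ≤ s) (hs1 : s < 1) :
    Multipliable fun p : ℕ × ℕ => (1 - t * s ^ (p.1 + p.2 + 1)) / (1 - s ^ (p.1 + p.2 + 1)) := by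
  have hlt : ∀ n : ℕ, s ^ (n + 1) < 1 := fun n => pow_lt_one₀ hs0 hs1 n.succ_ne_zero
  have hterm : ∀ n : ℕ, (1 - t * s ^ (n + 1)) / (1 - s ^ (n + 1)) =
      1 + (1 - t) * s ^ (n + 1) / (1 - s ^ (n + 1)) := fun n => by
    have : 1 - s ^ (n + 1) ≠ 0 := (sub_pos.2 (hlt n)).ne'
    field_simp
    ring
  have hgeom : Summable fun p : ℕ × ℕ => s ^ p.1 * s ^ p.2 :=
    (summable_geometric_of_lt_one hs0 hs1).mul_of_nonneg (summable_geometric_of_lt_one hs0 hs1)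
      (fun _ => pow_nonneg hs0 _) fun _ => pow_nonneg hs0 _
  have hsum : Summable fun p : ℕ × ℕ =>
      (1 - t) * s ^ (p.1 + p.2 + 1) / (1 - s ^ (p.1 + p.2 + 1)) := by
    refine Summable.of_nonneg_of_le
      (fun p => div_nonneg (mul_nonneg (by linarith) (pow_nonneg hs0 _))
        (sub_pos.2 (hlt (p.1 + p.2))).le) (fun p => ?_) (hgeom.mul_left ((1 - t) / (1 - s)))
    have h1 : s ^ (p.1 + p.2 + 1) ≤ s ^ 1 := pow_le_pow_of_le_one hs0 hs1.le (by omega)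
    have h2 : s ^ (p.1 + p.2 + 1) ≤ s ^ (p.1 + p.2) :=
      pow_le_pow_of_le_one hs0 hs1.le (Nat.le_succ _)
    rw [pow_one] at h1
    rw [← pow_add, div_mul_eq_mul_div]
    exact div_le_div₀ (mul_nonneg (by linarith) (pow_nonneg hs0 _))
      (mul_le_mul_of_nonneg_left h2 (by linarith)) (by linarith) (by linarith)
  simpa only [hterm] using Real.multipliable_one_add_of_summable hsum

/-- A product over `ℕ × ℕ` whose factors depend only on the sum of the coordinates, collected
along antidiagonals. -/
theorem tprod_add_eq_tprod_pow {g : ℕ → ℝ} (h : Multipliable fun p : ℕ × ℕ => g (p.1 + p.2)) :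
    ∏' p : ℕ × ℕ, g (p.1 + p.2) = ∏' n, g n ^ (n + 1) := by
  have h1 := (Equiv.hasProd_iff Finset.HasAntidiagonal.sigmaAntidiagonalEquivProd).2 h.hasProd
  refine (HasProd.tprod_eq (h1.sigma fun n => ?_)).symm
  have h2 := Finset.hasProd (Finset.HasAntidiagonal.antidiagonal n) fun p : ℕ × ℕ => g (p.1 + p.2)
  rw [Finset.prod_congr rfl fun p hp => by rw [Finset.HasAntidiagonal.mem_antidiagonal.1 hp],
    Finset.prod_const, Finset.Nat.card_antidiagonal] at h2
  exact h2

namespace PlanePartition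

theorem exists_inBox (π : PlanePartition) : ∃ N, π.InBox N := by
  obtain ⟨a, ha⟩ := π.finite_supp.bddAbove
  refine ⟨max a.1 a.2 + 1, fun i j hij => ?_⟩
  have h := ha (show (i, j) ∈ {p : ℕ × ℕ | π.part p.1 p.2 ≠ 0} from hij)
  have h1 : i ≤ a.1 := h.1
  have h2 : j ≤ a.2 := h.2
  omega

theorem InBox.mono {N M : ℕ} {π : PlanePartition} (h : π.InBox N) (hNM : N ≤ M) : π.InBox M :=
  fun i j hij => ⟨(h i j hij).1.trans_le hNM, (h i j hij).2.trans_le hNM⟩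

theorem Apoly_nonneg {t : ℝ} (ht0 : 0 ≤ t) (ht1 : t ≤ 1) (π : PlanePartition) :
    0 ≤ Apoly t π := by
  obtain ⟨N, hN⟩ := π.exists_inBox
  rw [hN.Apoly_eq le_rfl]
  exact Finset.prod_nonneg fun _ _ => Finset.prod_nonneg fun _ _ => dropFactor_nonneg ht0 ht1 _ _ _ _

theorem tendsto_tsum_inBox (f : PlanePartition → ℝ≥0∞) :
    Filter.Tendsto (fun N => ∑' π : {π : PlanePartition // π.InBox N}, f π.1) Filter.atTop
      (nhds (∑' π, f π)) := by
  have hmono : Monotone fun N => ∑' π : {π : PlanePartition // π.InBox N}, f π.1 :=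
    fun N M hNM => ENNReal.tsum_mono_subtype f (s := {π | π.InBox N}) (t := {π | π.InBox M})
      fun π hπ => InBox.mono hπ hNM
  have hsup : ∑' π, f π = ⨆ N, ∑' π : {π : PlanePartition // π.InBox N}, f π.1 := by
    refine le_antisymm ?_
      (iSup_le fun N => ENNReal.tsum_comp_le_tsum_of_injective Subtype.val_injective f)
    rw [ENNReal.tsum_eq_iSup_sum]
    refine iSup_le fun S => ?_
    choose b hb using exists_inBox
    refine le_trans ?_ (le_iSup _ (S.sup b))
    calc ∑ π ∈ S, f π = ∑' π : (S : Set PlanePartition), f π.1 :=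
          (Finset.tsum_subtype S f).symm
      _ ≤ _ := ENNReal.tsum_mono_subtype f (t := {π | π.InBox (S.sup b)})
          fun π hπ => (hb π).mono (Finset.le_sup (f := b) hπ)
  rw [hsup]
  exact tendsto_atTop_iSup hmono

theorem tsum_ofReal_Apoly {t s : ℝ} (ht0 : 0 ≤ t) (ht1 : t ≤ 1) (hs0 : 0 ≤ s) (hs1 : s < 1) :
    ∑' π : PlanePartition, ENNReal.ofReal (Apoly t π * s ^ π.weight) = ENNReal.ofReal
      (∏' p : ℕ × ℕ, (1 - t * s ^ (p.1 + p.2 + 1)) / (1 - s ^ (p.1 + p.2 + 1))) := by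
  have hsquare : Filter.Tendsto (fun N => Finset.range N ×ˢ Finset.range N) Filter.atTop
      (Filter.atTop : Filter (Finset (ℕ × ℕ))) :=
    Filter.tendsto_atTop_finset_of_monotone
      (fun N M h => Finset.product_subset_product (Finset.range_mono h) (Finset.range_mono h))
      fun p => ⟨max p.1 p.2 + 1, by simp only [Finset.mem_product, Finset.mem_range]; omega⟩
  have hprod := (multipliable_macMahonFactor ht1 hs0 hs1).hasProd
  rw [HasProd, SummationFilter.unconditional_filter] at hprod
  refine tendsto_nhds_unique (tendsto_tsum_inBox _) ?_
  refine (ENNReal.tendsto_ofReal (hprod.comp hsquare)).congr fun N => ?_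
  rw [tsum_inBox ht0 ht1 hs0 hs1, Function.comp_apply, ← Finset.prod_product',
    ENNReal.ofReal_prod_of_nonneg]
  · rfl
  · exact fun p _ => macMahonFactor_nonneg ht1 (pow_nonneg hs0 _)
      (pow_lt_one₀ hs0 hs1 (Nat.succ_ne_zero _))

end PlanePartition

/-- **Generalized MacMahon's formula (Hall–Littlewood's case, full version).**
`∑_{π ∈ P} A_π(t) s^{|π|} = ∏_{n=1}^{∞} [ (1 - t sⁿ) / (1 - sⁿ) ]ⁿ`,
the sum being over all plane partitions, for real `0 ≤ t, s < 1`. -/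
theorem generalized_macmahon_hall_littlewood
    (t s : ℝ) (ht0 : 0 ≤ t) (ht1 : t < 1) (hs0 : 0 ≤ s) (hs1 : s < 1) :
    ∑' π : PlanePartition, Apoly t π * s ^ π.weight =
      ∏' n : ℕ, ((1 - t * s ^ (n + 1)) / (1 - s ^ (n + 1))) ^ (n + 1) := by
  have hnn : ∀ p : ℕ × ℕ, 0 ≤ (1 - t * s ^ (p.1 + p.2 + 1)) / (1 - s ^ (p.1 + p.2 + 1)) :=
    fun p => macMahonFactor_nonneg ht1.le (pow_nonneg hs0 _)
      (pow_lt_one₀ hs0 hs1 (Nat.succ_ne_zero _))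
  have h := congrArg ENNReal.toReal (PlanePartition.tsum_ofReal_Apoly ht0 ht1.le hs0 hs1)
  rw [ENNReal.tsum_toReal_eq fun _ => ENNReal.ofReal_ne_top, ENNReal.toReal_ofReal
    (ge_of_tendsto' (multipliable_macMahonFactor ht1.le hs0 hs1).hasProd
      fun S => Finset.prod_nonneg fun p _ => hnn p)] at h
  rw [← tprod_add_eq_tprod_pow (g := fun n => (1 - t * s ^ (n + 1)) / (1 - s ^ (n + 1)))
    (multipliable_macMahonFactor ht1.le hs0 hs1), ← h]
  exact tsum_congr fun π => (ENNReal.toReal_ofReal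
    (mul_nonneg (π.Apoly_nonneg ht0 ht1.le) (pow_nonneg hs0 _))).symm
end
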